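/- The algebra C_{5,2}(0) of GL₅-invariant polynomial functions on pairs of trace-zero 5×5 matrices has a minimal generating set 𝒫 consisting of 171 bihomogeneous polynomials, namely: (i) 5 symmetric generators tr(xy), tr(x²y²), tr(xyxy), tr(x³y³), tr(x⁴y⁴); (ii) 4 skew-symmetric generators tr(x³y³x²y² − y³x³y²x²), tr(x²yxy²xyxy − y²xyx²yxyx), tr(x³y²xyxy²xy − y³x²yxyx²yx), tr(x⁴y⁴x³y³ − y⁴x⁴y³x³); (iii) the traces of the 81 words x²; x³, x²y; x⁴, x³y; x⁵, x⁴y, x³y², x²yxy; x⁴y², (x²y)², x²y²xy; x⁴y³, x⁴yxy, x³y²xy, x³yxy²; x⁴y²xy, x⁴yx²y, x⁴yxy², x³y³xy, x³y²x²y, x²y²xyxy; x⁴y²x²y, x⁴y²xy², x⁴yx²y², x³y³x²y, x³y²xyxy, x³yxyx²y, x³yxyxy², x²y²xyx²y; x⁴y⁴xy, x⁴y³xy², x⁴y²x³y, x⁴y²x²y², x⁴y²xyxy, x⁴yx²yxy, x⁴yxy²xy, x³y³xyxy, x³y²x²yxy, x³yx²yxy²; x⁴y⁴x²y, x⁴y⁴xy²,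 x⁴y³x³y, x⁴y³x²y², x⁴y³xyxy, x⁴y²x²yxy, x⁴y²xyxy², x⁴yx³yxy, x⁴yx²y²xy, x⁴yx²yxy², x³y²x²y²xy, x³yxyxy²xy; x⁴y⁴x³y, x⁴y⁴x²y², x⁴y³x³y², x⁴y³x²yxy, x⁴y³xy²xy, x⁴y²x³yxy, x⁴y²x²yx²y, x⁴y²xy²x²y, x⁴y²xyx²y², x⁴yx³yx²y, x⁴yx³yxy², x⁴yxyxy²xy, x³y³x²yxy²; x⁴y⁴x³y², x⁴y⁴x²yxy, x⁴y⁴xy²xy, x⁴y³x³yxy, x⁴y³x²y²xy, x⁴y³(x²y)², x⁴y²x³yx²y, x⁴(y²x²)²y, x⁴y²xyxy²xy; x⁴y⁴x³yxy, x⁴y⁴x²y²xy, x⁴y³x³y²xy, x⁴y³x²yx³y; x⁴y⁴x³y²xy, x⁴y³x³y²x²y, x⁴y²x³yx²yxy; and (iv) the 81 polynomials obtained from those in (iii) by interchanging x and y. The polynomials in (iii) and (iv) are neither symmetric nor skew-symmetric, the map f(x,y) ↦ f(y,x) is a bijection from (iii) to (iv), and no proper subset of 𝒫 generates C_{5,2}(0)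 as a unital K-algebra. -/

import Mathlib

open Matrix

noncomputable section

/-- Index type for the entries of a pair of generic `n × n` matrices:
`Sum.inl (i,j)` indexes the `(i,j)` entry of `x`, `Sum.inr (i,j)` that of `y`. -/
abbrev MatVar (n : ℕ) := (Fin n × Fin n) ⊕ (Fin n × Fin n)

/-- The substitution sending the variables to the entries of the pair `(A, B)`. -/
def pairSub {K : Type*} [CommSemiring K] {n : ℕ} (A B : Matrix (Fin n) (Fin n) K) :
    MatVar n → K
  | Sum.inl ij => A ij.1 ij.2
  | Sum.inr ij => B ij.1 ij.2

/-- The space `M_n(0)` of trace-zero `n × n` matrices. -/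
def sl (K : Type*) [Field K] (n : ℕ) : Submodule K (Matrix (Fin n) (Fin n) K) :=
  LinearMap.ker (Matrix.traceLinearMap (Fin n) K K)

/-- Conjugation of a trace-zero matrix by an invertible matrix. -/
def glConj {K : Type*} [Field K] {n : ℕ} (a : GL (Fin n) K) (A : sl K n) : sl K n :=
  ⟨(a : Matrix (Fin n) (Fin n) K) * A.1 * ((a⁻¹ : GL (Fin n) K) : Matrix (Fin n) (Fin n) K), by
    have hA : Matrix.trace A.1 = 0 := A.2
    have h1 : ((a⁻¹ : GL (Fin n) K) : Matrix (Fin n) (Fin n) K) * (a : Matrix (Fin n) (Fin n) K) = 1 :=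
      a.inv_mul
    have h : Matrix.trace ((a : Matrix (Fin n) (Fin n) K) * A.1 *
        ((a⁻¹ : GL (Fin n) K) : Matrix (Fin n) (Fin n) K)) = Matrix.trace A.1 := by
      rw [Matrix.trace_mul_cycle, h1, one_mul]
    show _ ∈ sl K n
    simp only [sl, LinearMap.mem_ker, Matrix.traceLinearMap_apply]
    rw [h, hA]⟩

/-- A function on pairs of trace-zero matrices is a polynomial function if it is the
restriction of a polynomial in the matrix entries. -/
def IsPolyFun0 {K : Type*} [Field K] {n : ℕ} (f : sl K n × sl K n → K) : Prop :=
  ∃ F : MvPolynomial (MatVar n) K, ∀ v : sl K n × sl K n,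
    f v = MvPolynomial.eval (pairSub (v.1 : Matrix (Fin n) (Fin n) K)
      (v.2 : Matrix (Fin n) (Fin n) K)) F

/-- The algebra `C_{n,2}(0)` of `GLₙ`-invariant polynomial functions on pairs of
trace-zero `n × n` matrices, realized as a subalgebra of the algebra of `K`-valued
functions. -/
def pureAlg0 (K : Type*) [Field K] (n : ℕ) : Subalgebra K (sl K n × sl K n → K) where
  carrier := {f | IsPolyFun0 f ∧ ∀ (a : GL (Fin n) K) (v : sl K n × sl K n),
    f (glConj a v.1, glConj a v.2) = f v}
  mul_mem' := by
    rintro f g ⟨⟨F, hF⟩, hfi⟩ ⟨⟨G, hG⟩, hgi⟩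
    exact ⟨⟨F * G, fun v => by simp [Pi.mul_apply, hF v, hG v]⟩,
      fun a v => by simp only [Pi.mul_apply, hfi a v, hgi a v]⟩
  add_mem' := by
    rintro f g ⟨⟨F, hF⟩, hfi⟩ ⟨⟨G, hG⟩, hgi⟩
    exact ⟨⟨F + G, fun v => by simp [Pi.add_apply, hF v, hG v]⟩,
      fun a v => by simp only [Pi.add_apply, hfi a v, hgi a v]⟩
  algebraMap_mem' := fun c =>
    ⟨⟨MvPolynomial.C c, fun v => by simp⟩, fun a v => rfl⟩

/-- A function on pairs of trace-zero matrices is bihomogeneous of bidegree `(p, q)`. -/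
def BiHomogFun0 {K : Type*} [Field K] {n : ℕ} (f : sl K n × sl K n → K) (p q : ℕ) : Prop :=
  ∀ (c d : K) (v : sl K n × sl K n), f (c • v.1, d • v.2) = c ^ p * d ^ q * f v

/-- A function on pairs of trace-zero matrices is homogeneous of total degree `d`. -/
def HomogFun0 {K : Type*} [Field K] {n : ℕ} (f : sl K n × sl K n → K) (d : ℕ) : Prop :=
  ∀ (c : K) (v : sl K n × sl K n), f (c • v.1, c • v.2) = c ^ d * f v

/-- A symmetric function of the pair. -/
def IsSymmFun0 {K : Type*} [Field K] {n : ℕ} (f : sl K n × sl K n → K) : Prop :=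
  ∀ v : sl K n × sl K n, f (v.2, v.1) = f v

/-- A skew-symmetric function of the pair. -/
def IsSkewFun0 {K : Type*} [Field K] {n : ℕ} (f : sl K n × sl K n → K) : Prop :=
  ∀ v : sl K n × sl K n, f (v.2, v.1) = - f v

/-- Evaluation of the word `x^{p₁} y^{q₁} ⋯ x^{p_k} y^{q_k}` encoded by the list
`[(p₁,q₁),…,(p_k,q_k)]` at the pair of matrices `(A, B)`. -/
def wordEval {K : Type*} [Field K] {n : ℕ} (l : List (ℕ × ℕ))
    (A B : Matrix (Fin n) (Fin n) K) : Matrix (Fin n) (Fin n) K :=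
  (l.map fun pq => A ^ pq.1 * B ^ pq.2).prod

/-- The trace of a word in a pair of trace-zero matrices, as a function. -/
def wordTr {K : Type*} [Field K] {n : ℕ} (l : List (ℕ × ℕ)) : sl K n × sl K n → K :=
  fun v => Matrix.trace (wordEval l (v.1 : Matrix (Fin n) (Fin n) K) (v.2 : Matrix (Fin n) (Fin n) K))

/-- The trace of a word in a pair of trace-zero matrices with the two arguments
interchanged, as a function. -/
def wordTrSwap {K : Type*} [Field K] {n : ℕ} (l : List (ℕ × ℕ)) : sl K n × sl K n → K :=
  fun v => Matrix.trace (wordEval l (v.2 : Matrix (Fin n) (Fin n) K) (v.1 : Matrix (Fin n) (Fin n) K))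

/-- The five symmetric words `xy, x²y², xyxy, x³y³, x⁴y⁴`. -/
def symWords : List (List (ℕ × ℕ)) :=
  [[(1,1)], [(2,2)], [(1,1),(1,1)], [(3,3)], [(4,4)]]

/-- The four words `x³y³x²y², x²yxy²xyxy, x³y²xyxy²xy, x⁴y⁴x³y³` giving the
skew-symmetric generators. -/
def skewWords : List (List (ℕ × ℕ)) :=
  [[(3,3),(2,2)], [(2,1),(1,2),(1,1),(1,1)], [(3,2),(1,1),(1,2),(1,1)], [(4,4),(3,3)]]

/-- The 81 words listed in Theorem `gen-C52` for the set `𝒫_d`. -/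
def words81 : List (List (ℕ × ℕ)) :=
  [[(2,0)],
   [(3,0)], [(2,1)],
   [(4,0)], [(3,1)],
   [(5,0)], [(4,1)], [(3,2)], [(2,1),(1,1)],
   [(4,2)], [(2,1),(2,1)], [(2,2),(1,1)],
   [(4,3)], [(4,1),(1,1)], [(3,2),(1,1)], [(3,1),(1,2)],
   [(4,2),(1,1)], [(4,1),(2,1)], [(4,1),(1,2)], [(3,3),(1,1)], [(3,2),(2,1)],
     [(2,2),(1,1),(1,1)],
   [(4,2),(2,1)], [(4,2),(1,2)], [(4,1),(2,2)], [(3,3),(2,1)], [(3,2),(1,1),(1,1)],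
     [(3,1),(1,1),(2,1)], [(3,1),(1,1),(1,2)], [(2,2),(1,1),(2,1)],
   [(4,4),(1,1)], [(4,3),(1,2)], [(4,2),(3,1)], [(4,2),(2,2)], [(4,2),(1,1),(1,1)],
     [(4,1),(2,1),(1,1)], [(4,1),(1,2),(1,1)], [(3,3),(1,1),(1,1)], [(3,2),(2,1),(1,1)],
     [(3,1),(2,1),(1,2)],
   [(4,4),(2,1)], [(4,4),(1,2)], [(4,3),(3,1)], [(4,3),(2,2)], [(4,3),(1,1),(1,1)],
     [(4,2),(2,1),(1,1)], [(4,2),(1,1),(1,2)], [(4,1),(3,1),(1,1)], [(4,1),(2,2),(1,1)],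
     [(4,1),(2,1),(1,2)], [(3,2),(2,2),(1,1)], [(3,1),(1,1),(1,2),(1,1)],
   [(4,4),(3,1)], [(4,4),(2,2)], [(4,3),(3,2)], [(4,3),(2,1),(1,1)], [(4,3),(1,2),(1,1)],
     [(4,2),(3,1),(1,1)], [(4,2),(2,1),(2,1)], [(4,2),(1,2),(2,1)], [(4,2),(1,1),(2,2)],
     [(4,1),(3,1),(2,1)], [(4,1),(3,1),(1,2)], [(4,1),(1,1),(1,2),(1,1)],
     [(3,3),(2,1),(1,2)],
   [(4,4),(3,2)], [(4,4),(2,1),(1,1)], [(4,4),(1,2),(1,1)], [(4,3),(3,1),(1,1)],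
     [(4,3),(2,2),(1,1)], [(4,3),(2,1),(2,1)], [(4,2),(3,1),(2,1)], [(4,2),(2,2),(2,1)],
     [(4,2),(1,1),(1,2),(1,1)],
   [(4,4),(3,1),(1,1)], [(4,4),(2,2),(1,1)], [(4,3),(3,2),(1,1)], [(4,3),(2,1),(3,1)],
   [(4,4),(3,2),(1,1)], [(4,3),(3,2),(2,1)], [(4,2),(3,1),(2,1),(1,1)]]

/-- The set `𝒫_s` of the 5 symmetric generators. -/
def gensS (K : Type*) [Field K] : Set (sl K 5 × sl K 5 → K) :=
  (fun l => (wordTr l : sl K 5 × sl K 5 → K)) '' {l | l ∈ symWords}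

/-- The set `𝒫_k` of the 4 skew-symmetric generators
`tr(w(x,y)) − tr(w(y,x))` for `w` in `skewWords`. -/
def gensK (K : Type*) [Field K] : Set (sl K 5 × sl K 5 → K) :=
  (fun l => (wordTr l - wordTrSwap l : sl K 5 × sl K 5 → K)) '' {l | l ∈ skewWords}

/-- The set `𝒫_d` consisting of the traces of the 81 words of `words81`. -/
def gensD (K : Type*) [Field K] : Set (sl K 5 × sl K 5 → K) :=
  (fun l => (wordTr l : sl K 5 × sl K 5 → K)) '' {l | l ∈ words81}

/-- The set `𝒫'_d` obtained from `𝒫_d` by interchanging `x` and `y`. -/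
def gensD' (K : Type*) [Field K] : Set (sl K 5 × sl K 5 → K) :=
  (fun l => (wordTrSwap l : sl K 5 × sl K 5 → K)) '' {l | l ∈ words81}

/-- The generating set `𝒫 = 𝒫_s ∪ 𝒫_k ∪ 𝒫_d ∪ 𝒫'_d` of `C_{5,2}(0)`. -/
def gensP (K : Type*) [Field K] : Set (sl K 5 × sl K 5 → K) :=
  gensS K ∪ gensK K ∪ gensD K ∪ gensD' K

namespace C520
open Equiv

abbrev Wd := List Bool

def trP {R : Type*} [CommRing R] {n d : ℕ} (σ : Perm (Fin d))
    (A : Fin d → Matrix (Fin n) (Fin n) R) : R :=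
  ∑ i : Fin d → Fin n, ∏ k, A k (i (σ.symm k)) (i k)

theorem sum_cons {R : Type*} [AddCommMonoid R] {X : Type*} [Fintype X] {d : ℕ} (f : (Fin (d+1) → X) → R) :
    ∑ i, f i = ∑ i : Fin d → X, ∑ x : X, f (Fin.cons x i) := by
  rw [Finset.sum_comm, ← Fintype.sum_prod_type', ← (Fin.consEquiv (fun _ : Fin (d+1) => X)).sum_comp]
  rfl

theorem dec_inv_zero {d : ℕ} (p : Fin (d+1)) (e : Perm (Fin d)) (k : Fin (d+1)) :
    (Perm.decomposeFin.symm (p, e)).symm k =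
      (Perm.decomposeFin.symm (0, e.symm)) (swap 0 p k) := by
  rw [Equiv.symm_apply_eq]
  have h : ∀ j, Perm.decomposeFin.symm (0, e) (Perm.decomposeFin.symm (0, e.symm) j) = j := by
    intro j
    refine Fin.cases ?_ (fun j => ?_) j <;> simp
  have h2 : ∀ j, Perm.decomposeFin.symm (p, e) j = swap 0 p (Perm.decomposeFin.symm (0, e) j) := by
    intro j
    refine Fin.cases ?_ (fun j => ?_) j <;> simp
  rw [h2, h]; simp

theorem trP_zero {R : Type*} [CommRing R] {n d : ℕ} (σ : Perm (Fin d))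
    (A : Fin (d+1) → Matrix (Fin n) (Fin n) R) :
    trP (Perm.decomposeFin.symm (0, σ)) A = (A 0).trace * trP σ (Fin.tail A) := by
  unfold trP
  rw [sum_cons, Finset.mul_sum]
  refine Finset.sum_congr rfl fun i _ => ?_
  simp only [Fin.prod_univ_succ, dec_inv_zero, Equiv.swap_self, Equiv.refl_apply]
  simp [Matrix.trace, Finset.sum_mul, Fin.tail]

theorem trP_succ {R : Type*} [CommRing R] {n d : ℕ} (σ : Perm (Fin d)) (r : Fin d)
    (A : Fin (d+1) → Matrix (Fin n) (Fin n) R) :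
    trP (Perm.decomposeFin.symm (r.succ, σ)) A
      = trP σ (Function.update (Fin.tail A) r (A 0 * A r.succ)) := by
  unfold trP
  rw [sum_cons]
  refine Finset.sum_congr rfl fun i _ => ?_
  simp only [Fin.prod_univ_succ, dec_inv_zero]
  rw [← Finset.mul_prod_erase _ _ (Finset.mem_univ r)]
  simp only [Function.update_self, Matrix.mul_apply, Finset.sum_mul]
  refine Finset.sum_congr rfl fun x _ => ?_
  rw [← Finset.mul_prod_erase _ _ (Finset.mem_univ r)]
  simp only [swap_apply_left, swap_apply_right, Perm.decomposeFin_symm_apply_succ, swap_self,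
    Perm.decomposeFin_symm_apply_zero, Fin.cons_zero, Fin.cons_succ, Equiv.refl_apply]
  rw [← mul_assoc]
  congr 1
  refine Finset.prod_congr rfl fun s hs => ?_
  have hs : s ≠ r := (Finset.mem_erase.1 hs).1
  rw [Function.update_of_ne hs, swap_apply_of_ne_of_ne (Fin.succ_ne_zero _) (by simpa using hs)]
  simp [Fin.tail]

/-- fundamental trace identity -/
theorem FTI {R : Type*} [CommRing R] {n d : ℕ} (h : n < d)
    (A : Fin d → Matrix (Fin n) (Fin n) R) :
    ∑ σ : Perm (Fin d), (Perm.sign σ : ℤ) • trP σ A = 0 := by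
  unfold trP
  simp only [Finset.smul_sum]
  rw [Finset.sum_comm]
  refine Finset.sum_eq_zero fun i _ => ?_
  obtain ⟨a, b, hab, hi⟩ := Fintype.exists_ne_map_eq_of_card_lt i (by simpa using h)
  have := Matrix.det_zero_of_row_eq (M := Matrix.of fun j k => A k (i j) (i k)) hab (by ext k; simp [hi])
  rw [Matrix.det_apply] at this
  rw [← this]
  refine Fintype.sum_equiv (Equiv.inv (Perm (Fin d))) _ _ fun σ => ?_
  simp [Units.smul_def, Perm.inv_def]

/-- sum of `t` over the ways to glue the words to a cycle -/
def Cy {M : Type*} [AddCommGroup M] (t : Wd → M) : (n : ℕ) → (Fin (n+1) → Wd) → M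
  | 0, a => t (a 0)
  | n+1, a => ∑ r : Fin (n+1), Cy t n (Function.update (Fin.tail a) r (a 0 ++ a r.succ))

theorem sum_perm {M : Type*} [AddCommGroup M] {d : ℕ} (f : Perm (Fin (d+1)) → M) :
    ∑ σ, (Perm.sign σ : ℤ) • f σ = ∑ e : Perm (Fin d), (Perm.sign e : ℤ) • f (Perm.decomposeFin.symm (0, e))
      - ∑ r : Fin d, ∑ e : Perm (Fin d), (Perm.sign e : ℤ) • f (Perm.decomposeFin.symm (r.succ, e)) := by
  rw [← Perm.decomposeFin.symm.sum_comp, Fintype.sum_prod_type, Fin.sum_univ_succ, sub_eq_add_neg,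
    ← Finset.sum_neg_distrib]
  simp [Perm.decomposeFin.symm_sign]

theorem sum_eq_Cy {M : Type*} [AddCommGroup M] (t : Wd → M) (P : (n : ℕ) → (Fin (n+1) → Wd) → Prop)
    (hP : ∀ n a r, P (n+1) a → P n (Function.update (Fin.tail a) r (a 0 ++ a r.succ)))
    (f : (n : ℕ) → Perm (Fin (n+1)) → (Fin (n+1) → Wd) → M)
    (h0 : ∀ a, P 0 a → f 0 1 a = t (a 0))
    (h1 : ∀ n e a, P (n+1) a → f (n+1) (Perm.decomposeFin.symm (0, e)) a = 0)
    (h2 : ∀ n e r a, P (n+1) a → f (n+1) (Perm.decomposeFin.symm (r.succ, e)) a =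
      f n e (Function.update (Fin.tail a) r (a 0 ++ a r.succ))) :
    ∀ n a, P n a → ∑ σ, (Perm.sign σ : ℤ) • f n σ a = (-1 : ℤ) ^ n • Cy t n a
  | 0, a, h => by
    have : (Finset.univ : Finset (Perm (Fin (0+1)))) = {1} := by decide
    rw [this, Finset.sum_singleton]
    simpa [Cy] using h0 a h
  | n+1, a, h => by
    rw [sum_perm]
    simp only [h1 n _ a h, h2 n _ _ a h, smul_zero, Finset.sum_const_zero, zero_sub]
    rw [Finset.sum_congr rfl fun r _ => sum_eq_Cy t P hP f h0 h1 h2 n _ (hP n a r h)]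
    rw [← Finset.smul_sum, pow_succ, mul_smul]
    simp [Cy]

def glue {n : ℕ} (a : Fin (n+1) → Wd) (r : Fin n) : Fin n → Wd :=
  Function.update (Fin.tail a) r (a 0 ++ a r.succ)

theorem glue_ne {n : ℕ} (a : Fin (n+1) → Wd) (r : Fin n) (h : ∀ i, a i ≠ []) (i) : glue a r i ≠ [] := by
  unfold glue
  by_cases hi : i = r
  · subst hi; simp [h]
  · simpa [hi, Fin.tail] using h i.succ

theorem glue_sum {n : ℕ} (a : Fin (n+1) → Wd) (r : Fin n) :
    ∑ i, (glue a r i).length = ∑ i, (a i).length := by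
  unfold glue
  rw [Fin.sum_univ_succ, ← Finset.add_sum_erase _ _ (Finset.mem_univ r),
    ← Finset.add_sum_erase Finset.univ (fun i : Fin n => (a i.succ).length) (Finset.mem_univ r), ← add_assoc]
  congr 1
  · simp
  · refine Finset.sum_congr rfl fun s hs => ?_
    rw [Function.update_of_ne (Finset.mem_erase.1 hs).1]; rfl

section ev
variable {R : Type*} [CommRing R] {n : ℕ} (X Y : Matrix (Fin n) (Fin n) R)

def ev (w : Wd) : Matrix (Fin n) (Fin n) R := (w.map fun b => bif b then Y else X).prod

theorem ev_append (u v : Wd) : ev X Y (u ++ v) = ev X Y u * ev X Y v := by simp [ev]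

theorem ev_glue {d : ℕ} (a : Fin (d+1) → Wd) (r : Fin d) :
    (fun i => ev X Y (glue a r i)) = Function.update (Fin.tail fun i => ev X Y (a i)) r
      (ev X Y (a 0) * ev X Y (a r.succ)) := by
  funext i
  unfold glue
  by_cases hi : i = r
  · subst hi; simp [ev_append]
  · simp [hi, Fin.tail]

theorem trP_mem (A : Subring R) : ∀ (d : ℕ) (σ : Perm (Fin d)) (a : Fin d → Wd), (∀ i, a i ≠ []) →
    (∀ w : Wd, w ≠ [] → w.length ≤ ∑ i, (a i).length → (ev X Y w).trace ∈ A) →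
    trP σ (fun i => ev X Y (a i)) ∈ A
  | 0, σ, a, _, _ => by simp [trP, A.one_mem]
  | d+1, σ, a, h0, h => by
    obtain ⟨⟨r, e⟩, rfl⟩ := Perm.decomposeFin.symm.surjective σ
    refine Fin.cases ?_ (fun r => ?_) r
    · rw [trP_zero]
      rw [Fin.sum_univ_succ] at h
      exact A.mul_mem (h _ (h0 0) (by omega))
        (trP_mem A d e (Fin.tail a) (fun i => h0 _) fun w hw hl => h w hw (hl.trans (by simp [Fin.tail])))
    · rw [trP_succ, ← ev_glue]
      exact trP_mem A d e _ (glue_ne a r h0) (by rwa [glue_sum])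

/-- the trace identity modulo products -/
theorem Cy_tr (A : Subring R) (N : AddSubgroup R) (hN : ∀ x ∈ A, x ∈ N) (L : ℕ)
    (hA : ∀ w : Wd, w ≠ [] → w.length < L → (ev X Y w).trace ∈ A) {d : ℕ} (hd : n ≤ d)
    (a : Fin (d+1) → Wd) (h0 : ∀ i, a i ≠ []) (hL : ∑ i, (a i).length = L) :
    Cy (fun w => (QuotientAddGroup.mk (ev X Y w).trace : R ⧸ N)) d a = 0 := by
  have key := sum_eq_Cy (fun w => (QuotientAddGroup.mk (ev X Y w).trace : R ⧸ N))
    (fun n a => (∀ i, a i ≠ []) ∧ ∑ i, (a i).length = L)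
    (fun n a r h => ⟨glue_ne a r h.1, (glue_sum a r).trans h.2⟩)
    (fun n σ a => QuotientAddGroup.mk (trP σ (fun i => ev X Y (a i))))
    (fun a h => by
      congr 1
      unfold trP
      rw [sum_cons]
      simp only [Finset.univ_unique, Finset.sum_singleton, Matrix.trace, Matrix.diag]
      exact Finset.sum_congr rfl fun x _ => by simp [Perm.one_symm])
    (fun n e a h => by
      rw [QuotientAddGroup.eq_zero_iff, trP_zero]
      have h2 := h.2
      rw [Fin.sum_univ_succ] at h2
      have h3 : 0 < (a 0).length := List.length_pos_iff.2 (h.1 _)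
      have h4 : 0 < (a (Fin.succ 0)).length := List.length_pos_iff.2 (h.1 _)
      have h5 : (a (Fin.succ 0)).length ≤ ∑ i : Fin (n+1), (a i.succ).length :=
        Finset.single_le_sum (f := fun i : Fin (n+1) => (a i.succ).length) (fun _ _ => Nat.zero_le _) (Finset.mem_univ 0)
      refine hN _ (A.mul_mem (hA _ (h.1 0) (by omega)) (trP_mem X Y A _ e (Fin.tail a) (fun i => h.1 _)
        fun w hw hl => hA w hw ?_))
      simp only [Fin.tail] at hl
      omega)
    (fun n e r a h => by rw [trP_succ, ← ev_glue]; rfl) d a ⟨h0, hL⟩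
  have h2 := FTI (Nat.lt_succ_of_le hd) (fun i => ev X Y (a i))
  have h3 : ∑ σ : Perm (Fin (d+1)), (Perm.sign σ : ℤ) •
      (QuotientAddGroup.mk (trP σ (fun i => ev X Y (a i))) : R ⧸ N) = 0 := by
    have := congrArg (QuotientAddGroup.mk' N) h2
    rw [map_sum, map_zero] at this
    rw [← this]
    exact Finset.sum_congr rfl fun σ _ => (map_zsmul (QuotientAddGroup.mk' N) _ _).symm
  rw [h3] at key
  rcases Int.even_or_odd' d with ⟨k, hk⟩
  have := neg_one_pow_eq_or ℤ d
  rcases this with h | h <;> rw [h] at key <;> simpa using key.symm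

end ev

end C520

namespace C520
open Equiv

def Full {α : Type*} (l : List α) : Prop := l.Nodup ∧ ∀ x, x ∈ l

theorem rotated_phi {M α : Type*} (φ : Wd → M) (hφ : ∀ u v, φ (u ++ v) = φ (v ++ u)) (a : α → Wd)
    {l l' : List α} (h : l ~r l') : φ (l.flatMap a) = φ (l'.flatMap a) := by
  obtain ⟨k, hk, rfl⟩ := List.isRotated_iff_mod.1 h
  rw [List.rotate_eq_drop_append_take hk, List.flatMap_append, hφ, ← List.flatMap_append,
    List.take_append_drop]

theorem full_rot {α : Type*} {l : List α} (hl : Full l) (x : α) : ∃ m, l ~r (x :: m) ∧ Full (x :: m) := by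
  obtain ⟨s, t, rfl⟩ := List.append_of_mem (hl.2 x)
  have h : (s ++ x :: t) ~r (x :: (t ++ s)) := by
    refine ⟨s.length, ?_⟩
    simp
  exact ⟨_, h, h.nodup_iff.1 hl.1, fun y => h.mem_iff.1 (hl.2 y)⟩

theorem formPerm_conj {α β : Type*} [DecidableEq α] [DecidableEq β] (π : α ≃ β) : ∀ l : List α,
    ∀ x, (l.map π).formPerm (π x) = π (l.formPerm x)
  | [], x => by simp
  | [y], x => by simp
  | y :: z :: l, x => by
    have := formPerm_conj π (z :: l) x
    simp only [List.map_cons, List.formPerm_cons_cons, Perm.mul_apply] at this ⊢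
    rw [this]
    simp only [swap_apply_def, π.injective.eq_iff]
    split_ifs <;> rfl

open Classical in
def Phi {M : Type*} [AddCommGroup M] (φ : Wd → M) {n : ℕ} (σ : Perm (Fin n)) (a : Fin n → Wd) : M :=
  if h : ∃ l : List (Fin n), Full l ∧ l.formPerm = σ then φ (h.choose.flatMap a) else 0

section
variable {M : Type*} [AddCommGroup M]

theorem Phi_eq (φ : Wd → M) (hφ : ∀ u v, φ (u ++ v) = φ (v ++ u)) {n : ℕ} (a : Fin n → Wd) (l : List (Fin n)) (hl : Full l) :
    Phi φ l.formPerm a = φ (l.flatMap a) := by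
  have h : ∃ l' : List (Fin n), Full l' ∧ l'.formPerm = l.formPerm := ⟨l, hl, rfl⟩
  unfold Phi
  rw [dif_pos h]
  obtain ⟨h1, h2⟩ := h.choose_spec
  refine rotated_phi φ hφ a ?_
  rcases (List.formPerm_eq_formPerm_iff h1.1 hl.1).1 h2 with h3 | ⟨h3, h4⟩
  · exact h3
  · have hp : h.choose.Perm l := (List.perm_ext_iff_of_nodup h1.1 hl.1).2 fun x => by simp [h1.2, hl.2]
    have : h.choose = l := by
      generalize h.choose = l' at *
      match l, l', h4, h3, hp with
      | [], l', _, _, hp => exact List.perm_nil.1 hp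
      | [x], l', _, _, hp => exact List.perm_singleton.1 hp
    rw [this]

theorem Phi_conj (φ : Wd → M) (hφ : ∀ u v, φ (u ++ v) = φ (v ++ u)) {n : ℕ} (π σ : Perm (Fin n)) (a : Fin n → Wd) :
    Phi φ (π * σ * π⁻¹) (a ∘ π.symm) = Phi φ σ a := by
  have hc : ∀ l : List (Fin n), (l.map π).formPerm = π * l.formPerm * π⁻¹ := by
    intro l
    ext x
    obtain ⟨y, rfl⟩ := π.surjective x
    rw [formPerm_conj]; simp
  have hf : ∀ (π : Perm (Fin n)) (l : List (Fin n)), Full l → Full (l.map π) := fun π l hl =>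
    ⟨(List.nodup_map_iff π.injective).2 hl.1, fun x => List.mem_map.2 ⟨π.symm x, hl.2 _, by simp⟩⟩
  by_cases h : ∃ l : List (Fin n), Full l ∧ l.formPerm = σ
  · obtain ⟨l, hl, rfl⟩ := h
    rw [← hc, Phi_eq φ hφ _ _ (hf π l hl), Phi_eq φ hφ _ _ hl, List.flatMap_map]
    simp
  · have h' : ¬ ∃ l : List (Fin n), Full l ∧ l.formPerm = π * σ * π⁻¹ := by
      rintro ⟨l, hl, he⟩
      refine h ⟨l.map (π⁻¹ : Perm (Fin n)), hf _ l hl, ?_⟩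
      ext x
      have := formPerm_conj π⁻¹ l (π x)
      rw [he] at this
      simp at this
      exact congrArg _ this
    unfold Phi
    rw [dif_neg h, dif_neg h']

theorem dec_eq {d : ℕ} (p : Fin (d+1)) (e : Perm (Fin d)) :
    Perm.decomposeFin.symm (p, e) = swap 0 p * Perm.decomposeFin.symm (0, e) := by
  ext j
  refine congrArg _ (Fin.cases ?_ (fun j => ?_) j) <;> simp

theorem dec_mul {d : ℕ} (p : Fin (d+1)) (e e' : Perm (Fin d)) :
    Perm.decomposeFin.symm (p, e) * Perm.decomposeFin.symm (0, e') = Perm.decomposeFin.symm (p, e * e') := by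
  ext j
  refine congrArg _ (Fin.cases ?_ (fun j => ?_) j) <;> simp

theorem dec_form {d : ℕ} (l : List (Fin d)) :
    Perm.decomposeFin.symm (0, l.formPerm) = (l.map Fin.succ).formPerm := by
  ext j
  refine congrArg _ (Fin.cases ?_ (fun j => ?_) j)
  · rw [List.formPerm_apply_of_notMem (by simp)]; simp
  · rw [Perm.decomposeFin_symm_apply_succ, swap_self, Equiv.refl_apply]
    symm
    induction l with
    | nil => simp
    | cons y l ih => cases l with
      | nil => simp
      | cons z l =>
        simp only [List.map_cons, List.formPerm_cons_cons, Perm.mul_apply] at ih ⊢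
        rw [ih]
        simp only [swap_apply_def, Fin.succ_inj]
        split_ifs <;> rfl

theorem Phi_zero (φ : Wd → M) (hφ : ∀ u v, φ (u ++ v) = φ (v ++ u)) {n : ℕ} (e : Perm (Fin (n+1))) (a : Fin (n+2) → Wd) :
    Phi φ (Perm.decomposeFin.symm (0, e)) a = 0 := by
  unfold Phi
  rw [dif_neg]
  rintro ⟨l, hl, he⟩
  have h2 : l.formPerm 0 = 0 := by rw [he]; simp
  replace h2 := (List.formPerm_apply_mem_eq_self_iff _ hl.1 _ (hl.2 0)).1 h2
  have h3 : (0 : Fin (n+2)) ∈ l := hl.2 0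
  have h4 : (1 : Fin (n+2)) ∈ l := hl.2 1
  match l, h2 with
  | [], _ => simp at h3
  | [x], _ =>
    simp at h3 h4
    rw [← h3] at h4
    simp at h4

theorem Phi_succ (φ : Wd → M) (hφ : ∀ u v, φ (u ++ v) = φ (v ++ u)) {n : ℕ} (e : Perm (Fin n)) (r : Fin n) (a : Fin (n+1) → Wd) :
    Phi φ (Perm.decomposeFin.symm (r.succ, e)) a = Phi φ e (glue a r) := by
  by_cases h : ∃ l : List (Fin n), Full l ∧ l.formPerm = e
  · obtain ⟨l, hl, rfl⟩ := h
    obtain ⟨m, hm, hm2⟩ := full_rot hl r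
    rw [List.formPerm_eq_of_isRotated hl.1 hm, Phi_eq φ hφ _ _ hm2, dec_eq, dec_form, List.map_cons,
      ← List.formPerm_cons_cons, Phi_eq φ hφ]
    · congr 1
      have h1 : r ∉ m := (List.nodup_cons.1 hm2.1).1
      simp only [List.flatMap_cons, List.flatMap_map]
      unfold glue
      simp only [Function.update_self, List.append_assoc]
      congr 2
      refine List.flatMap_congr fun x hx => ?_
      rw [Function.update_of_ne (fun h : x = r => h1 (h ▸ hx))]; rfl
    · constructor
      · rw [List.nodup_cons, ← List.map_cons, List.nodup_map_iff (Fin.succ_injective _)]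
        exact ⟨by simp [List.mem_map, Fin.succ_ne_zero, Ne.symm], hm2.1⟩
      · intro x
        refine Fin.cases (by simp) (fun x => ?_) x
        have := hm2.2 x
        simp at this
        simp [this]
  · have h' : ¬ ∃ l : List (Fin (n+1)), Full l ∧ l.formPerm = Perm.decomposeFin.symm (r.succ, e) := by
      rintro ⟨l, hl, he⟩
      obtain ⟨m, hm, hm2⟩ := full_rot hl 0
      rw [List.formPerm_eq_of_isRotated hl.1 hm] at he
      match m, hm2 with
      | [], hm2 => have := hm2.2 r.succ; simp at this
      | y :: m, hm2 =>
        have h0 : (0 : Fin (n+1)) ∉ y :: m := (List.nodup_cons.1 hm2.1).1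
        have hy : y = r.succ := by
          have := congrArg (· 0) he
          simp only [List.formPerm_cons_cons, Perm.mul_apply] at this
          rw [List.formPerm_apply_of_notMem h0] at this
          simpa using this
        subst hy
        rw [List.formPerm_cons_cons, dec_eq, mul_right_inj] at he
        obtain ⟨m', rfl⟩ : ∃ m' : List (Fin n), m = m'.map Fin.succ := by
          refine ⟨m.filterMap fun x => Fin.cases none some x, ?_⟩
          rw [List.map_filterMap]
          symm
          have hz : ∀ x ∈ m, (Option.map Fin.succ (Fin.cases (motive := fun _ => Option (Fin n)) none some x)) = some x := by
            intro x hx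
            have : x ≠ 0 := fun h => h0 (by simp [← h, hx])
            obtain ⟨y, rfl⟩ := Fin.exists_succ_eq.2 this
            simp
          rw [List.filterMap_congr hz]; simp
        rw [← List.map_cons, ← dec_form] at he
        have he2 := Perm.decomposeFin.symm.injective he
        simp only [Prod.mk.injEq, true_and] at he2
        refine h ⟨r :: m', ⟨?_, ?_⟩, he2⟩
        · have := (List.nodup_cons.1 hm2.1).2
          rwa [← List.map_cons, List.nodup_map_iff (Fin.succ_injective _)] at this
        · intro x
          have := hm2.2 x.succ
          simpa using this
    unfold Phi
    rw [dif_neg h, dif_neg h']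

theorem Phi_sum (φ : Wd → M) (hφ : ∀ u v, φ (u ++ v) = φ (v ++ u)) (n : ℕ) (a : Fin (n+1) → Wd) :
    ∑ σ, (Perm.sign σ : ℤ) • Phi φ σ a = (-1 : ℤ) ^ n • Cy φ n a := by
  refine sum_eq_Cy φ (fun _ _ => True) (fun _ _ _ h => h) (fun _ σ a => Phi φ σ a) ?_ ?_ ?_ n a trivial
  · intro a _
    have := Phi_eq φ hφ a [0] ⟨by simp, fun x => by simp; omega⟩
    simpa using this
  · exact fun n e a _ => Phi_zero φ hφ e a
  · exact fun n e r a _ => Phi_succ φ hφ e r a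

/-- `Cy` is symmetric -/
theorem Cy_symm (φ : Wd → M) (hφ : ∀ u v, φ (u ++ v) = φ (v ++ u)) (n : ℕ) (a : Fin (n+1) → Wd) (π : Perm (Fin (n+1))) :
    Cy φ n (a ∘ π) = Cy φ n a := by
  have h1 := Phi_sum φ hφ n (a ∘ π)
  have h2 := Phi_sum φ hφ n a
  have : ∑ σ, (Perm.sign σ : ℤ) • Phi φ σ (a ∘ π) = ∑ σ, (Perm.sign σ : ℤ) • Phi φ σ a := by
    refine Fintype.sum_equiv (MulAut.conj π).toEquiv _ _ fun σ => ?_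
    simp only [MulEquiv.toEquiv_eq_coe, MulEquiv.coe_toEquiv, MulAut.conj_apply]
    rw [← Phi_conj φ hφ π σ (a ∘ π)]
    have hs : Perm.sign (π * σ * π⁻¹) = Perm.sign σ := by
      rw [map_mul, map_mul, Perm.sign_inv, mul_right_comm, Int.units_mul_self, one_mul]
    rw [hs]
    simp [Function.comp_assoc]
  rw [h1, h2] at this
  rcases neg_one_pow_eq_or ℤ n with h | h <;> rw [h] at this <;> simpa using this

theorem Phi_alt (φ : Wd → M) (hφ : ∀ u v, φ (u ++ v) = φ (v ++ u)) {m : ℕ} (hC : ∀ a : Fin (m+2) → Wd, (∀ i, a i ≠ []) → Cy φ (m+1) a = 0) :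
    ∀ (d : ℕ) (p : Fin (m+2) ↪ Fin d) (σ : Perm (Fin d)) (a : Fin d → Wd), (∀ i, a i ≠ []) →
    ∑ τ : Perm (Fin (m+2)), (Perm.sign τ : ℤ) • Phi φ (σ * τ.viaEmbedding p) a = 0 := by
  intro d
  induction d with
  | zero => intro p; exact (p 0).elim0
  | succ n ih =>
    intro p σ a ha
    by_cases hs : Function.Surjective p
    · have hcard := Fintype.card_of_bijective ⟨p.injective, hs⟩
      simp only [Fintype.card_fin] at hcard
      obtain rfl : n = m+1 := by omega
      let P : Perm (Fin (m+2)) := Equiv.ofBijective p ⟨p.injective, hs⟩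
      have hv : ∀ τ : Perm (Fin (m+2)), τ.viaEmbedding p = P * τ * P⁻¹ := by
        intro τ
        ext x
        obtain ⟨y, rfl⟩ := P.surjective x
        have : P y = p y := rfl
        rw [this, Perm.viaEmbedding_apply, ← this]
        simp
        rfl
      have h1 := Phi_sum φ hφ (m+1) a
      rw [hC a ha, smul_zero] at h1
      have h2 : ∑ τ : Perm (Fin (m+2)), (Perm.sign τ : ℤ) • Phi φ (σ * τ.viaEmbedding p) a =
          (Perm.sign σ : ℤ) • ∑ τ, (Perm.sign τ : ℤ) • Phi φ τ a := by
        rw [Finset.smul_sum]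
        refine Fintype.sum_equiv ((MulAut.conj P).toEquiv.trans (Equiv.mulLeft σ)) _ _ fun τ => ?_
        simp only [hv, Equiv.trans_apply, MulEquiv.toEquiv_eq_coe, MulEquiv.coe_toEquiv, MulAut.conj_apply, Equiv.coe_mulLeft,
          smul_smul]
        congr 1
        have hs : Perm.sign (P * τ * P⁻¹) = Perm.sign τ := by
          rw [map_mul, map_mul, Perm.sign_inv, mul_right_comm, Int.units_mul_self, one_mul]
        rw [map_mul, hs]
        rcases Int.units_eq_one_or (Perm.sign σ) with h | h <;> simp [h]
      rw [h2, h1, smul_zero]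
    · obtain ⟨q, hq⟩ := not_forall.1 hs
      let π : Perm (Fin (n+1)) := swap q 0
      have hp0 : ∀ x, π (p x) ≠ 0 := fun x h => hq ⟨x, by
        have := congrArg π h; simpa [π] using this⟩
      let p' : Fin (m+2) ↪ Fin n := ⟨fun x => (π (p x)).pred (hp0 x), fun x y h => by
        simpa using Fin.pred_inj.1 h⟩
      have hp' : ∀ x, (p' x).succ = π (p x) := fun x => Fin.succ_pred _ (hp0 x)
      have hE : ∀ τ : Perm (Fin (m+2)), π * τ.viaEmbedding p * π⁻¹ = Perm.decomposeFin.symm (0, τ.viaEmbedding p') := by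
        intro τ
        ext x
        refine congrArg _ ?_
        by_cases hx : ∃ y, π (p y) = x
        · obtain ⟨y, rfl⟩ := hx
          rw [← hp', Perm.decomposeFin_symm_apply_succ, Perm.viaEmbedding_apply, hp', swap_self, Equiv.refl_apply, hp',
            Perm.mul_apply, Perm.mul_apply, show π⁻¹ (π _) = _ from π.symm_apply_apply _, Perm.viaEmbedding_apply]
        · obtain ⟨z, rfl⟩ := π.surjective x
          rw [Perm.mul_apply, Perm.mul_apply, show π⁻¹ (π _) = _ from π.symm_apply_apply _, Perm.viaEmbedding_apply_of_notMem _ _ _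
            (by rintro ⟨y, hy⟩; exact hx ⟨y, by rw [hy]⟩)]
          by_cases h0 : π z = 0
          · rw [h0]; simp
          · obtain ⟨u, hu⟩ := Fin.exists_succ_eq.2 h0
            rw [← hu, Perm.decomposeFin_symm_apply_succ, Perm.viaEmbedding_apply_of_notMem]
            · simp
            · rintro ⟨y, hy⟩
              exact hx ⟨y, by rw [← hp', hy, hu]⟩
      obtain ⟨⟨r, e⟩, hre⟩ := Perm.decomposeFin.symm.surjective (π * σ * π⁻¹)
      have hm : m + 2 ≤ n := by simpa using Fintype.card_le_of_embedding p'
      have hτ : ∀ τ : Perm (Fin (m+2)), Phi φ (σ * τ.viaEmbedding p) a =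
          Phi φ (Perm.decomposeFin.symm (r, e * τ.viaEmbedding p')) (a ∘ π.symm) := by
        intro τ
        rw [← Phi_conj φ hφ π, ← dec_mul, hre, ← hE]
        congr 1
        group
      simp only [hτ]
      revert hτ hre
      refine Fin.cases ?_ (fun r => ?_) r
      · intro _ _
        obtain ⟨n, rfl⟩ : ∃ k, n = k + 1 := ⟨n - 1, by omega⟩
        simp [Phi_zero φ hφ]
      · intro _ _
        simp only [Phi_succ φ hφ]
        exact ih p' e _ (glue_ne _ _ fun i => ha _)

end
end C520

namespace C520
open Equiv

def Alt {K : Type*} [Field K] (n : ℕ) {d : ℕ} (Φ : Perm (Fin d) → K) : Prop :=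
  ∀ (p : Fin (n+1) ↪ Fin d) (σ : Perm (Fin d)),
    ∑ τ : Perm (Fin (n+1)), (Perm.sign τ : ℤ) • Φ (σ * τ.viaEmbedding p) = 0

def dl (K : Type*) [Field K] {n d : ℕ} (ij : (Fin d → Fin n) × (Fin d → Fin n)) (σ : Perm (Fin d)) : K :=
  if ij.1 ∘ σ = ij.2 then 1 else 0

theorem comp_via {X : Type*} {n d : ℕ} (p : Fin n ↪ Fin d) (τ τ' : Perm (Fin n)) (f : Fin d → X)
    (h : ∀ x, f (p (τ x)) = f (p (τ' x))) : f ∘ τ.viaEmbedding p = f ∘ τ'.viaEmbedding p := by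
  funext x
  by_cases hx : x ∈ Set.range p
  · obtain ⟨y, rfl⟩ := hx
    simp [Perm.viaEmbedding_apply, h]
  · simp [Perm.viaEmbedding_apply_of_notMem _ _ _ hx]

theorem dl_alt {K : Type*} [Field K] {n d : ℕ} (ij : (Fin d → Fin n) × (Fin d → Fin n)) :
    Alt n (dl K ij) := by
  intro p σ
  obtain ⟨a, b, hab, hi⟩ := Fintype.exists_ne_map_eq_of_card_lt (fun x => ij.1 (σ (p x))) (by simp)
  have hsw : ∀ y, ij.1 (σ (p (swap a b y))) = ij.1 (σ (p y)) := by
    intro y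
    rw [swap_apply_def]
    split_ifs with h1 h2
    · rw [h1]; exact hi.symm
    · rw [h2]; exact hi
    · rfl
  refine Finset.sum_involution (fun τ _ => swap a b * τ) ?_ ?_ ?_ ?_
  · intro τ _
    have : dl K ij (σ * (swap a b * τ).viaEmbedding p) = dl K ij (σ * τ.viaEmbedding p) := by
      unfold dl
      have := comp_via p (swap a b * τ) τ (ij.1 ∘ σ) (fun x => hsw (τ x))
      simp only [Perm.coe_mul, ← Function.comp_assoc, this]
      congr
    rw [this, ← add_smul]
    simp [Perm.sign_swap hab]
  · intro τ _ _ h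
    have : swap a b = 1 := by simpa using h
    exact hab (swap_eq_one_iff.1 this)
  · simp
  · intro τ _
    simp [← mul_assoc]

def key {d : ℕ} (σ : Perm (Fin d)) : Lex (Fin d → Fin d) := toLex σ

theorem key_inj {d : ℕ} {σ σ' : Perm (Fin d)} (h : key σ = key σ') : σ = σ' :=
  DFunLike.coe_injective (toLex.injective h)

theorem key_lt {d n : ℕ} (p : Fin n ↪ Fin d) (hp : StrictMono p) (σ : Perm (Fin d))
    (hσ : StrictAnti (σ ∘ p)) (τ : Perm (Fin n)) (hτ : τ ≠ 1) : key (σ * τ.viaEmbedding p) < key σ := by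
  have hne : ∃ a, τ a ≠ a := by
    by_contra h
    push Not at h
    exact hτ (Equiv.ext h)
  obtain ⟨a, ha, hmin⟩ : ∃ a, τ a ≠ a ∧ ∀ b < a, τ b = b := by
    have hw := (inferInstance : WellFoundedLT (Fin n)).wf
    refine ⟨hw.min {a | τ a ≠ a} hne, hw.min_mem {a | τ a ≠ a} hne, fun b hb => ?_⟩
    by_contra h
    exact hw.not_lt_min {a | τ a ≠ a} h hb
  have hgt : a < τ a := by
    rcases lt_trichotomy a (τ a) with h | h | h
    · exact h
    · exact absurd h.symm ha
    · exact absurd (τ.injective (hmin _ h)) ha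
  refine ⟨p a, fun j hj => ?_, ?_⟩
  · show σ (τ.viaEmbedding p j) = σ j
    by_cases hx : j ∈ Set.range p
    · obtain ⟨y, rfl⟩ := hx
      rw [Perm.viaEmbedding_apply, hmin _ (hp.lt_iff_lt.1 hj)]
    · rw [Perm.viaEmbedding_apply_of_notMem _ _ _ hx]
  · show σ (τ.viaEmbedding p (p a)) < σ (p a)
    rw [Perm.viaEmbedding_apply]
    exact hσ hgt

theorem dl_lt {d n : ℕ} {K : Type*} [Field K] (σ σ' : Perm (Fin d)) (c : Fin d → Fin n)
    (hc : ∀ j k, j < k → c j = c k → σ j < σ k) (hne : σ' ≠ σ) (h : dl K (c ∘ σ.symm, c) σ' ≠ 0) :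
    key σ < key σ' := by
  have h1 : (c ∘ σ.symm) ∘ σ' = c := by
    by_contra h2
    exact h (if_neg h2)
  have hne' : ∃ a, σ' a ≠ σ a := by
    by_contra h
    push Not at h
    exact hne (Equiv.ext h)
  obtain ⟨k, ha, hmin⟩ : ∃ a, σ' a ≠ σ a ∧ ∀ b < a, σ' b = σ b := by
    have hw := (inferInstance : WellFoundedLT (Fin d)).wf
    refine ⟨hw.min {a | σ' a ≠ σ a} hne', hw.min_mem {a | σ' a ≠ σ a} hne', fun b hb => ?_⟩
    by_contra h
    exact hw.not_lt_min {a | σ' a ≠ σ a} h hb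
  refine ⟨k, fun j hj => (hmin j hj).symm, ?_⟩
  show σ k < σ' k
  have h2 : c (σ.symm (σ' k)) = c k := congrFun h1 k
  have h3 : σ (σ.symm (σ' k)) = σ' k := by simp
  rcases lt_trichotomy (σ.symm (σ' k)) k with h | h | h
  · have := hmin _ h
    rw [h3] at this
    exact absurd (σ'.injective this) h.ne
  · rw [h] at h3; exact absurd h3.symm ha
  · rw [← h3]; exact hc _ _ h h2.symm

theorem coloring {d n : ℕ} (σ : Perm (Fin d))
    (h : ¬ ∃ p : Fin (n+1) → Fin d, StrictMono p ∧ StrictAnti (σ ∘ p)) :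
    ∃ c : Fin d → Fin n, ∀ j k, j < k → c j = c k → σ j < σ k := by
  classical
  let P : Fin d → ℕ → Prop := fun k m =>
    ∃ p : Fin (m+1) → Fin d, StrictMono p ∧ StrictAnti (σ ∘ p) ∧ p (Fin.last m) = k
  let c : Fin d → ℕ := fun k => Nat.findGreatest (P k) d
  have h0 : ∀ k, P k 0 := fun k => ⟨fun _ => k, fun a b h => by omega, fun a b h => by omega, rfl⟩
  have h1 : ∀ k, P k (c k) := fun k => Nat.findGreatest_spec (Nat.zero_le d) (h0 k)
  have h2 : ∀ k m, P k m → m ≤ c k := by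
    rintro k m hm
    refine Nat.le_findGreatest ?_ hm
    obtain ⟨p, hp, _⟩ := hm
    have := Fintype.card_le_of_injective p hp.injective
    simp at this; omega
  have h3 : ∀ k, c k < n := by
    intro k
    by_contra hk
    push Not at hk
    obtain ⟨p, hp, hp2, _⟩ := h1 k
    exact h ⟨p ∘ Fin.castLE (by omega), hp.comp (Fin.strictMono_castLE _),
      hp2.comp_strictMono (Fin.strictMono_castLE _)⟩
  refine ⟨fun k => ⟨c k, h3 k⟩, fun j k hjk hc => ?_⟩
  by_contra hlt
  have hlt : σ k < σ j := lt_of_le_of_ne (not_lt.1 hlt) (fun h => hjk.ne' (σ.injective h))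
  obtain ⟨p, hp, hp2, hp3⟩ := h1 j
  have : P k (c j + 1) := by
    refine ⟨Fin.snoc p k, ?_, ?_, by simp⟩
    · rw [Fin.strictMono_iff_lt_succ]
      intro i
      refine Fin.lastCases ?_ (fun i => ?_) i
      · rw [Fin.succ_last, Fin.snoc_last, Fin.snoc_castSucc, hp3]; exact hjk
      · rw [← Fin.castSucc_succ, Fin.snoc_castSucc, Fin.snoc_castSucc]; exact hp (Fin.castSucc_lt_succ)
    · rw [Fin.strictAnti_iff_succ_lt]
      intro i
      simp only [Function.comp]
      refine Fin.lastCases ?_ (fun i => ?_) i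
      · rw [Fin.succ_last, Fin.snoc_last, Fin.snoc_castSucc, hp3]; exact hlt
      · rw [← Fin.castSucc_succ, Fin.snoc_castSucc, Fin.snoc_castSucc]; exact hp2 (Fin.castSucc_lt_succ)
  have := h2 _ _ this
  simp at hc
  omega

theorem straighten {K : Type*} [Field K] (n d : ℕ) : ∀ (N : ℕ) (Φ : Perm (Fin d) → K), Alt n Φ →
    (∀ S : Finset (Perm (Fin d)), (∀ σ ∈ S, ∃ σ', Φ σ' ≠ 0 ∧ key σ' ≤ key σ) → S.card < N) →
    Φ ∈ Submodule.span K (Set.range (dl K : (Fin d → Fin n) × (Fin d → Fin n) → Perm (Fin d) → K)) := by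
  classical
  intro N
  induction N with
  | zero => intro Φ _ h; exact absurd (h ∅ (by simp)) (by simp)
  | succ N ih =>
    intro Φ hΦ hN
    by_cases hz : Φ = 0
    · rw [hz]; exact Submodule.zero_mem _
    have hne : (Finset.univ.filter fun σ => Φ σ ≠ 0).Nonempty := by
      obtain ⟨σ, hσ⟩ := Function.ne_iff.1 hz
      exact ⟨σ, by simpa using hσ⟩
    obtain ⟨σ, hσ, hmin⟩ := Finset.exists_min_image _ key hne
    simp only [Finset.mem_filter, Finset.mem_univ, true_and] at hσ hmin
    have hgood : ¬ ∃ p : Fin (n+1) → Fin d, StrictMono p ∧ StrictAnti (σ ∘ p) := by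
      rintro ⟨p, hp, hp2⟩
      have h1 := hΦ ⟨p, hp.injective⟩ σ
      rw [Finset.sum_eq_single 1] at h1
      · have : σ * (1 : Perm (Fin (n+1))).viaEmbedding ⟨p, hp.injective⟩ = σ := by
          have := map_one (Perm.viaEmbeddingHom (⟨p, hp.injective⟩ : Fin (n+1) ↪ Fin d))
          rw [Perm.viaEmbeddingHom_apply] at this
          rw [this, mul_one]
        rw [this] at h1
        exact hσ (by simpa using h1)
      · intro τ _ hτ
        have := key_lt ⟨p, hp.injective⟩ hp σ hp2 τ hτ
        by_cases h0 : Φ (σ * τ.viaEmbedding ⟨p, hp.injective⟩) = 0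
        · rw [h0, smul_zero]
        · exact absurd this (not_lt.2 (hmin _ h0))
      · simp
    obtain ⟨c, hc⟩ := coloring σ hgood
    let D : Perm (Fin d) → K := dl K (c ∘ σ.symm, c)
    have hD1 : D σ = 1 := if_pos (by funext x; simp)
    have hmem : D ∈ Submodule.span K (Set.range (dl K : (Fin d → Fin n) × (Fin d → Fin n) → Perm (Fin d) → K)) :=
      Submodule.subset_span ⟨_, rfl⟩
    have hkey : ∀ σ', (Φ - Φ σ • D) σ' ≠ 0 → key σ < key σ' := by
      intro σ' h
      have hne : σ' ≠ σ := by rintro rfl; simp [hD1] at h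
      by_cases hd : D σ' = 0
      · have : Φ σ' ≠ 0 := by simpa [hd] using h
        exact lt_of_le_of_ne (hmin _ this) fun h => hne (key_inj h).symm
      · exact dl_lt σ σ' c hc hne hd
    have := ih (Φ - Φ σ • D) ?_ ?_
    · have h2 := Submodule.add_mem _ this (Submodule.smul_mem _ (Φ σ) hmem)
      simpa using h2
    · intro p ρ
      have h1 := hΦ p ρ
      have h2 := dl_alt (K := K) (c ∘ σ.symm, c) p ρ
      simp only [Pi.sub_apply, Pi.smul_apply, smul_sub, Finset.sum_sub_distrib, h1]
      simp only [smul_comm _ (Φ σ), ← Finset.smul_sum]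
      simp only [D]; rw [h2]; simp
    · intro S hS
      have hnot : σ ∉ S := fun h => by
        obtain ⟨σ', h1, h2⟩ := hS σ h
        exact absurd (hkey σ' h1) (not_lt.2 h2)
      have := hN (insert σ S) (by
        intro ρ hρ
        refine ⟨σ, hσ, ?_⟩
        rcases Finset.mem_insert.1 hρ with rfl | h
        · exact le_rfl
        · obtain ⟨σ', h1, h2⟩ := hS ρ h
          exact (hkey σ' h1).le.trans h2)
      rw [Finset.card_insert_of_notMem hnot] at this
      omega

theorem alt_span {K : Type*} [Field K] {n d : ℕ} (Φ : Perm (Fin d) → K) (h : Alt n Φ) :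
    ∃ c : (Fin d → Fin n) × (Fin d → Fin n) → K, ∀ σ, Φ σ = ∑ ij, c ij * dl K ij σ := by
  have := straighten n d (Fintype.card (Perm (Fin d)) + 1) Φ h
    (fun S _ => Nat.lt_succ_of_le (Finset.card_le_univ S))
  rw [Submodule.mem_span_range_iff_exists_fun] at this
  obtain ⟨c, hc⟩ := this
  exact ⟨c, fun σ => by rw [← hc]; simp⟩

end C520

namespace C520
open Equiv

abbrev MV := Bool × Fin 5 × Fin 5

theorem perm_of_sum {V : Type*} [DecidableEq V] {d : ℕ} (v v' : Fin d → V)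
    (h : ∑ k, Finsupp.single (v k) 1 = ∑ k, Finsupp.single (v' k) (1:ℕ)) : ∃ π : Perm (Fin d), v' = v ∘ π := by
  have hc : ∀ (u : Fin d → V) (x : V), Fintype.card {k // u k = x} = (∑ k, Finsupp.single (u k) (1:ℕ)) x := by
    intro u x
    rw [Finsupp.finsetSum_apply, Fintype.card_subtype, Finset.card_filter]
    refine Finset.sum_congr rfl fun k _ => ?_
    rw [Finsupp.single_apply]
  have e : ∀ x, ({k // v' k = x} ≃ {k // v k = x}) := fun x =>
    Fintype.equivOfCardEq (by rw [hc, hc, h])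
  refine ⟨(Equiv.sigmaFiberEquiv v').symm.trans ((Equiv.sigmaCongrRight fun x => (e x)).trans (Equiv.sigmaFiberEquiv v)), ?_⟩
  funext k
  exact ((e (v' k)) ⟨k, rfl⟩).2.symm

theorem prod_X {K V : Type*} [Field K] {d : ℕ} (v : Fin d → V) :
    ∏ k, (MvPolynomial.X (v k) : MvPolynomial V K) = MvPolynomial.monomial (∑ k, Finsupp.single (v k) 1) 1 := by
  rw [MvPolynomial.monomial_sum_one]
  rfl

section
variable {K : Type*} [Field K]

def Dm {V : Type*} {d : ℕ} (C : (Fin d → V) → K) (m : V →₀ ℕ) : K := by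
  classical
  exact if h : ∃ v : Fin d → V, ∑ k, Finsupp.single (v k) 1 = m then ∑ π : Perm (Fin d), C (h.choose ∘ π) else 0

def DD {V : Type*} {d : ℕ} (C : (Fin d → V) → K) : MvPolynomial V K →ₗ[K] K :=
  (MvPolynomial.basisMonomials V K).constr K (Dm C)

theorem DD_mon {V : Type*} {d : ℕ} (C : (Fin d → V) → K) (m : V →₀ ℕ) :
    DD C (MvPolynomial.monomial m 1) = Dm C m := by
  have := (MvPolynomial.basisMonomials V K).constr_basis K (Dm C) m
  rwa [MvPolynomial.coe_basisMonomials] at this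

theorem DD_prod {V : Type*} {d : ℕ} (C : (Fin d → V) → K) (v : Fin d → V) :
    DD C (∏ k, MvPolynomial.X (v k)) = ∑ π : Perm (Fin d), C (v ∘ π) := by
  classical
  rw [prod_X, DD_mon, Dm]
  have h : ∃ v' : Fin d → V, ∑ k, Finsupp.single (v' k) 1 = ∑ k, Finsupp.single (v k) 1 := ⟨v, rfl⟩
  rw [dif_pos h]
  obtain ⟨ρ, hρ⟩ := perm_of_sum _ _ h.choose_spec
  generalize h.choose = u at hρ
  rw [hρ, ← Equiv.sum_comp (Equiv.mulLeft ρ)]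
  rfl

theorem DD_prod_ne {V : Type*} {d e : ℕ} (hde : e ≠ d) (C : (Fin d → V) → K) (v : Fin e → V) :
    DD C (∏ k, MvPolynomial.X (v k)) = 0 := by
  classical
  rw [prod_X, DD_mon, Dm, dif_neg]
  rintro ⟨v', h⟩
  have := congrArg Finsupp.degree h
  simp at this
  omega

/-- generic matrices -/
def GX (b : Bool) : Matrix (Fin 5) (Fin 5) (MvPolynomial MV K) := fun i j => MvPolynomial.X (b, i, j)

def gev (w : Wd) : Matrix (Fin 5) (Fin 5) (MvPolynomial MV K) := ev (GX false) (GX true) w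

theorem trP_letters {d : ℕ} (σ : Perm (Fin d)) (ε : Fin d → Bool) :
    trP σ (fun k => (gev [ε k] : Matrix _ _ (MvPolynomial MV K))) =
      ∑ i : Fin d → Fin 5, ∏ k, MvPolynomial.X (ε k, i (σ.symm k), i k) := by
  unfold trP
  refine Finset.sum_congr rfl fun i _ => Finset.prod_congr rfl fun k _ => ?_
  unfold gev ev
  rcases h : ε k <;> simp [GX, h]

theorem DD_letters (φ : Wd → K) (hφ : ∀ u v, φ (u ++ v) = φ (v ++ u))
    (hC : ∀ a : Fin 6 → Wd, (∀ i, a i ≠ []) → Cy φ 5 a = 0) (d : ℕ) :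
    ∃ C : (Fin d → MV) → K, ∀ (σ : Perm (Fin d)) (ε : Fin d → Bool),
      DD C (trP σ (fun k => gev [ε k])) = (d.factorial : K) * Phi φ σ (fun k => [ε k]) := by
  have h1 : ∀ ε : Fin d → Bool, ∃ c : (Fin d → Fin 5) × (Fin d → Fin 5) → K,
      ∀ σ, Phi φ σ (fun k => [ε k]) = ∑ ij, c ij * dl K ij σ := by
    intro ε
    apply alt_span
    intro p σ
    exact Phi_alt φ hφ hC d p σ _ (by simp)
  choose c hc using h1
  refine ⟨fun v => c (fun k => (v k).1) (fun k => (v k).2.1, fun k => (v k).2.2), fun σ ε => ?_⟩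
  rw [trP_letters, map_sum]
  simp only [DD_prod]
  rw [Finset.sum_comm]
  have : ∀ π : Perm (Fin d), ∑ i : Fin d → Fin 5, c (fun k => ε (π k)) (fun k => i (σ.symm (π k)), fun k => i (π k))
      = Phi φ σ (fun k => [ε k]) := by
    intro π
    have h2 := Phi_conj φ hφ π (π⁻¹ * σ * π) (fun k => [ε (π k)])
    have h3 : π * (π⁻¹ * σ * π) * π⁻¹ = σ := by group
    rw [h3] at h2
    have h4 : (fun k => [ε (π k)]) ∘ π.symm = fun k => [ε k] := by funext k; simp
    rw [h4] at h2
    rw [h2, hc, Fintype.sum_prod_type_right]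
    rw [← Equiv.sum_comp (Equiv.arrowCongr π (Equiv.refl (Fin 5)))]
    refine Finset.sum_congr rfl fun i _ => ?_
    rw [Finset.sum_eq_single (fun k => i (π.symm (σ.symm (π k))))]
    · have : (fun k => i (π.symm (σ.symm (π k)))) ∘ (π⁻¹ * σ * π : Perm (Fin d)) = i := by
        funext k; simp [Perm.inv_def]
      rw [dl, if_pos this, mul_one]
      congr
      · funext k; simp
    · intro j _ hj
      rw [dl, if_neg, mul_zero]
      intro h
      apply hj
      simp only at h
      rw [← h]
      funext k
      simp [Perm.inv_def]
    · simp
  refine (Finset.sum_congr rfl fun π _ => this π).trans ?_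
  simp [Fintype.card_perm]

theorem split_words (φ : Wd → K) (hφ : ∀ u v, φ (u ++ v) = φ (v ++ u)) : ∀ (N n : ℕ) (σ : Perm (Fin n)) (a : Fin n → Wd),
    (∀ i, a i ≠ []) → ∑ i, (a i).length = n + N →
    ∃ (σ' : Perm (Fin (n + N))) (ε : Fin (n + N) → Bool),
      trP σ (fun k => (gev (a k) : Matrix _ _ (MvPolynomial MV K))) = trP σ' (fun k => gev [ε k]) ∧
      Phi φ σ a = Phi φ σ' (fun k => [ε k]) := by
  intro N
  induction N with
  | zero =>
    intro n σ a ha hs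
    have h1 : ∀ i, (a i).length = 1 := by
      have h0 : ∑ i, (a i).length = ∑ i : Fin n, 1 := by simpa using hs
      have h2 : ∀ i ∈ Finset.univ, 1 ≤ (a i).length := fun i _ => List.length_pos_iff.2 (ha i)
      intro i
      exact ((Finset.sum_eq_sum_iff_of_le h2).1 h0.symm i (Finset.mem_univ i)).symm
    choose ε hε using fun i => List.length_eq_one_iff.1 (h1 i)
    obtain rfl : a = fun k => [ε k] := funext hε
    exact ⟨σ, ε, rfl, rfl⟩
  | succ N ih =>
    intro n σ a ha hs
    obtain ⟨r, hr⟩ : ∃ r, 1 < (a r).length := by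
      by_contra h
      push Not at h
      have : ∑ i, (a i).length ≤ ∑ i : Fin n, 1 := Finset.sum_le_sum fun i _ => h i
      simp at this
      omega
    obtain ⟨b, c, u, hu⟩ : ∃ b c u, a r = [b] ++ (c :: u) := by
      match h : a r with
      | b :: c :: u => exact ⟨b, c, u, rfl⟩
      | [b] => simp [h] at hr
      | [] => simp [h] at hr
    have hne : ∀ i, (Fin.cons [b] (Function.update a r (c :: u)) : Fin (n+1) → Wd) i ≠ [] := by
      intro i
      refine Fin.cases (by simp) (fun i => ?_) i
      rw [Fin.cons_succ, Function.update_apply]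
      split_ifs
      · simp
      · exact ha i
    have hup : ∑ i, (Function.update a r (c :: u) i).length + 1 = ∑ i, (a i).length := by
      rw [← Finset.add_sum_erase _ _ (Finset.mem_univ r), ← Finset.add_sum_erase _ _ (Finset.mem_univ r)]
      rw [Function.update_self, hu]
      have : ∑ i ∈ Finset.univ.erase r, (Function.update a r (c :: u) i).length = ∑ i ∈ Finset.univ.erase r, (a i).length :=
        Finset.sum_congr rfl fun i hi => by rw [Function.update_of_ne (Finset.mem_erase.1 hi).1]
      rw [this]
      simp
      omega
    obtain ⟨σ', ε, h1, h2⟩ := ih (n+1) (Perm.decomposeFin.symm (r.succ, σ)) (Fin.cons [b] (Function.update a r (c :: u))) hne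
      (by rw [Fin.sum_univ_succ]; simp only [Fin.cons_zero, Fin.cons_succ, List.length_singleton]; omega)
    rw [trP_succ] at h1
    rw [Phi_succ φ hφ] at h2
    have hg : glue (Fin.cons [b] (Function.update a r (c :: u)) : Fin (n+1) → Wd) r = a := by
      unfold glue
      rw [Fin.tail_cons, Fin.cons_zero, Fin.cons_succ, Function.update_self, Function.update_idem, ← hu,
        Function.update_eq_self]
    have he := ev_glue (X := (GX false : Matrix _ _ (MvPolynomial MV K))) (Y := GX true)
      (Fin.cons [b] (Function.update a r (c :: u))) r
    rw [hg] at he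
    have : n + 1 + N = n + (N + 1) := by omega
    revert σ' ε
    rw [this]
    intro σ' ε h1 h2
    refine ⟨σ', ε, ?_, by rw [← h2, hg]⟩
    rw [← h1]
    unfold gev
    rw [he]

theorem dec_one {n : ℕ} : (1 : Perm (Fin (n+1))) = Perm.decomposeFin.symm (0, (1 : Perm (Fin n))) := by
  rw [Perm.decomposeFin_symm_of_one, swap_self]
  rfl

theorem trP_one : ∀ l : List Wd, trP (1 : Perm (Fin l.length)) (fun k => (gev (l.get k) : Matrix _ _ (MvPolynomial MV K)))
    = (l.map fun w => (gev w).trace).prod := by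
  intro l
  induction l with
  | nil => simp [trP]
  | cons w l ih =>
    have h : (1 : Perm (Fin (w :: l).length)) = Perm.decomposeFin.symm (0, (1 : Perm (Fin l.length))) :=
      dec_one
    rw [h, trP_zero, List.map_cons, List.prod_cons, ← ih]
    rfl

theorem DD_list (φ : Wd → K) (hφ : ∀ u v, φ (u ++ v) = φ (v ++ u))
    (hC : ∀ a : Fin 6 → Wd, (∀ i, a i ≠ []) → Cy φ 5 a = 0) (d : ℕ) (hd : ∀ w, φ w ≠ 0 → w.length = d) (hd0 : d ≠ 0) :
    ∃ D : MvPolynomial MV K →ₗ[K] K, D 1 = 0 ∧ (∀ w, w ≠ [] → D (gev w).trace = (d.factorial : K) * φ w) ∧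
      ∀ l : List Wd, 2 ≤ l.length → (∀ w ∈ l, w ≠ []) → D (l.map fun w => (gev w).trace).prod = 0 := by
  obtain ⟨C, h⟩ := DD_letters φ hφ hC d
  have key : ∀ l : List Wd, (∀ w ∈ l, w ≠ []) → (Phi φ 1 l.get ≠ 0 → ∑ k, (l.get k).length = d) →
      DD C (l.map fun w => (gev w).trace).prod = (d.factorial : K) * Phi φ 1 l.get := by
    intro l hl hp
    have hle : ∑ k : Fin l.length, 1 ≤ ∑ k, (l.get k).length :=
      Finset.sum_le_sum fun i _ => List.length_pos_iff.2 (hl _ (List.get_mem _ _))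
    obtain ⟨N, hN⟩ := Nat.exists_eq_add_of_le hle
    simp only [Finset.sum_const, Finset.card_univ, Fintype.card_fin, smul_eq_mul, mul_one] at hN
    obtain ⟨σ', ε, h1, h2⟩ := split_words φ hφ N l.length 1 l.get (fun i => hl _ (List.get_mem _ _)) hN
    rw [← trP_one, h1, h2]
    by_cases hd' : l.length + N = d
    · subst hd'
      exact h σ' ε
    · rw [trP_letters, map_sum, Finset.sum_eq_zero fun i _ => DD_prod_ne hd' C _, ← h2]
      by_cases h0 : Phi φ 1 l.get = 0
      · rw [h0, mul_zero]
      · exact absurd (hN.symm.trans (hp h0)) hd'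
  refine ⟨DD C, ?_, ?_, ?_⟩
  · have := DD_prod_ne (e := 0) (Ne.symm hd0) C (fun k => k.elim0)
    simpa using this
  · intro w hw
    have h1 : Phi φ (1 : Perm (Fin 1)) (fun _ => w) = φ w := by
      have := Phi_sum φ hφ 0 (fun _ => w)
      simp at this
      rw [this]
      rfl
    have h2 : Phi φ 1 [w].get = φ w := by rw [← h1]; congr 1; funext k; simp
    have := key [w] (by simpa using hw) (by rw [h2]; intro h; simpa using hd w h)
    rw [h2] at this
    simpa using this
  · intro l hl hne
    match l, hl with
    | u :: v :: l, _ =>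
      have h0 : Phi φ (1 : Perm (Fin (l.length+2))) (u :: v :: l).get = 0 := by
        rw [dec_one]
        exact Phi_zero φ hφ _ _
      have := key _ hne (fun h => absurd h0 h)
      rw [this]
      erw [h0]
      rw [mul_zero]

end
end C520

namespace C520
open Equiv
section
variable {K : Type*} [Field K]

/-- trace of a word as a function -/
def fw (w : Wd) : sl K 5 × sl K 5 → K := fun v => (ev (v.1 : Matrix (Fin 5) (Fin 5) K) v.2 w).trace

def sub (A B : Matrix (Fin 5) (Fin 5) K) : MV → K := fun v => bif v.1 then B v.2.1 v.2.2 else A v.2.1 v.2.2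

def dev {R : Type*} [CommRing R] [Algebra K R] (A : Matrix (Fin 5) (Fin 5) R) : Matrix (Fin 5) (Fin 5) R :=
  A - ((5:K)⁻¹ • A.trace) • 1

theorem dev_trace [CharZero K] (A : Matrix (Fin 5) (Fin 5) K) : (dev (K := K) A).trace = 0 := by
  simp [dev]
  field_simp
  ring

def dsl [CharZero K] (A : Matrix (Fin 5) (Fin 5) K) : sl K 5 := ⟨dev (K := K) A, dev_trace A⟩

theorem dsl_sl [CharZero K] (A : sl K 5) : dsl (A : Matrix (Fin 5) (Fin 5) K) = A := by
  have : (A : Matrix (Fin 5) (Fin 5) K).trace = 0 := A.2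
  apply Subtype.ext
  simp [dsl, dev, this]

def TA (K : Type*) [Field K] : Subalgebra K (MvPolynomial MV K) := Algebra.adjoin K {f | ∃ w : Wd, w ≠ [] ∧ f = (gev w).trace}

theorem ev_cons {n : ℕ} {R : Type*} [CommRing R] (X Y : Matrix (Fin n) (Fin n) R) (b : Bool) (w : Wd) :
    ev X Y (b :: w) = (bif b then Y else X) * ev X Y w := by
  simp [ev]

theorem ev_nil {n : ℕ} {R : Type*} [CommRing R] (X Y : Matrix (Fin n) (Fin n) R) : ev X Y [] = 1 := by
  simp [ev]

theorem gev_cons (b : Bool) (w : Wd) : (gev (b :: w) : Matrix _ _ (MvPolynomial MV K)) = GX b * gev w := by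
  rw [gev, ev_cons]; cases b <;> rfl

theorem gt_mem (w : Wd) : (gev w).trace ∈ TA K := by
  by_cases h : w = []
  · subst h
    rw [gev, ev_nil, Matrix.trace_one]
    exact natCast_mem _ _
  · exact Algebra.subset_adjoin ⟨w, h, rfl⟩

theorem ev_map {n : ℕ} {R S : Type*} [CommRing R] [CommRing S] (f : R →+* S) (X Y : Matrix (Fin n) (Fin n) R) (w : Wd) :
    (ev X Y w).map f = ev (X.map f) (Y.map f) w := by
  induction w with
  | nil => simp [ev_nil, Matrix.map_one]
  | cons b w ih => rw [ev_cons, ev_cons, Matrix.map_mul, ih]; cases b <;> rfl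

theorem tr_map {n : ℕ} {R S : Type*} [CommRing R] [CommRing S] (f : R →+* S) (M : Matrix (Fin n) (Fin n) R) :
    (M.map f).trace = f M.trace := by
  simp [Matrix.trace]

theorem eps_gev (w : Wd) (hw : w ≠ []) : MvPolynomial.constantCoeff (gev w : Matrix _ _ (MvPolynomial MV K)).trace = 0 := by
  rw [← tr_map, gev, ev_map]
  cases w with
  | nil => exact absurd rfl hw
  | cons b w =>
    rw [ev_cons]
    have : ∀ b, (GX b : Matrix _ _ (MvPolynomial MV K)).map (MvPolynomial.constantCoeff) = 0 := by
      intro b; ext i j; simp [GX]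
    cases b <;> simp [this]

theorem eval_gev (A B : Matrix (Fin 5) (Fin 5) K) (w : Wd) :
    MvPolynomial.eval (sub A B) (gev w).trace = (ev A B w).trace := by
  rw [← tr_map, gev, ev_map]
  have h : ∀ b, (GX b : Matrix _ _ (MvPolynomial MV K)).map (MvPolynomial.eval (sub A B)) = bif b then B else A := by
    intro b
    ext i j; cases b <;> simp [GX, sub]
  rw [h, h]
  rfl

theorem deriv_TA (D : MvPolynomial MV K →ₗ[K] K) (h1 : D 1 = 0)
    (h2 : ∀ l : List Wd, 2 ≤ l.length → (∀ w ∈ l, w ≠ []) → D (l.map fun w => (gev w).trace).prod = 0)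
    (f g : MvPolynomial MV K) (hf : f ∈ TA K) (hg : g ∈ TA K) :
    D (f * g) = D f * MvPolynomial.constantCoeff g + MvPolynomial.constantCoeff f * D g := by
  have hl : ∀ x ∈ Submonoid.closure {f : MvPolynomial MV K | ∃ w : Wd, w ≠ [] ∧ f = (gev w).trace},
      ∃ l : List Wd, (∀ w ∈ l, w ≠ []) ∧ x = (l.map fun w => (gev w).trace).prod := by
    intro x hx
    induction hx using Submonoid.closure_induction with
    | mem x hx => obtain ⟨w, hw, rfl⟩ := hx; exact ⟨[w], by simpa using hw, by simp⟩
    | one => exact ⟨[], by simp, by simp⟩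
    | mul x y _ _ h1 h2 =>
      obtain ⟨l, hl, rfl⟩ := h1
      obtain ⟨m, hm, rfl⟩ := h2
      exact ⟨l ++ m, by simp only [List.mem_append]; rintro w (h | h); exacts [hl w h, hm w h], by simp⟩
  have hε : ∀ l : List Wd, (∀ w ∈ l, w ≠ []) → l ≠ [] →
      MvPolynomial.constantCoeff (l.map fun w => (gev w : Matrix _ _ (MvPolynomial MV K)).trace).prod = 0 := by
    intro l hl hne
    cases l with
    | nil => exact absurd rfl hne
    | cons w l => rw [List.map_cons, List.prod_cons, map_mul, eps_gev w (hl w (by simp)), zero_mul]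
  rw [TA, ← Subalgebra.mem_toSubmodule, Algebra.adjoin_eq_span] at hf hg
  induction hf using Submodule.span_induction with
  | zero => simp
  | add x y _ _ hx hy => rw [add_mul, map_add, hx, hy, map_add, map_add]; ring
  | smul a x _ hx => rw [smul_mul_assoc, map_smul, hx, map_smul D, MvPolynomial.constantCoeff_smul]; simp only [smul_eq_mul]; ring
  | mem x hx =>
    induction hg using Submodule.span_induction with
    | zero => simp
    | add x y _ _ hx hy => rw [mul_add, map_add, hx, hy, map_add, map_add]; ring
    | smul a x _ hx => rw [mul_smul_comm, map_smul, hx, map_smul D, MvPolynomial.constantCoeff_smul]; simp only [smul_eq_mul]; ring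
    | mem y hy =>
      obtain ⟨l, hl1, rfl⟩ := hl x hx
      obtain ⟨m, hm1, rfl⟩ := hl y hy
      by_cases hl0 : l = []
      · subst hl0; simp [h1]
      by_cases hm0 : m = []
      · subst hm0; simp [h1]
      rw [hε l hl1 hl0, hε m hm1 hm0, ← List.prod_append, ← List.map_append, h2]
      · simp
      · have := List.length_pos_iff.2 hl0
        have := List.length_pos_iff.2 hm0
        simp; omega
      · simp only [List.mem_append]; rintro w (h | h); exacts [hl1 w h, hm1 w h]

def JJ (K : Type*) [Field K] : Submodule K (Matrix (Fin 5) (Fin 5) (MvPolynomial MV K)) :=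
  Submodule.span K {M | ∃ (b : Bool) (q : MvPolynomial MV K) (u : Wd), q ∈ TA K ∧ M = ((gev [b]).trace * q) • gev u}

theorem JJ_mul (b : Bool) (M : Matrix (Fin 5) (Fin 5) (MvPolynomial MV K)) (h : M ∈ JJ K) : GX b * M ∈ JJ K := by
  induction h using Submodule.span_induction with
  | zero => simp
  | add x y _ _ hx hy => rw [mul_add]; exact Submodule.add_mem _ hx hy
  | smul a x _ hx => rw [mul_smul_comm]; exact Submodule.smul_mem _ _ hx
  | mem x hx =>
    obtain ⟨c, q, u, hq, rfl⟩ := hx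
    refine Submodule.subset_span ⟨c, q, b :: u, hq, ?_⟩
    rw [mul_smul_comm, gev_cons b u]

theorem JJ_smul (r : MvPolynomial MV K) (hr : r ∈ TA K) (M : Matrix (Fin 5) (Fin 5) (MvPolynomial MV K)) (h : M ∈ JJ K) : r • M ∈ JJ K := by
  induction h using Submodule.span_induction with
  | zero => simp
  | add x y _ _ hx hy => rw [smul_add]; exact Submodule.add_mem _ hx hy
  | smul a x _ hx => rw [smul_comm]; exact Submodule.smul_mem _ _ hx
  | mem x hx =>
    obtain ⟨c, q, u, hq, rfl⟩ := hx
    refine Submodule.subset_span ⟨c, r * q, u, mul_mem hr hq, ?_⟩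
    rw [smul_smul]
    congr 1
    ring

theorem JJ_dev (w : Wd) : ev (dev (K := K) (GX false)) (dev (K := K) (GX true)) w - gev w ∈ JJ K := by
  induction w with
  | nil => simp [gev, ev_nil]
  | cons b w ih =>
    have hb : ((gev [b] : Matrix _ _ (MvPolynomial MV K))) = GX b := by
      rw [gev, ev_cons, ev_nil]; cases b <;> simp
    have h1 : (bif b then dev (K := K) (GX true) else dev (K := K) (GX false)) =
        GX b - ((5:K)⁻¹ • (gev [b] : Matrix _ _ (MvPolynomial MV K)).trace) • (1 : Matrix (Fin 5) (Fin 5) (MvPolynomial MV K)) := by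
      rw [hb]; cases b <;> rfl
    rw [ev_cons, h1, gev_cons b w]
    set E : Matrix (Fin 5) (Fin 5) (MvPolynomial MV K) := ev (dev (K := K) (GX false)) (dev (K := K) (GX true)) w
    have : (GX b - ((5:K)⁻¹ • (gev [b] : Matrix _ _ (MvPolynomial MV K)).trace) • (1 : Matrix (Fin 5) (Fin 5) (MvPolynomial MV K))) * E - GX b * (gev w : Matrix (Fin 5) (Fin 5) (MvPolynomial MV K)) =
      (GX b : Matrix _ _ (MvPolynomial MV K)) * (E - gev w) - ((5:K)⁻¹ • (gev [b] : Matrix _ _ (MvPolynomial MV K)).trace) • (E - gev w) - (5:K)⁻¹ • (((gev [b] : Matrix _ _ (MvPolynomial MV K)).trace * 1) • (gev w : Matrix _ _ (MvPolynomial MV K))) := by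
      rw [sub_mul, smul_mul_assoc, one_mul, mul_sub, smul_sub, mul_one, smul_assoc, smul_assoc]
      abel
    rw [this]
    refine Submodule.sub_mem _ (Submodule.sub_mem _ (JJ_mul _ _ ih) (JJ_smul _ ?_ _ ih)) ?_
    · exact Subalgebra.smul_mem _ (gt_mem _) _
    · exact Submodule.smul_mem _ _ (Submodule.subset_span ⟨b, 1, w, one_mem _, rfl⟩)

theorem JJ_trace (M : Matrix (Fin 5) (Fin 5) (MvPolynomial MV K)) (h : M ∈ JJ K) : M.trace ∈ TA K := by
  induction h using Submodule.span_induction with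
  | zero => simp
  | add x y _ _ hx hy => rw [trace_add]; exact add_mem hx hy
  | smul a x _ hx => rw [trace_smul]; exact Subalgebra.smul_mem _ hx _
  | mem x hx =>
    obtain ⟨c, q, u, hq, rfl⟩ := hx
    rw [trace_smul]
    exact mul_mem (mul_mem (gt_mem _) hq) (gt_mem _)

def QQ (K : Type*) [Field K] (w : Wd) : MvPolynomial MV K := (ev (dev (K := K) (GX false)) (dev (K := K) (GX true)) w).trace

theorem QQ_mem (w : Wd) : QQ K w ∈ TA K := by
  have := add_mem (JJ_trace _ (JJ_dev (K := K) w)) (gt_mem (K := K) w)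
  rwa [trace_sub, sub_add_cancel] at this

theorem QQ_eval [CharZero K] (A B : Matrix (Fin 5) (Fin 5) K) (w : Wd) :
    MvPolynomial.eval (sub A B) (QQ K w) = fw w (dsl A, dsl B) := by
  rw [QQ, ← tr_map, ev_map]
  have h : ∀ b, (dev (K := K) (GX b)).map (MvPolynomial.eval (sub A B)) = dev (K := K) (bif b then B else A) := by
    intro b
    have h2 : (GX b : Matrix _ _ (MvPolynomial MV K)).map (MvPolynomial.eval (sub A B)) = bif b then B else A := by
      ext i j; cases b <;> simp [GX, sub]
    rw [← h2]
    ext i j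
    simp only [dev, Matrix.map_apply, Matrix.sub_apply, Matrix.smul_apply, map_sub, tr_map]
    by_cases hij : i = j
    · subst hij; simp [MvPolynomial.smul_eval]
    · simp [hij]
  rw [h, h]
  rfl

theorem exists_Z [CharZero K] (φ : Wd → K) (hφ : ∀ u v, φ (u ++ v) = φ (v ++ u))
    (hC : ∀ a : Fin 6 → Wd, (∀ i, a i ≠ []) → Cy φ 5 a = 0) (d : ℕ) (hd : ∀ w, φ w ≠ 0 → w.length = d) (hd0 : 2 ≤ d) :
    ∃ Z : Subalgebra K (sl K 5 × sl K 5 → K), ∀ (u v : Wd) (a b : K), u ≠ [] → v ≠ [] →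
      (a • fw u + b • fw v ∈ Z ↔ a * φ u + b * φ v = 0) := by
  obtain ⟨D, h1, h2, h3⟩ := DD_list φ hφ hC d hd (by omega)
  have hder := deriv_TA D h1 h3
  have hD1 : ∀ b, D (gev [b]).trace = 0 := by
    intro b
    rw [h2 _ (by simp)]
    by_cases h : φ [b] = 0
    · simp [h]
    · have := hd _ h
      simp at this; omega
  have hDJ : ∀ M ∈ JJ K, D M.trace = 0 := by
    intro M h
    induction h using Submodule.span_induction with
    | zero => simp
    | add x y _ _ hx hy => rw [trace_add, map_add, hx, hy, add_zero]
    | smul a x _ hx => rw [trace_smul, map_smul, hx, smul_zero]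
    | mem x hx =>
      obtain ⟨c, q, u, hq, rfl⟩ := hx
      rw [trace_smul, smul_eq_mul, mul_assoc, hder _ _ (gt_mem _) (mul_mem hq (gt_mem _)), hD1, eps_gev _ (by simp)]
      simp
  have hQ : ∀ w, w ≠ [] → D (QQ K w) = d.factorial * φ w := by
    intro w hw
    have := hDJ _ (JJ_dev w)
    rw [trace_sub, map_sub, h2 w hw, sub_eq_zero] at this
    exact this
  let Z : Subalgebra K (sl K 5 × sl K 5 → K) :=
    { carrier := {f | ∃ F ∈ TA K, D F = 0 ∧ ∀ A B, MvPolynomial.eval (sub A B) F = f (dsl A, dsl B)}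
      mul_mem' := by
        rintro f g ⟨F, hF, hF1, hF2⟩ ⟨G, hG, hG1, hG2⟩
        exact ⟨F * G, mul_mem hF hG, by rw [hder _ _ hF hG, hF1, hG1]; simp, fun A B => by simp [hF2, hG2]⟩
      add_mem' := by
        rintro f g ⟨F, hF, hF1, hF2⟩ ⟨G, hG, hG1, hG2⟩
        exact ⟨F + G, add_mem hF hG, by rw [map_add, hF1, hG1]; simp, fun A B => by simp [hF2, hG2]⟩
      algebraMap_mem' := fun c => ⟨algebraMap K _ c, Subalgebra.algebraMap_mem _ c,
        by rw [Algebra.algebraMap_eq_smul_one, map_smul, h1, smul_zero], fun A B => by simp⟩ }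
  refine ⟨Z, fun u v a b hu hv => ?_⟩
  have hDab : D (a • QQ K u + b • QQ K v) = d.factorial * (a * φ u + b * φ v) := by
    rw [map_add, map_smul, map_smul, hQ u hu, hQ v hv]; simp only [smul_eq_mul]; ring
  constructor
  · rintro ⟨F, hF, hF1, hF2⟩
    have : F = a • QQ K u + b • QQ K v := by
      apply MvPolynomial.funext
      intro x
      have hx : x = sub (Matrix.of fun i j => x (false, i, j)) (Matrix.of fun i j => x (true, i, j)) := by
        funext ⟨c, i, j⟩; cases c <;> rfl
      rw [hx, hF2, map_add, MvPolynomial.smul_eval, MvPolynomial.smul_eval, QQ_eval, QQ_eval]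
      rfl
    rw [this, hDab] at hF1
    rcases mul_eq_zero.1 hF1 with h | h
    · exact absurd h (by exact_mod_cast d.factorial_ne_zero)
    · exact h
  · intro h
    refine ⟨a • QQ K u + b • QQ K v, add_mem (Subalgebra.smul_mem _ (QQ_mem u) _) (Subalgebra.smul_mem _ (QQ_mem v) _), by rw [hDab, h, mul_zero], fun A B => ?_⟩
    rw [map_add, MvPolynomial.smul_eval, MvPolynomial.smul_eval, QQ_eval, QQ_eval]
    rfl

end
end C520

namespace C520
open Equiv
section
set_option linter.unusedSectionVars false
variable {K : Type*} [Field K] [CharZero K] {d : ℕ}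

def Lσ (σ : Perm (Fin d)) : Matrix (Fin d → Fin 5) (Fin d → Fin 5) K →ₗ[K] Matrix (Fin d → Fin 5) (Fin d → Fin 5) K where
  toFun M := fun i j => M (i ∘ σ) j
  map_add' _ _ := rfl
  map_smul' _ _ := rfl

theorem dcent (C : Matrix (Fin d → Fin 5) (Fin d → Fin 5) K)
    (hC : ∀ e : Matrix (Fin d → Fin 5) (Fin d → Fin 5) K, (∀ (τ : Perm (Fin d)) i j, e (i ∘ τ) (j ∘ τ) = e i j) → C * e = e * C) :
    ∃ γ : Perm (Fin d) → K, ∀ i j, C i j = ∑ σ, γ σ * dl K (i, j) σ := by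
  let B : Submodule K (Matrix (Fin d → Fin 5) (Fin d → Fin 5) K) := Submodule.span K (Set.range fun σ : Perm (Fin d) => Lσ (K := K) σ 1)
  have hL : ∀ (σ τ : Perm (Fin d)) (M : Matrix (Fin d → Fin 5) (Fin d → Fin 5) K), Lσ σ (Lσ τ M) = Lσ (σ * τ) M := fun _ _ _ => rfl
  have hB : ∀ (σ : Perm (Fin d)), ∀ M ∈ B, Lσ σ M ∈ B := by
    intro σ M hM
    induction hM using Submodule.span_induction with
    | zero => simp
    | add x y _ _ hx hy => rw [map_add]; exact add_mem hx hy
    | smul a x _ hx => rw [map_smul]; exact Submodule.smul_mem _ _ hx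
    | mem x hx => obtain ⟨τ, rfl⟩ := hx; exact Submodule.subset_span ⟨σ * τ, rfl⟩
  obtain ⟨ℓ, hℓ⟩ := B.subtype.exists_leftInverse_of_injective B.ker_subtype
  let π : Matrix (Fin d → Fin 5) (Fin d → Fin 5) K →ₗ[K] Matrix (Fin d → Fin 5) (Fin d → Fin 5) K :=
    ((d.factorial : K)⁻¹) • ∑ σ : Perm (Fin d), Lσ σ ∘ₗ B.subtype ∘ₗ ℓ ∘ₗ Lσ σ⁻¹
  have hπ : ∀ M, π M = ((d.factorial : K)⁻¹) • ∑ σ : Perm (Fin d), Lσ σ (ℓ (Lσ σ⁻¹ M) : Matrix _ _ K) := by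
    intro M; simp [π]
  have hπB : ∀ M, π M ∈ B := fun M => by
    rw [hπ]; exact Submodule.smul_mem _ _ (Submodule.sum_mem _ fun σ _ => hB _ _ (ℓ _).2)
  have hπid : ∀ M ∈ B, π M = M := by
    intro M hM
    rw [hπ]
    have : ∀ σ : Perm (Fin d), Lσ σ (ℓ (Lσ σ⁻¹ M) : Matrix _ _ K) = M := by
      intro σ
      have h1 := LinearMap.congr_fun hℓ ⟨Lσ σ⁻¹ M, hB _ _ hM⟩
      simp only [LinearMap.comp_apply, Submodule.subtype_apply, LinearMap.id_apply] at h1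
      rw [h1, hL, mul_inv_cancel]
      rfl
    rw [Finset.sum_congr rfl fun σ _ => this σ]
    simp only [Finset.sum_const, Finset.card_univ, Fintype.card_perm, Fintype.card_fin]
    rw [← Nat.cast_smul_eq_nsmul K, smul_smul, inv_mul_cancel₀ (by exact_mod_cast d.factorial_ne_zero), one_smul]
  have hπeq : ∀ τ M, π (Lσ τ M) = Lσ τ (π M) := by
    intro τ M
    rw [hπ, hπ, map_smul, map_sum, ← Equiv.sum_comp (Equiv.mulLeft τ)]
    congr 1
    refine Finset.sum_congr rfl fun σ _ => ?_
    rw [hL, hL]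
    simp
  have key : C * π 1 = π (C * 1) := by
    have hs : ∀ M, π M = ∑ i', ∑ j', M i' j' • π (Matrix.single i' j' 1) := by
      intro M
      conv_lhs => rw [Matrix.matrix_eq_sum_single M]
      simp only [map_sum]
      refine Finset.sum_congr rfl fun i _ => Finset.sum_congr rfl fun j _ => ?_
      rw [← map_smul, Matrix.smul_single, smul_eq_mul, mul_one]
    have he : ∀ j j', C * (Matrix.of fun i i' => π (Matrix.single i' j' 1) i j) = (Matrix.of fun i i' => π (Matrix.single i' j' 1) i j) * C := by
      intro j j'
      apply hC
      intro τ i i'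
      show π (Matrix.single (i' ∘ τ) j' 1) (i ∘ τ) j = π (Matrix.single i' j' 1) i j
      have h1 : π (Matrix.single (i' ∘ τ) j' 1) (i ∘ τ) j = Lσ τ (π (Matrix.single (i' ∘ τ) j' 1)) i j := rfl
      rw [h1, ← hπeq]
      have h2 : Lσ τ (Matrix.single (i' ∘ τ) j' (1:K)) = Matrix.single i' j' 1 := by
        ext a b
        show Matrix.single (i' ∘ τ) j' 1 (a ∘ τ) b = _
        simp only [Matrix.single_apply, τ.surjective.injective_comp_right.eq_iff]
      rw [h2]
    ext i j
    rw [mul_one, hs C, hs 1]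
    simp only [Matrix.mul_apply, Matrix.sum_apply, Matrix.smul_apply, Matrix.one_apply, smul_eq_mul, Finset.mul_sum]
    rw [Finset.sum_comm]
    rw [Finset.sum_comm (f := fun i' j' => C i' j' * _)]
    have h2 : ∀ i' , ∑ l, ∑ j', C i l * ((if i' = j' then 1 else 0) * π (Matrix.single i' j' 1) l j) = ∑ l, C l i' * π (Matrix.single l i' 1) i j := by
      intro i'
      have := congrFun (congrFun (he j i') i) i'
      simp only [Matrix.mul_apply, Matrix.of_apply] at this
      simp only [ite_mul, one_mul, zero_mul, mul_ite, mul_zero, Finset.sum_ite_eq, Finset.mem_univ, if_true]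
      rw [this]
      exact Finset.sum_congr rfl fun _ _ => mul_comm _ _
    exact Finset.sum_congr rfl fun i' _ => h2 i'
  have h1 : (1 : Matrix (Fin d → Fin 5) (Fin d → Fin 5) K) ∈ B := Submodule.subset_span ⟨1, rfl⟩
  rw [hπid 1 h1, mul_one] at key
  have hCB : C ∈ B := by rw [key]; exact hπB _
  rw [Submodule.mem_span_range_iff_exists_fun] at hCB
  obtain ⟨γ, hγ⟩ := hCB
  refine ⟨γ, fun i j => ?_⟩
  rw [← hγ, Matrix.sum_apply]
  refine Finset.sum_congr rfl fun σ _ => ?_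
  show γ σ * (1 : Matrix _ _ K) (i ∘ σ) j = _
  rw [Matrix.one_apply, dl]

/-- tensor power -/
def tp (g : Matrix (Fin 5) (Fin 5) K) : Matrix (Fin d → Fin 5) (Fin d → Fin 5) K := fun i j => ∏ k, g (i k) (j k)

theorem tp_mul (g h : Matrix (Fin 5) (Fin 5) K) : tp (d := d) (g * h) = tp g * tp h := by
  ext i j
  simp only [tp, Matrix.mul_apply, ← Finset.prod_mul_distrib]
  rw [Finset.prod_univ_sum]
  simp

theorem tp_one : tp (d := d) (1 : Matrix (Fin 5) (Fin 5) K) = 1 := by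
  ext i j
  simp only [tp, Matrix.one_apply]
  by_cases h : i = j
  · subst h; simp
  · rw [if_neg h]
    obtain ⟨k, hk⟩ := Function.ne_iff.1 h
    exact Finset.prod_eq_zero (Finset.mem_univ k) (if_neg hk)

theorem cent_tp (C : Matrix (Fin d → Fin 5) (Fin d → Fin 5) K)
    (hC : ∀ g : Matrix (Fin 5) (Fin 5) K, g.det ≠ 0 → C * tp g = tp g * C)
    (e : Matrix (Fin d → Fin 5) (Fin d → Fin 5) K) (he : ∀ (τ : Perm (Fin d)) i j, e (i ∘ τ) (j ∘ τ) = e i j) : C * e = e * C := by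
  ext i j
  let V := Fin 5 × Fin 5
  let P : MvPolynomial V K := ∑ l, MvPolynomial.C (C i l) * (∏ k, MvPolynomial.X (l k, j k)) - ∑ l, MvPolynomial.C (C l j) * (∏ k, MvPolynomial.X (i k, l k))
  have hP : P = 0 := by
    have h1 : P * (Matrix.mvPolynomialX (Fin 5) (Fin 5) K).det = 0 := by
      apply MvPolynomial.funext
      intro x
      rw [map_mul, map_zero, mul_eq_zero]
      by_cases hd : (Matrix.of fun a b => x (a, b) : Matrix (Fin 5) (Fin 5) K).det = 0
      · right
        rw [RingHom.map_det]
        rw [← hd]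
        congr 1
        ext a b
        simp
      · left
        have := congrFun (congrFun (hC _ hd) i) j
        simp only [Matrix.mul_apply, tp, Matrix.of_apply] at this
        simp only [P, map_sub, map_sum, map_mul, map_prod, MvPolynomial.eval_C, MvPolynomial.eval_X]
        rw [this, sub_eq_zero]
        exact Finset.sum_congr rfl fun _ _ => mul_comm _ _
    rcases mul_eq_zero.1 h1 with h | h
    · exact h
    · exact absurd h (Matrix.det_mvPolynomialX_ne_zero (Fin 5) K)
  have h2 : ∀ a b : Fin d → Fin 5, DD (fun v : Fin d → V => e (fun k => (v k).1) (fun k => (v k).2)) (∏ k, MvPolynomial.X (a k, b k)) = d.factorial * e a b := by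
    intro a b
    rw [DD_prod]
    have : ∀ π : Perm (Fin d), e (fun k => (((fun k => (a k, b k)) ∘ π : Fin d → V) k).1) (fun k => (((fun k => (a k, b k)) ∘ π : Fin d → V) k).2) = e a b :=
      fun π => he π a b
    rw [Finset.sum_congr rfl fun π _ => this π]
    simp [Fintype.card_perm]
  have h3 := congrArg (DD (fun v : Fin d → V => e (fun k => (v k).1) (fun k => (v k).2))) hP
  simp only [P, map_sub, map_sum, map_zero, ← MvPolynomial.smul_eq_C_mul, map_smul, h2] at h3
  rw [sub_eq_zero] at h3
  simp only [Matrix.mul_apply]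
  have hf : (d.factorial : K) ≠ 0 := by exact_mod_cast d.factorial_ne_zero
  apply mul_left_cancel₀ hf
  rw [Finset.mul_sum, Finset.mul_sum]
  simp only [smul_eq_mul] at h3
  convert h3 using 2
  · ring
  · ring

/-- coefficients of the symmetric tensor -/
def cf {V : Type*} [DecidableEq V] (v : Fin d → V) : MvPolynomial V K →ₗ[K] K := DD (fun u => if u = v then 1 else 0)

theorem mon_prod {V : Type*} (m : V →₀ ℕ) : ∃ (e : ℕ) (u : Fin e → V), (MvPolynomial.monomial m (1:K)) = ∏ k, MvPolynomial.X (u k) := by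
  classical
  refine ⟨(Finsupp.toMultiset m).toList.length, (Finsupp.toMultiset m).toList.get, ?_⟩
  rw [← List.prod_ofFn]
  have h : List.ofFn (fun k => (MvPolynomial.X ((Finsupp.toMultiset m).toList.get k) : MvPolynomial V K)) = (Finsupp.toMultiset m).toList.map MvPolynomial.X := by
    conv_rhs => rw [← List.ofFn_get (Finsupp.toMultiset m).toList]
    rw [List.map_ofFn]; rfl
  rw [h, ← Multiset.prod_coe, ← Multiset.map_coe, Multiset.coe_toList, Finsupp.toMultiset_map]
  rw [MvPolynomial.monomial_eq, Finsupp.prod_toMultiset]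
  simp [Finsupp.prod_mapDomain_index, pow_add]

theorem cf_prod {V : Type*} [DecidableEq V] (v u : Fin d → V) :
    cf (K := K) v (∏ k, MvPolynomial.X (u k)) = ∑ π : Perm (Fin d), if u ∘ π = v then 1 else 0 := DD_prod _ _

theorem cf_prod_ne {V : Type*} [DecidableEq V] {e : ℕ} (h : e ≠ d) (v : Fin d → V) (u : Fin e → V) :
    cf (K := K) v (∏ k, MvPolynomial.X (u k)) = 0 := DD_prod_ne h _ _

theorem lin_ind {V : Type*} (P : MvPolynomial V K → Prop) (h1 : ∀ (e : ℕ) (u : Fin e → V), P (∏ k, MvPolynomial.X (u k)))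
    (h2 : ∀ (a : K) F, P F → P (a • F)) (h3 : ∀ F G, P F → P G → P (F + G)) (F) : P F := by
  induction F using MvPolynomial.induction_on' with
  | monomial m a =>
    obtain ⟨e, u, h⟩ := mon_prod (K := K) m
    have : MvPolynomial.monomial m a = a • MvPolynomial.monomial m (1:K) := by
      rw [MvPolynomial.smul_monomial, smul_eq_mul, mul_one]
    rw [this, h]
    exact h2 _ _ (h1 e u)
  | add p q hp hq => exact h3 _ _ hp hq

theorem cf_recon {V : Type*} [Fintype V] [DecidableEq V] (F : MvPolynomial V K) :
    ∃ N, F = ∑ d ∈ Finset.range N, ∑ v : Fin d → V, ((d.factorial : K)⁻¹ * cf v F) • ∏ k, MvPolynomial.X (v k) := by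
  suffices h : ∃ N₀, ∀ N ≥ N₀, F = ∑ d ∈ Finset.range N, ∑ v : Fin d → V, ((d.factorial : K)⁻¹ * cf v F) • ∏ k, MvPolynomial.X (v k) by
    obtain ⟨N₀, h⟩ := h; exact ⟨N₀, h _ le_rfl⟩
  induction F using lin_ind with
  | h1 e u =>
    refine ⟨e + 1, fun N hN => ?_⟩
    rw [Finset.sum_eq_single e]
    · simp only [cf_prod, mul_smul, ← Finset.smul_sum, Finset.sum_smul, ite_smul, one_smul, zero_smul]
      rw [Finset.sum_comm]
      have : ∀ π : Perm (Fin e), ∑ v : Fin e → V, (if u ∘ π = v then ∏ k, (MvPolynomial.X (v k) : MvPolynomial V K) else 0) = ∏ k, MvPolynomial.X (u k) := by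
        intro π
        rw [Finset.sum_ite_eq, if_pos (Finset.mem_univ _)]
        exact Equiv.prod_comp π (fun k => (MvPolynomial.X (u k) : MvPolynomial V K))
      rw [Finset.sum_congr rfl fun π _ => this π]
      simp only [Finset.sum_const, Finset.card_univ, Fintype.card_perm, Fintype.card_fin]
      rw [← Nat.cast_smul_eq_nsmul K, smul_smul, inv_mul_cancel₀ (by exact_mod_cast e.factorial_ne_zero), one_smul]
    · intro d _ hd
      simp [cf_prod_ne hd.symm]
    · intro h
      exact absurd (Finset.mem_range.2 (by omega)) h
  | h2 a F h =>
    obtain ⟨N, h⟩ := h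
    refine ⟨N, fun M hM => ?_⟩
    conv_lhs => rw [h M hM]
    simp only [map_smul, Finset.smul_sum, smul_smul, smul_eq_mul]
    refine Finset.sum_congr rfl fun d _ => Finset.sum_congr rfl fun v _ => ?_
    congr 1; ring
  | h3 F G h1 h2 =>
    obtain ⟨N, h⟩ := h1
    obtain ⟨N', h'⟩ := h2
    refine ⟨max N N', fun M hM => ?_⟩
    conv_lhs => rw [h M (le_trans (le_max_left _ _) hM), h' M (le_trans (le_max_right _ _) hM)]
    simp only [map_add, mul_add, add_smul, Finset.sum_add_distrib]

theorem cf_subst {V : Type*} [Fintype V] [DecidableEq V] (S : V → V → K) (v : Fin d → V) (F : MvPolynomial V K) :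
    cf v (MvPolynomial.aeval (fun u => ∑ u', S u u' • (MvPolynomial.X u' : MvPolynomial V K)) F) =
      ∑ u : Fin d → V, (∏ k, S (u k) (v k)) * cf u F := by
  induction F using lin_ind with
  | h1 e u =>
    rw [map_prod]
    simp only [MvPolynomial.aeval_X]
    rw [Finset.prod_univ_sum]
    simp only [Finset.prod_smul, map_sum, map_smul, Fintype.piFinset_univ]
    by_cases h : e = d
    · subst h
      simp only [cf_prod, smul_eq_mul, Finset.mul_sum, mul_ite, mul_one, mul_zero]
      refine (Finset.sum_comm).trans (Eq.trans ?_ Finset.sum_comm)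
      refine Finset.sum_congr rfl fun π _ => ?_
      rw [Finset.sum_ite_eq, if_pos (Finset.mem_univ _), Finset.sum_eq_single (v ∘ π.symm), if_pos]
      · rw [← Equiv.prod_comp π]; simp
      · funext k; simp
      · intro b _ hb
        rw [if_neg]
        rintro rfl
        exact hb (by funext k; simp)
      · simp
    · simp [cf_prod_ne h]
  | h2 a F h => rw [map_smul, map_smul, h, smul_eq_mul, Finset.mul_sum]; refine Finset.sum_congr rfl fun u _ => ?_; rw [map_smul, smul_eq_mul]; ring
  | h3 F G h1 h2 => simp only [map_add, h1, h2, mul_add, Finset.sum_add_distrib]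

end
end C520

namespace C520
open Equiv
section
variable {K : Type*} [Field K] [CharZero K] {d : ℕ}

def mvE (d : ℕ) : (Fin d → MV) ≃ (Fin d → Bool) × (Fin d → Fin 5) × (Fin d → Fin 5) :=
  (Equiv.arrowProdEquivProdArrow _ _ _).trans ((Equiv.refl _).prodCongr (Equiv.arrowProdEquivProdArrow _ _ _))

def mvc (ε : Fin d → Bool) (i j : Fin d → Fin 5) : Fin d → MV := fun k => (ε k, i k, j k)

theorem sum_mv {R : Type*} [AddCommMonoid R] (f : (Fin d → MV) → R) :
    ∑ u, f u = ∑ ε : Fin d → Bool, ∑ i : Fin d → Fin 5, ∑ j : Fin d → Fin 5, f (mvc ε i j) := by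
  rw [← Equiv.sum_comp (mvE d).symm, Fintype.sum_prod_type]
  refine Finset.sum_congr rfl fun ε _ => ?_
  rw [Fintype.sum_prod_type]
  rfl

theorem inv_TA (F : MvPolynomial MV K)
    (hF : ∀ g h A B : Matrix (Fin 5) (Fin 5) K, g * h = 1 → h * g = 1 → MvPolynomial.eval (sub (g * A * h) (g * B * h)) F = MvPolynomial.eval (sub A B) F) :
    F ∈ TA K := by
  have h1 : ∀ (d : ℕ) (ε : Fin d → Bool) (g h : Matrix (Fin 5) (Fin 5) K), g * h = 1 → h * g = 1 →
      (Matrix.of fun j i => cf (mvc ε i j) F) * tp g = tp g * (Matrix.of fun j i => cf (mvc ε i j) F) := by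
    intro d ε g h hgh hhg
    let S : MV → MV → K := fun u v => if u.1 = v.1 then g u.2.1 v.2.1 * h v.2.2 u.2.2 else 0
    have hS : MvPolynomial.aeval (fun u => ∑ u', S u u' • (MvPolynomial.X u' : MvPolynomial MV K)) F = F := by
      apply MvPolynomial.funext
      intro x
      have e1 : (MvPolynomial.eval x) ((MvPolynomial.aeval (fun u => ∑ u', S u u' • (MvPolynomial.X u' : MvPolynomial MV K))) F) =
        MvPolynomial.eval (fun u => ∑ u', S u u' * x u') F := by
        have : (MvPolynomial.aeval (R := K) x).comp (MvPolynomial.aeval (fun u => ∑ u', S u u' • (MvPolynomial.X u' : MvPolynomial MV K))) =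
          MvPolynomial.aeval (R := K) (fun u => ∑ u', S u u' * x u') := by
          apply MvPolynomial.algHom_ext
          intro i
          simp
        have := congrArg (fun f => f F) this
        simpa [MvPolynomial.aeval_eq_eval] using this
      rw [e1]
      have := hF g h (Matrix.of fun i j => x (false, i, j)) (Matrix.of fun i j => x (true, i, j)) hgh hhg
      have e2 : sub (Matrix.of fun i j => x (false, i, j)) (Matrix.of fun i j => x (true, i, j)) = x := by
        funext ⟨b, i, j⟩; cases b <;> rfl
      have e3 : sub (g * (Matrix.of fun i j => x (false, i, j)) * h) (g * (Matrix.of fun i j => x (true, i, j)) * h) = fun u => ∑ u', S u u' * x u' := by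
        funext ⟨b, i, j⟩
        rw [Fintype.sum_prod_type, Fintype.sum_bool]
        cases b <;> simp only [sub, S, cond_true, cond_false, Matrix.mul_apply, Matrix.of_apply, Fintype.sum_prod_type, reduceCtorEq, if_true, if_false, zero_mul, Finset.sum_const_zero, add_zero, zero_add, Finset.sum_mul] <;>
        · rw [Finset.sum_comm]
          refine Finset.sum_congr rfl fun k _ => Finset.sum_congr rfl fun l _ => ?_
          ring
      rw [e2, e3] at this
      exact this
    have h2 : ∀ i j, cf (mvc ε i j) F = ∑ i', ∑ j', tp g i' i * tp h j j' * cf (mvc ε i' j') F := by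
      intro i j
      conv_lhs => rw [← hS]
      rw [cf_subst, sum_mv, Finset.sum_eq_single ε]
      · refine Finset.sum_congr rfl fun i' _ => Finset.sum_congr rfl fun j' _ => ?_
        simp only [S, mvc, if_true, tp, Finset.prod_mul_distrib]
      · intro ε' _ hε
        obtain ⟨k, hk⟩ := Function.ne_iff.1 hε
        refine Finset.sum_eq_zero fun i' _ => Finset.sum_eq_zero fun j' _ => ?_
        rw [Finset.prod_eq_zero (Finset.mem_univ k), zero_mul]
        simp only [S, mvc]
        rw [if_neg hk]
      · simp
    set D : Matrix (Fin d → Fin 5) (Fin d → Fin 5) K := Matrix.of fun j i => cf (mvc ε i j) F with hD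
    have h3 : D = tp h * D * tp g := by
      ext j i
      rw [Matrix.mul_apply]
      simp only [Matrix.mul_apply, Finset.sum_mul]
      show cf (mvc ε i j) F = _
      rw [h2]
      refine Finset.sum_congr rfl fun i' _ => Finset.sum_congr rfl fun j' _ => ?_
      simp only [hD, Matrix.of_apply]
      ring
    calc D * tp g = tp (g * h) * (D * tp g) := by rw [hgh, tp_one, one_mul]
      _ = tp g * (tp h * D * tp g) := by rw [tp_mul]; simp only [mul_assoc]
      _ = _ := by rw [← h3]
  have h2 : ∀ (d : ℕ) (ε : Fin d → Bool), ∃ γ : Perm (Fin d) → K, ∀ i j, cf (mvc ε i j) F = ∑ σ, γ σ * dl K (j, i) σ := by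
    intro d ε
    obtain ⟨γ, hγ⟩ := dcent (Matrix.of fun j i => cf (mvc ε i j) F) (cent_tp _ fun g hg =>
      h1 d ε g g⁻¹ (Matrix.mul_nonsing_inv _ (isUnit_iff_ne_zero.2 hg)) (Matrix.nonsing_inv_mul _ (isUnit_iff_ne_zero.2 hg)))
    exact ⟨γ, fun i j => hγ j i⟩
  obtain ⟨N, hN⟩ := cf_recon F
  rw [hN]
  refine Subalgebra.sum_mem _ fun d _ => ?_
  rw [sum_mv]
  refine Subalgebra.sum_mem _ fun ε _ => ?_
  obtain ⟨γ, hγ⟩ := h2 d ε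
  have : ∑ i : Fin d → Fin 5, ∑ j : Fin d → Fin 5, ((d.factorial : K)⁻¹ * cf (mvc ε i j) F) • ∏ k, (MvPolynomial.X (mvc ε i j k) : MvPolynomial MV K)
    = ∑ σ : Perm (Fin d), ((d.factorial : K)⁻¹ * γ σ) • trP σ.symm (fun k => (gev [ε k] : Matrix _ _ (MvPolynomial MV K))) := by
    simp only [hγ, Finset.mul_sum, Finset.sum_smul, trP_letters, Finset.smul_sum]
    rw [Finset.sum_comm]
    refine Eq.trans ?_ Finset.sum_comm
    refine Finset.sum_congr rfl fun j _ => ?_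
    rw [Finset.sum_comm]
    refine Finset.sum_congr rfl fun σ _ => ?_
    rw [Finset.sum_eq_single (j ∘ σ)]
    · simp [dl, mvc]
    · intro i _ hi
      simp [dl, Ne.symm hi]
    · simp
  rw [this]
  refine Subalgebra.sum_mem _ fun σ _ => Subalgebra.smul_mem _ ?_ _
  exact trP_mem _ _ (TA K).toSubring d σ.symm (fun k => [ε k]) (fun i => by simp) (fun w _ _ => gt_mem w)

theorem FFT (f : sl K 5 × sl K 5 → K) (hf : f ∈ pureAlg0 K 5) : f ∈ Algebra.adjoin K {f | ∃ w : Wd, w ≠ [] ∧ f = fw (K := K) w} := by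
  obtain ⟨⟨F0, hF0⟩, hinv⟩ := hf
  let F : MvPolynomial MV K := MvPolynomial.aeval (fun v : MatVar 5 => match v with
    | Sum.inl ij => dev (K := K) (GX false) ij.1 ij.2
    | Sum.inr ij => dev (K := K) (GX true) ij.1 ij.2) F0
  have hF : ∀ A B : Matrix (Fin 5) (Fin 5) K, MvPolynomial.eval (sub A B) F = f (dsl A, dsl B) := by
    intro A B
    rw [hF0]
    have : (MvPolynomial.aeval (R := K) (sub A B)).comp (MvPolynomial.aeval (fun v : MatVar 5 => match v with
    | Sum.inl ij => dev (K := K) (GX false) ij.1 ij.2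
    | Sum.inr ij => dev (K := K) (GX true) ij.1 ij.2)) = MvPolynomial.aeval (R := K) (pairSub (dsl A : Matrix (Fin 5) (Fin 5) K) (dsl B)) := by
      apply MvPolynomial.algHom_ext
      rintro (⟨i, j⟩ | ⟨i, j⟩) <;> by_cases hij : i = j <;>
        simp [hij, pairSub, dsl, dev, GX, Matrix.trace, Matrix.one_apply, sub, apply_ite, MvPolynomial.smul_eq_C_mul]
    have := congrArg (fun f => f F0) this
    simp only [AlgHom.comp_apply, MvPolynomial.aeval_eq_eval] at this
    exact this
  have hTA : F ∈ TA K := by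
    apply inv_TA
    intro g h A B hgh hhg
    rw [hF, hF]
    let a : GL (Fin 5) K := ⟨g, h, hgh, hhg⟩
    have hc : ∀ A, dsl (g * A * h) = glConj a (dsl A) := by
      intro A
      apply Subtype.ext
      show dev (K := K) (g * A * h) = g * dev (K := K) A * h
      have : (g * A * h).trace = A.trace := by rw [Matrix.trace_mul_cycle, hhg, one_mul]
      simp only [dev, this, mul_sub, sub_mul, Matrix.mul_smul, Matrix.smul_mul, mul_one, hgh]
    rw [hc, hc]
    exact hinv a (dsl A, dsl B)
  have key : ∀ G ∈ TA K, (fun v : sl K 5 × sl K 5 => MvPolynomial.eval (sub (v.1 : Matrix (Fin 5) (Fin 5) K) v.2) G) ∈ Algebra.adjoin K {f | ∃ w : Wd, w ≠ [] ∧ f = fw (K := K) w} := by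
    intro G hG
    induction hG using Algebra.adjoin_induction with
    | mem x hx =>
      obtain ⟨w, hw, rfl⟩ := hx
      apply Algebra.subset_adjoin
      refine ⟨w, hw, ?_⟩
      funext v
      rw [eval_gev]; rfl
    | algebraMap r => 
      have := Subalgebra.algebraMap_mem (Algebra.adjoin K {f | ∃ w : Wd, w ≠ [] ∧ f = fw (K := K) w}) r
      convert this using 1
      funext v
      simp
    | add x y _ _ hx hy => simp only [map_add]; exact Subalgebra.add_mem _ hx hy
    | mul x y _ _ hx hy => simp only [map_mul]; exact Subalgebra.mul_mem _ hx hy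
  have := key F hTA
  convert this using 1
  funext v
  rw [hF, dsl_sl, dsl_sl]

end
end C520

namespace C520
/-- force a natural number before passing it on -/
def frc {α : Type} (n : Nat) (k : Nat → α) : α :=
  Nat.rec (motive := fun _ => α) (k 0) (fun m _ => k m) (Nat.add n 1)

def bsel {α : Type} (b : Bool) (x y : α) : α := Bool.rec (motive := fun _ => α) y x b

inductive Tr where
  | leaf (v : Nat) : Tr
  | node (l r : Tr) : Tr

def Tr.get (T : Tr) : Nat → Nat → Nat :=
  Tr.rec (motive := fun _ => Nat → Nat → Nat) (fun v _ _ => v)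
    (fun _ _ gl gr k i => frc (Nat.pred k) fun k => bsel (Nat.ble (Nat.pow 2 k) i)
      (frc (Nat.sub i (Nat.pow 2 k)) fun j => gr k j) (gl k i)) T

def Tr.set {α : Type} (T : Tr) : Nat → Nat → Nat → (Tr → α) → α :=
  Tr.rec (motive := fun _ => Nat → Nat → Nat → (Tr → α) → α) (fun _ _ _ v c => c (Tr.leaf v))
    (fun l r sl sr k i v c => frc (Nat.pred k) fun k => bsel (Nat.ble (Nat.pow 2 k) i)
      (frc (Nat.sub i (Nat.pow 2 k)) fun j => sr k j v fun r' => c (Tr.node l r'))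
      (sl k i v fun l' => c (Tr.node l' r))) T

def Tr.full (d : Nat) : Tr :=
  Nat.rec (motive := fun _ => Tr) (Tr.leaf 0) (fun _ t => Tr.node t t) d

def XX : Nat := 16777259

/-- Σ digits * rows -/
def ap (T : Tr) : Nat → Nat → Nat → Nat :=
  Tr.rec (motive := fun _ => Nat → Nat → Nat → Nat)
    (fun r _ V acc => Nat.add acc (Nat.mul (Nat.mod V 7) r))
    (fun _ _ al ar k V acc => bsel (Nat.beq V 0) acc
      (frc (Nat.pred k) fun k => frc (Nat.pow XX (Nat.pow 2 k)) fun Y =>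
        frc (Nat.div V Y) fun hi => frc (Nat.mod V Y) fun lo =>
        frc (al k lo acc) fun a => ar k hi a)) T

def nrm (k : Nat) : Nat → Nat :=
  Nat.rec (motive := fun _ => Nat → Nat) (fun V => Nat.mod V 7)
    (fun k ih V => bsel (Nat.beq V 0) 0
      (frc (Nat.pow XX (Nat.pow 2 k)) fun Y =>
        frc (Nat.div V Y) fun hi => frc (Nat.mod V Y) fun lo =>
        frc (ih lo) fun a => frc (ih hi) fun b => Nat.add a (Nat.mul b Y))) k

def apN (T : Tr) (V : Nat) : Nat := frc (ap T 9 V 0) fun W => nrm 9 W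

/-- `- c⁻¹ mod 7` -/
def ninv (c : Nat) : Nat := Nat.mod (Nat.mul 6 (Nat.pow c 5)) 7

/-- insert one row -/
def elim {α : Type} (T : Tr) : Nat → Nat → Nat → (Nat → α) → (Tr → α) → α :=
  Tr.rec (motive := fun _ => Nat → Nat → Nat → (Nat → α) → (Tr → α) → α)
    (fun r _ o V kc ks => frc (Nat.pow XX o) fun Y =>
      frc (Nat.mod (Nat.div V Y) 7) fun c => frc (Nat.mod V Y) fun V' =>
      bsel (Nat.beq c 0) (kc V')
        (bsel (Nat.beq r 0)
          (frc (nrm 9 (Nat.mul (ninv c) V')) fun red => ks (Tr.leaf (Nat.succ red)))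
          (frc (Nat.add V' (Nat.mul c (Nat.pred r))) kc)))
    (fun l r el er k o V kc ks => bsel (Nat.ble (Nat.pow XX o) V)
      (frc (Nat.pred k) fun k => frc (Nat.add o (Nat.pow 2 k)) fun o' =>
        er k o' V (fun V' => el k o V' kc (fun l' => ks (Tr.node l' r))) (fun r' => ks (Tr.node l r')))
      (kc V)) T

def ins {α : Type} (V : Nat) (T : Tr) (k : Tr → α) : α := elim T 9 0 V (fun _ => k T) k

structure St where
  n : Nat
  tabs : List (Nat × Tr)   -- oldest first : (n_{k-1}, table)
  l0 : Tr
  l1 : Tr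
  npl : List (Nat × Nat)           -- (z,i) for basis
  pvl : List (Nat × Nat × Nat)     -- (z,i,tab)

/-- word normal form -/
def nfw (w : List Bool) : List (Nat × Tr) → Nat → Nat :=
  List.rec (motive := fun _ => List (Nat × Tr) → Nat → Nat) (fun _ V => V)
    (fun z _ ih tabs V => List.rec (motive := fun _ => Nat) (bsel z (Nat.mul V (Nat.pow XX 0)) V) (fun t ts _ =>
      frc (bsel z (Nat.mul V (Nat.pow XX t.1)) V) fun V => frc (ap t.2 9 V 0) fun V' => ih ts V') tabs) w

/-- vector of a word over the columns `{x,y} × B` -/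
def wrow (s : St) (w : List Bool) : Nat :=
  frc (nfw w.dropLast s.tabs 1) fun V => bsel (w.getLastD false) (Nat.mul V (Nat.pow XX s.n)) V

def sumRows (s : St) (ws : List (List Bool)) : Nat :=
  List.rec (motive := fun _ => Nat → Nat) (fun a => a) (fun w _ ih a => frc (Nat.add a (wrow s w)) ih) ws 0

/-- arrangements of `a a a a b` -/
def arr5 (a b : List Bool) : List (List Bool) :=
  [b++a++a++a++a, a++b++a++a++a, a++a++b++a++a, a++a++a++b++a, a++a++a++a++b]
def arr20 (a b c : List Bool) : List (List Bool) :=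
  [b++c++a++a++a, b++a++c++a++a, b++a++a++c++a, b++a++a++a++c,
   a++b++c++a++a, a++b++a++c++a, a++b++a++a++c, a++a++b++c++a, a++a++b++a++c, a++a++a++b++c,
   c++b++a++a++a, c++a++b++a++a, c++a++a++b++a, c++a++a++a++b,
   a++c++b++a++a, a++c++a++b++a, a++c++a++a++b, a++a++c++b++a, a++a++c++a++b, a++a++a++c++b]

/-- decode a word: binary with leading 1, low bit first -/
def dec (n : Nat) : List Bool :=
  Nat.rec (motive := fun _ => Nat → List Bool) (fun _ => [])
    (fun _ ih m => bsel (Nat.ble m 1) [] (List.cons (Nat.beq (Nat.mod m 2) 1) (frc (Nat.div m 2) ih))) 20 n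

/-- relation data: a, b, c ; c = 0 means type a^4 b -/
def relWs (r : Nat × Nat × Nat) : List (List Bool) :=
  bsel (Nat.beq r.2.2 0) (arr5 (dec r.1) (dec r.2.1)) (arr20 (dec r.1) (dec r.2.1) (dec r.2.2))

def srows {α : Type} (s : St) (rs : List (Nat × Nat × Nat)) : Tr → (Tr → α) → α :=
  List.rec (motive := fun _ => Tr → (Tr → α) → α) (fun T k => k T)
    (fun r _ ih T k => frc (sumRows s (relWs r)) fun V => ins V T fun T' => ih T' k) rs

def mkplt {α : Type} (n : Nat) (lt : Tr) (npl : List (Nat × Nat)) : Nat → Tr → (Tr → α) → α :=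
  List.rec (motive := fun _ => Nat → Tr → (Tr → α) → α) (fun _ T k => k T)
    (fun p _ ih i T k => frc (Nat.mul (lt.get 9 p.2) (Nat.pow XX (Nat.mul p.1 n))) fun v =>
      T.set 9 i v fun T' => frc (Nat.add i 1) fun i' => ih i' T' k) npl

def lrows {α : Type} (n : Nat) (lt plt : Tr) (pvl : List (Nat × Nat × Nat)) : Tr → (Tr → α) → α :=
  List.rec (motive := fun _ => Tr → (Tr → α) → α) (fun T k => k T)
    (fun p _ ih T k =>
      frc (ap plt 9 p.2.2 0) fun a =>
      frc (Nat.add (Nat.mul (lt.get 9 p.2.1) (Nat.pow XX (Nat.mul p.1 n))) (Nat.mul 6 a)) fun V =>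
      ins V T fun T' => ih T' k) pvl

/-- cyclic rows: plt_z[i] - X^(zn+i) -/
def crows {α : Type} (o : Nat) (plt : Tr) (m : Nat) : Nat → Tr → (Tr → α) → α :=
  Nat.rec (motive := fun _ => Nat → Tr → (Tr → α) → α) (fun _ T k => k T)
    (fun _ ih i T k =>
      frc (Nat.add (plt.get 9 i) (Nat.mul 6 (Nat.pow XX (Nat.add o i)))) fun V =>
      ins V T fun T' => frc (Nat.add i 1) fun i' => ih i' T' k) m

/-- generator rows: each is a pair (plus, minus) of words lists -/
def grows {α : Type} (s : St) (rs : List (List Bool × List (List Bool))) : Tr → (Tr → α) → α :=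
  List.rec (motive := fun _ => Tr → (Tr → α) → α) (fun T k => k T)
    (fun r _ ih T k => frc (Nat.add (wrow s r.1) (Nat.mul 6 (sumRows s r.2))) fun V =>
      ins V T fun T' => ih T' k) rs

/-- all entries below m nonzero -/
def allp (T : Tr) (m : Nat) : Nat → Bool :=
  Nat.rec (motive := fun _ => Nat → Bool) (fun _ => true)
    (fun _ ih i => bsel (Nat.beq (T.get 9 i) 0) false (frc (Nat.add i 1) ih)) m

/-- finalize columns z*n+i, loop over j -/
def fin {α : Type} (n : Nat) (T : Tr) (m : Nat) :
    (j n' : Nat) → Tr → List (Nat × Nat) → List (Nat × Nat × Nat) →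
    (Nat → Tr → List (Nat × Nat) → List (Nat × Nat × Nat) → α) → α :=
  Nat.rec (motive := fun _ => (j n' : Nat) → Tr → List (Nat × Nat) → List (Nat × Nat × Nat) →
    (Nat → Tr → List (Nat × Nat) → List (Nat × Nat × Nat) → α) → α)
    (fun _ n' U a b k => k n' U a b)
    (fun _ ih j n' U a b k =>
      frc (T.get 9 j) fun r => frc (Nat.add j 1) fun j' => frc (Nat.div j n) fun z => frc (Nat.mod j n) fun i =>
        (bsel (Nat.beq r 0)
          (frc (Nat.pow XX n') fun v => U.set 9 j v fun U' => frc (Nat.add n' 1) fun n'' =>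
            ih j' n'' U' (List.cons (z,i) a) b k)
          (frc (apN U (Nat.pred r)) fun v => U.set 9 j v fun U' =>
            ih j' n' U' a (List.cons (z,i,v) b) k))) m

/-- new left table -/
def newl {α : Type} (tab plt : Tr) (m : Nat) : Nat → Tr → (Tr → α) → α :=
  Nat.rec (motive := fun _ => Nat → Tr → (Tr → α) → α) (fun _ T k => k T)
    (fun _ ih i T k => frc (plt.get 9 i) fun p => frc (apN tab p) fun v => T.set 9 i v fun T' =>
      frc (Nat.add i 1) fun i' => ih i' T' k) m

def step (s : St) (rs : List (Nat × Nat × Nat)) (gs : List (List Bool × List (List Bool)))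
    (k : St → Bool) : Bool :=
  bsel (Nat.ble s.n 250)
  (mkplt s.n s.l0 s.npl 0 (Tr.full 9) fun p0 =>
  mkplt s.n s.l1 s.npl 0 (Tr.full 9) fun p1 =>
  lrows s.n s.l0 p0 s.pvl (Tr.full 9) fun T =>
  lrows s.n s.l1 p1 s.pvl T fun T =>
  bsel (crows 0 p0 s.n 0 T fun T => crows s.n p1 s.n 0 T fun T => grows s gs T fun T => allp T (Nat.mul 2 s.n) 0)
  (srows s rs T fun T =>
  fin s.n T (Nat.mul 2 s.n) 0 0 (Tr.full 9) [] [] fun n' tab a b =>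
  newl tab p0 s.n 0 (Tr.full 9) fun l0 =>
  newl tab p1 s.n 0 (Tr.full 9) fun l1 =>
  k ⟨n', s.tabs ++ [(s.n, tab)], l0, l1, a.reverse, b.reverse⟩) false) false

def st1 : St :=
  let T := (Tr.full 9).set 9 0 1 fun T => T.set 9 1 XX fun T => T
  ⟨2, [(1, T)], (Tr.full 9).set 9 0 1 id, (Tr.full 9).set 9 0 XX id, [(0,0),(1,0)], []⟩

def runN (rels : List (List (Nat × Nat × Nat) × List (List Bool × List (List Bool)))) : St → Bool :=
  List.rec (motive := fun _ => St → Bool) (fun s => Nat.beq s.n 0) (fun r _ ih s => step s r.1 r.2 ih) rels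

def expd (l : List (Nat × Nat)) : List Bool := l.flatMap fun p => List.replicate p.1 false ++ List.replicate p.2 true
def swp (w : List Bool) : List Bool := w.map not
/-- digits with bit `p` set -/
def hiM (w0 p : Nat) (d : Nat) : Nat :=
  Nat.rec (motive := fun _ => Nat) 0 (fun d ih => bsel (Nat.beq d p)
    (Nat.shiftLeft (Nat.sub (Nat.pow 2 (Nat.mul w0 (Nat.pow 2 d))) 1) (Nat.mul w0 (Nat.pow 2 d)))
    (frc ih fun h => Nat.lor h (Nat.shiftLeft h (Nat.mul w0 (Nat.pow 2 d))))) d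

def mskM (w0 d p q : Nat) : Nat :=
  frc (hiM w0 p d) fun a => frc (hiM w0 q d) fun b => Nat.xor a (Nat.land a b)

def xorS (_s : Nat) (a b : Nat) : Nat := Nat.xor a b
def landS (_s : Nat) (a b : Nat) : Nat := Nat.land a b
def shlS (_s : Nat) (a b : Nat) : Nat := Nat.shiftLeft a b
def shrS (_s : Nat) (a b : Nat) : Nat := Nat.shiftRight a b
def addS (_s : Nat) (a b : Nat) : Nat := Nat.add a b
def frcS {α : Type} (_s : Nat) (n : Nat) (k : Nat → α) : α := 
  Nat.rec (motive := fun _ => α) (k 0) (fun m _ => k m) (Nat.add n 1)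

/-- exchange positions p < q -/
def dsw (w0 d : Nat) (s p q : Nat) (V : Nat) : Nat :=
  frc p fun p => frc q fun q =>
  frc (Nat.mul w0 (Nat.sub (Nat.pow 2 q) (Nat.pow 2 p))) fun h =>
  frcS s (landS s (xorS s (shrS s V h) V) (mskM w0 d p q)) fun t =>
  xorS s (xorS s V t) (shlS s t h)

def swT (w0 d : Nat) (l : Nat) : Nat → Nat → Nat → Nat → Nat :=
  Nat.rec (motive := fun _ => Nat → Nat → Nat → Nat → Nat) (fun _ _ _ V => V)
    (fun _ ih s o g V => frcS s (ih (Nat.succ s) (Nat.succ o) g V) fun V =>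
      dsw w0 d s o (Nat.add o g) V) l

def rotT (w0 d : Nat) (fuel : Nat) : Nat → Nat → Nat → Nat → Nat → Nat :=
  Nat.rec (motive := fun _ => Nat → Nat → Nat → Nat → Nat → Nat) (fun _ _ _ _ V => V)
    (fun _ ih s o l m V => bsel (Nat.beq (Nat.mul l m) 0) V
      (bsel (Nat.ble l m)
        (frcS s (ih (Nat.mul s 2) (Nat.add o l) l (Nat.sub m l) V) fun V => swT w0 d l s o l V)
        (frcS s (ih (Nat.mul s 2) o (Nat.sub l m) m V) fun V =>
           swT w0 d m s (Nat.sub (Nat.add o l) m) m V))) fuel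

/-- sum over insertion of `a` into the blocks `ls` -/
def cyL {α : Type} (a : Nat) (ls : List Nat) : List Nat → Nat → (List Nat → Nat → α) → (α → α → α) → α → α :=
  List.rec (motive := fun _ => List Nat → Nat → (List Nat → Nat → α) → (α → α → α) → α → α) (fun _ _ _ _ z => z)
    (fun b bs ih pre o f ad z => ad (f (pre ++ (Nat.add a b) :: bs) o)
      (ih (pre ++ [b]) (Nat.add o b) f ad z)) ls

def cyT (w0 d V : Nat) (n : Nat) : Nat → List Nat → Nat :=
  Nat.rec (motive := fun _ => Nat → List Nat → Nat) (fun _ _ => V)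
    (fun n ih s ls => List.rec (motive := fun _ => Nat) V (fun a ls _ =>
      cyL a ls [] 0 (fun ls' o => 
         frcS (Nat.add s o) (ih (Nat.add (Nat.mul s 20) o) ls') fun U => rotT w0 d 20 (Nat.add (Nat.mul s 20) o) 0 a o U)
         (fun x y => frcS s x fun x => frcS s y fun y => addS s x y) 0) ls) n

def lensL (k : Nat) : Nat → Nat → List (List Nat) :=
  Nat.rec (motive := fun _ => Nat → Nat → List (List Nat))
    (fun _ rem => bsel (Nat.beq rem 0) [[]] [])
    (fun _ ih lo rem => (List.range' lo (rem+1-lo)).flatMap fun l => (ih l (rem-l)).map (l :: ·)) k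

/-- table of all ones -/
def repu (w0 n : Nat) : Nat := Nat.div (Nat.sub (Nat.pow 2 (Nat.mul w0 n)) 1) (Nat.sub (Nat.pow 2 w0) 1)

def put1 (w0 : Nat) (c v V : Nat) : Nat := 
  frc V fun V => Nat.sub (Nat.add V (Nat.shiftLeft v (Nat.mul w0 c))) (Nat.shiftLeft 32 (Nat.mul w0 c))

def putL (w0 d : Nat) (f : Nat) (cpl : Bool) (l : List Nat) (V : Nat) : Nat :=
  List.rec (motive := fun _ => Nat) V (fun n _ ih => frc (Nat.div n 64) fun c => frc (Nat.mod n 64) fun v =>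
    frc ih fun V => bsel cpl 
      (put1 w0 (Nat.add (Nat.mul (Nat.pow 2 d) f) c) v (put1 w0 (Nat.sub (Nat.mul (Nat.pow 2 d) (Nat.succ f)) (Nat.succ c)) v V))
      (put1 w0 (Nat.add (Nat.mul (Nat.pow 2 d) f) c) v V)) l

def putLL (w0 d : Nat) (cpl : Bool) (ll : List (List Nat)) : Nat → Nat → Nat :=
  List.rec (motive := fun _ => Nat → Nat → Nat) (fun _ V => V) (fun l _ ih f V => 
    frc (putL w0 d f cpl l V) fun V => ih (Nat.succ f) V) ll

/-- cyclic sum -/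
def cycS (w0 D d V : Nat) (k : Nat) : Nat :=
  Nat.rec (motive := fun _ => Nat) 0 (fun _ ih => frc ih fun A => 
     frc (rotT w0 D 20 0 0 1 (Nat.sub d 1) A) fun A => Nat.add A V) k

def tabV (w0 D d F : Nat) (dt : List (List Nat) × List (List Nat)) : Nat :=
  frc (Nat.mul 32 (repu w0 (Nat.mul F (Nat.pow 2 d)))) fun O =>
  frc (putLL w0 d false dt.1 0 O) fun V => frc (putLL w0 d true dt.2 0 V) fun V =>
  cycS w0 D d V d

def chkC (w0 D d F V : Nat) (L : List (List Nat)) : Bool :=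
  frc V fun V => frc (Nat.mul (Nat.mul 3840 d) (repu w0 (Nat.mul F (Nat.pow 2 d)))) fun O =>
  List.rec (motive := fun _ => Nat → Bool) (fun _ => true) (fun l _ ih s =>
    bsel (Nat.beq (cyT w0 D V 4 s l) O) (ih (Nat.succ s)) false) L 1
def relData : List (List (Nat × Nat × Nat)) :=
 [[],[],[],
  [(2,2,0), (3,3,0), (2,3,0), (3,2,0), (2,3,3), (3,2,2)],
  [(2,7,0), (3,4,0), (2,3,7)],
  [(2,13,0), (2,15,0), (3,8,0), (3,10,0), (2,7,7), (3,4,4)],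
  [(2,25,0), (2,29,0), (2,27,0), (2,31,0), (3,20,0), (3,18,0), (3,22,0), (2,3,29), (2,3,27)],
  [(2,57,0), (2,53,0), (2,61,0), (2,59,0), (3,40,0), (3,36,0), (3,44,0), (3,42,0), (2,13,13), (3,10,10), (2,3,57), (2,3,61)],
  [(2,113,0), (2,105,0), (2,121,0), (2,117,0), (2,109,0), (2,125,0), (2,115,0), (2,123,0), (2,119,0), (3,72,0), (3,88,0), (3,84,0), (3,76,0), (3,92,0), (3,82,0), (3,90,0), (6,5,5), (5,6,6), (2,3,105), (2,3,121), (2,3,123)],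
  [(2,209,0), (2,241,0), (2,233,0), (2,217,0), (2,249,0), (2,245,0), (2,237,0), (2,211,0), (2,243,0), (2,235,0), (2,251,0), (2,247,0), (3,168,0), (3,152,0), (3,184,0), (3,164,0), (3,180,0), (3,178,0), (3,154,0), (3,186,0), (2,29,29), (3,20,20), (2,3,217), (2,3,243)],
  [(2,401,0), (2,465,0), (2,433,0), (2,497,0), (2,457,0), (2,489,0), (2,473,0), (2,485,0), (2,437,0), (2,501,0), (2,493,0), (2,467,0), (2,499,0), (2,491,0), (2,503,0), (3,328,0), (3,360,0), (3,344,0), (3,356,0), (3,308,0), (3,372,0), (3,364,0), (3,338,0), (3,370,0), (3,374,0), (6,9,9), (6,11,11), (2,3,489), (2,3,473), (2,3,485), (2,3,437)],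
  [(2,913,0), (2,977,0), (2,945,0), (2,969,0), (2,1001,0), (2,985,0), (2,997,0), (2,949,0), (2,1005,0), (2,979,0), (2,1003,0), (2,987,0), (3,712,0), (3,744,0), (3,728,0), (3,676,0), (3,740,0), (3,748,0)],
  [(2,1937,0), (2,1969,0), (2,1993,0), (2,2009,0), (2,2005,0), (2,1973,0), (2,2011,0), (3,1480,0), (3,1496,0)],
  [(2,3729,0), (2,3921,0), (2,4009,0), (2,4021,0), (3,2984,0), (3,2996,0)]]
def gensAt (d : Nat) : List (List Bool × List (List Bool)) :=
  ((symWords.map expd).filter (fun w => w.length == d)).map (fun w => (w, [])) ++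
  ((skewWords.map expd).filter (fun w => w.length == d)).map (fun w => (w, [swp w])) ++
  ((words81.map expd).filter (fun w => w.length == d)).flatMap (fun w => [(w, []), (swp w, [])])
def allData : List (List (Nat × Nat × Nat) × List (List Bool × List (List Bool))) :=
  List.zipIdx relData |>.map fun p => (p.1, gensAt (p.2+2))
/-- unpack the digits in base `2 ^ k` -/
def upk (k f n : Nat) : List Nat :=
  Nat.rec (motive := fun _ => Nat → List Nat) (fun _ => []) (fun _ ih n => bsel (Nat.beq n 0) [] (Nat.mod n (Nat.pow 2 k) :: frc (Nat.div n (Nat.pow 2 k)) ih)) f n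
def up2 (k : Nat) (p : List Nat × List Nat) : List (List Nat) × List (List Nat) := (p.1.map (upk k 400), p.2.map (upk k 400))
def dat2 := up2 8 ([161],
  [33])
def dat3 := up2 9 ([],
  [17185])
def dat4 := up2 10 ([801,
  673],
  [34337])
def dat5 := up2 11 ([],
  [140578337,
  1313])
def dat6 := up2 12 ([11140641,
  11139873,
  11140385],
  [10615841,
  9574943])
def dat7 := up2 13 ([],
  [20895031926125222945,
  52688417,
  52689441])
def dat8 := up2 14 ([12882378386319389896457249,
  57569956309005855,
  57569956342528545,
  180907295,
  189265185],
  [10313134313963770996059169,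
  46309926465172513,
  159937055])
def dat9 := up2 15 ([],
  [26717565404614532229545900801265938531767041387553,
  23173793964165376900315013509663,
  716955028742976146106276383,
  978014238524593350974174239,
  802830714189902881])
def dat10 := up2 16 ([3458328095,
  2904667423,
  1181133495558044503220007111216800040953120526485078313927022797121580062,
  1194856950961398376042513187222361277942095015153843212932312895896613922,
  55438679980385741579697122335,
  55436262163694389354616058401,
  238107804236900689500565061435482167841,
  272667732117407324139239478752488450593],
  [186267243061038806826368997522468228129,
  196890033556187917919787898327571358753,
  51103302024173267765589824543,
  11971071521639621665,
  46460956002733013478269903903])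
def dat11 := up2 17 ([],
  [1807720579541697060160458596828148645959983152346570997051583788054275097591502644103576730038693220221485588802949977222170677509079390778058842297971746,
  6612970564043299716891734525497845971963468182090626983959854107249105105718022917693750040626495767399012968249392108784089795912737,
  4359443943090955651495196083257355319602331939588943577894741821277360024805821470,
  22104360162527067052720287558313607943105980482350621543160626559236828495851572278347707813313636679046219944991,
  6004677991055913608708650966717561170695922597757039589904669852498114737588261918,
  15172079064536891128485090171308091194251846155944204314202655,
  3536787826411568396754499889697])
def dat12 := up2 18 ([347312156192773729338521316518143150066977456849790120662514475600421484923396623919649,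
  327689336658463917406577842964890111684825403600622430493857857672517291265683018319742110738976210172890062149905304613545643255164621996477775324387169413571221483306118648404351885889177648719567517071819862288423302686459103115864939797875641017422879,
  327692916494141539659851233763999764114398573486047826249641545091461577633459950249669320682942704191642293048798967621966446447155642356446040778089754914715738316451790813229295433315890813734605277726487137937233562129963842494911163518309504350671901,
  18190213602511202549589722289774152458573151620451145360978583625138201466476587016853154832240167553615616059044947429741677704884959903685155236557591600964422144609439237385201867343644389276936343458320867647712827012676700684399399971,
  18190412321794763816668449235627639018284786367147919714410279592550335416899498984362479371859293923711708416216304476010855853086466489639807157113469805343672704183460850046163452403311657384134536447494794109461415334344603940701590557,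
  658913343425446018237586108155899493482577120849216432971923460247947353027513213849104085748479756046494993433330924402462149587852308762363634150543496854277033284637,
  658891748803987040493783634998599777735022133843595336150006732751396600235250678030606769056192162550910444140616572671640820322443342025349291382332720441301694665763],
  [2952399958467497181242470132028564884781898268110614131755391810365299044443895334250429075588214031076068610492812937206508843888983093742630653625238815101431769505574923977936378417338361256066041620052667632436255,
  56872965790878081450839495293545995945614830612207294481047631201076407551323873591454860329766353874058855746836475284015802172950278133072106178078091390308344379711038102692333088384028406765452236251188760239954135670998207259681,
  240642614093500785749216220730839943682961233684646514071986733497387693586110432165685488871677881446602976662363020592686233761843146784699724779038164901428285458823686574033938324589888549391830523248228117034854331121902621,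
  34018725912150713348506480283733352299309640925722896914702960415192551403587232786627002905601070104431100637093913266829830604973980058417921770087453,
  34019325285585919648417823622216818289089445995587743768301914215270404116655006618141309417921835180402496041182023205388567396177236854518972734219299,
  4700663216111103075776839768392634216268004105768173003873605084034968769571])
def dat13 := up2 19 ([],
  [11863285334735043187726758572565607670809618518510839056223021605124306776965935686495428691011479472799075046336046226809005173313610059074249120054164635831557136588198578302698264509054347616476885541250158518052532640946321229733517368330750987151882524761902632991292787214504160489924485241819245462469322424696140531470954143783195326435791004986184262373765736300764976807770226342761767008384706793020958791973373650519121107835279304097505715636024568702276850076594761199306286553923513319127476881497121896155391782085001052008924865993077534677169033190583555430074398802866846959671877696680468851986737589289180610059678512380351523,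
  5065564088896833544214099290388370070543752581703974167272168449263320054018072869420466010092852710052906302934064378361961644599335837180525243055821308580285497557034171581139387726187645594937398890037152511199857844579726804732966108788335168029113528157084495250433884298858236234598762144154900348821443448051463371863926731809761521863451929183166204040383114364868228067755345330137816585209063023660368722005298772845558147074300074539818813968982848480070200928595810242267669690078322116315225413495019995558100575683247200347364267037915838073695615618736741306946624922920052300751895689752524728831531998282658391395741301530477027212883998973585073680221977198337112040762526850714180183927066944538,
  243893170535429730844443914195906873159104647365110855886692281162881012157098910029525309092841647310201728816938050914622031303412950711529696275466202913591463173541097454906477400331532202952130405231166504676922994901024806457623328325065240121537394062133652716654272187855058274745384740067471574098456924107585917515861800408152710988778229224697731886305848088271995838499649915076520564875859332941364339442987967055939275745675283579213466530087995154808852718070942049076263412891537142369468059208646131095976881721655291713595100078952167817391582638659079058502649287525944835944796706983596547129082436258624781275278345740158126216489809005202065127968698378200105,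
  2260851509031880919670850016853893310352183204005137077639312595388522465985024359185933311924791498894050055428496325667950126363498985895388592339304865415800536158921759,
  319760444020026444614119946993830016065498549918447179372648024501123745853853575866321209663424220958158597578426436094999564612772487515145343431557908397523171942720975568936557443606393848456924752999818974389985295635623634432491157780574979937315])
def dat14 := up2 20 ([912500978858088060573840583761654114353192755762819394237450965305744624569380008875643979315761873625766881286429094734070803866740571506623728053892262313347197788665960722797268394340111184712720880120411037371585013189337848023325988391337099276985831832174025394825105120017077807429284693744734944957599516636972022556644834975432708973008118376442573079933716894441725573404227333123894195761468341726495895550143336883154161490741356158417578555186707069268320555657231839922783596146653378046841013088193920987484548398544528062630386070559472381424550692448448333656725124832290844341631163385277026639156131997029767710161004534643763820887405196308091095506796684120662010708820077924450975097303337204022391027357790763228676459752022664720739885465677430236923490403426728630214537145443702608379860803862510824962098098492894119289494283955177875256925770526114815516503813992915621292691430202893353,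
  686489437291279088038279056289192387980601559410395191818977757710607613493519268242560097390901626768000879913258306884681220596752961536742232923497454568846679718322402439963380688304567724286343736313606811047839366503761441171759847960298951025064227987558602034053140051187821354231095168330464207216519492949602714842404114417935343294508697083510281649404140643276298780284118922758954301338192214375485701740673640436278503121223123567632748038167774683484017055306407517290424307642990484930487376837604506861730573759712297495046082984254251805176342795131308708633757844625665173103269793462459409787102627767868730030688791794206811077740635198350828237838603987469603301409139095787206780724410069377687837173346469561239490262784806979501817155646150531867699727726895603753919503935542449154017770709837417615733603115912178194565062854529870306869912191487628326,
  806233341933831837899356784032347903958016150732776091356284397219954093493908034427737367859523216051106590607407199584718396333402030363030620615195271191603903377836458815785031239560790678003452932702275539391040448062178796817397853512707772860716802561892274025641605999292843740573553623072940894365891669579715761379727293340639997484830943278724668607023192724574637281239449796879001094873074500682501842650468560597103559189775933246750088480412029625333054861959901517359381265904511800935448818154151114181694051098823825728610959702795501880882191316575335808005997285991222437793139432527256877299669932557653029738664067498531816302398139721665874251433246178542714415192678567568443344807142484031843102181456253573007130074375329226417064641223497306911022348541610038215170088689674829744473143444945636959491946582985527019212877577574958427630013856866067479],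
  [1578268004340592621050710866204192747598573711013068168142325466419389694590218399534796060347292702849010319738233389405640880156118270732192729562963909564767435385352941927812854658187338843883787730171953762679817330281166074235717231719676797176874511043707746361406659870995967613969764038598098778330625459289730688310550737349867695709785404725355457733329788357351690777972021353109097729707011548029195341231172474455241339247112261872207419019002223434187744388358282041512874552762369448367273243107202481275497403576830514065446322089932236469974080526818638972277035255761515526667344832315133208850257503710572413279918343708136308310389525246009691383795815397904600127791065523877991573237575172993526212967917725538673399798587949240426492750693674023414795824552354906842589504017227506242458094786194296017441676049432152412720876795652413805811103731238390819918899089098257348592420452535523253484087418567108797468663097454832504997178312231006022521631583504378897711500077290144798,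
  10013805282138342751371323713287904824276224336840880259962868421577778235257499973307013048994495116655291127549472421866143665215720345188624938143172583285180135153483062601116889422868471054426848288608909582143058482976430226253109319283335318918337237086536725981582723575203811034132275850922800848835246868966002046758475242754750075722358598323398427679])
def dat15 := up2 21 ([],
  [1654446033381521097335575915041124085537911364349536285540515452842283727178213596253591629795740494554984845729018981520580096366964262437485453677320978539489594061926112984205084181088447751024120571395270333130206686996946396523623722800826397393779369752074717606757446282709750882925091152538136516802898316527517847649773171940463232175601322366920773696137458527886351912334544003605367463529116367035452734851078103746236031000115695719825038768207466563770942424142452257369664963741837910563199225634973393602182165103474104399144803130968674137276828250175752848229057260666731022218602334312529586179555128315747278836971728603308825279327766471771979251486981392183213867914097027117174228845844042806896571497105837385126276317238842023019490139636573090750479655237421324551236008039378702395662571927992691802897519212868450655516713271281269534819496570941587092439727019508993753823609338479669734981105003108392880032487318010270664484713637690829332674665879753705705974104268733720018645327720425169861283741373414299539440353330925784339887696250587449291428527893993660973350962336048208931642129163090472717324290427369896800664957717944729199910541714816736029929346421818387377532030613995797374956674595210486688512209844596698949295881229274002756915982743328272390380599529961064579023940972435159240999596073464774740141142058963455018352113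851500223940106132604814610568558040046297362556437757576436576542218645997108236973846121706745475893851970153032079784389401703587329511351293225400986397952325562171778564437277480772141851259606095333462922499191129882257743548661887803820538013658007240385790806456450268913592143288556916059329727403139326185160255054865908369992093411417280233963230943393507108738382124277391216824662261661443517286244708080837013292563488339375844708489821445388805283475836998283996730438733047790078693555437870296643207969023009])
end C520

namespace C520
open Equiv

theorem frc_eq {α : Type} (n : Nat) (k : Nat → α) : frc n k = k n := rfl
theorem frcS_eq {α : Type} (s n : Nat) (k : Nat → α) : frcS s n k = k n := rfl
theorem bsel_eq {α : Type} (b : Bool) (x y : α) : bsel b x y = if b then x else y := by cases b <;> rfl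

def dig (V c : ℕ) : ℕ := V / 2 ^ (16 * c) % 2 ^ 16

theorem dig_testBit (V c r : ℕ) : (dig V c).testBit r = (decide (r < 16) && V.testBit (16 * c + r)) := by
  rw [dig, Nat.testBit_mod_two_pow, Nat.testBit_div_two_pow, Nat.add_comm]

theorem dig_eq {V W c c' : ℕ} (h : ∀ r < 16, V.testBit (16 * c + r) = W.testBit (16 * c' + r)) : dig V c = dig W c' := by
  apply Nat.eq_of_testBit_eq
  intro r
  rw [dig_testBit, dig_testBit]
  by_cases hr : r < 16
  · rw [h r hr]
  · simp [hr]

theorem hiM_succ (p d : ℕ) : hiM 16 p (d+1) = if d = p then (2 ^ (16 * 2 ^ d) - 1) <<< (16 * 2 ^ d) else hiM 16 p d ||| (hiM 16 p d <<< (16 * 2 ^ d)) := by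
  show bsel (Nat.beq d p) _ _ = _
  rw [bsel_eq]
  by_cases h : d = p
  · rw [if_pos h, if_pos (by simpa using h)]; rfl
  · rw [if_neg h, if_neg (by simpa using h)]; rfl

theorem hiM_le (p : ℕ) : ∀ d, d ≤ p → hiM 16 p d = 0
  | 0, _ => rfl
  | d+1, h => by
    rw [hiM_succ, if_neg (by omega), hiM_le p d (by omega)]; simp

theorem hiM_bit (p : ℕ) : ∀ d c r, r < 16 → p < d → (hiM 16 p d).testBit (16 * c + r) = (decide (c < 2 ^ d) && c.testBit p)
  | 0, _, _, _, h => by omega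
  | d+1, c, r, hr, h => by
    rw [hiM_succ]
    split_ifs with hd
    · subst hd
      rw [Nat.testBit_shiftLeft, Nat.testBit_two_pow_sub_one]
      by_cases h1 : 2 ^ d ≤ c
      · have e1 : 16 * 2 ^ d ≤ 16 * c + r := by omega
        simp only [ge_iff_le, e1, decide_true, Bool.true_and]
        by_cases h2 : c < 2 ^ (d+1)
        · have e2 : 16 * c + r - 16 * 2 ^ d < 16 * 2 ^ d := by rw [pow_succ] at h2; omega
          simp only [e2, decide_true, h2, Bool.true_and]
          symm
          obtain ⟨k, rfl⟩ := Nat.exists_eq_add_of_le h1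
          rw [pow_succ] at h2
          have e3 : k < 2 ^ d := by omega
          rw [Nat.testBit_two_pow_add_eq, Nat.testBit_lt_two_pow e3]; rfl
        · have e2 : ¬ 16 * c + r - 16 * 2 ^ d < 16 * 2 ^ d := by rw [pow_succ] at h2; omega
          simp [e2, h2]
      · have e1 : ¬ 16 * 2 ^ d ≤ 16 * c + r := by omega
        rw [Nat.testBit_lt_two_pow (x := c) (by omega)]
        simp [e1]
    · have hp : p < d := by omega
      rw [Nat.testBit_or, Nat.testBit_shiftLeft, hiM_bit p d c r hr hp]
      by_cases h1 : 2 ^ d ≤ c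
      · have e1 : 16 * 2 ^ d ≤ 16 * c + r := by omega
        have e2 : 16 * c + r - 16 * 2 ^ d = 16 * (c - 2 ^ d) + r := by omega
        rw [e2, hiM_bit p d _ r hr hp]
        have e3 : (c - 2 ^ d).testBit p = c.testBit p := by
          obtain ⟨k, rfl⟩ := Nat.exists_eq_add_of_le h1
          rw [Nat.add_sub_cancel_left, Nat.testBit_two_pow_add_gt hp]
        rw [e3]
        have e4 : c - 2 ^ d < 2 ^ d ↔ c < 2 ^ (d+1) := by rw [pow_succ]; omega
        have e5 : ¬ c < 2 ^ d := by omega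
        simp [e4, e5, e1]
      · have e1 : ¬ 16 * 2 ^ d ≤ 16 * c + r := by omega
        have e2 : c < 2 ^ d := by omega
        have e3 : c < 2 ^ (d+1) := by rw [pow_succ]; omega
        simp [e1, e2, e3]

theorem mskM_bit (p q d c r : ℕ) (hr : r < 16) (hp : p < d) (hq : q < d) :
    (mskM 16 d p q).testBit (16 * c + r) = (decide (c < 2 ^ d) && c.testBit p && !c.testBit q) := by
  show (hiM 16 p d ^^^ (hiM 16 p d &&& hiM 16 q d)).testBit _ = _
  rw [Nat.testBit_xor, Nat.testBit_and, hiM_bit p d c r hr hp, hiM_bit q d c r hr hq]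
  cases decide (c < 2 ^ d) <;> cases c.testBit p <;> cases c.testBit q <;> rfl

def code : Wd → ℕ
  | [] => 0
  | b :: w => Nat.bit b (code w)

theorem code_append (u v : Wd) : code (u ++ v) = code u + 2 ^ u.length * code v := by
  induction u with
  | nil => simp [code]
  | cons b u ih =>
    simp only [List.cons_append, code, ih, Nat.bit_val, List.length_cons, pow_succ]
    ring

theorem code_lt (u : Wd) : code u < 2 ^ u.length := by
  induction u with
  | nil => simp [code]
  | cons b u ih =>
    simp only [code, Nat.bit_val, List.length_cons, pow_succ]
    cases b <;> simp <;> omega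

theorem code_bit (P : Wd) (x : Bool) (S : Wd) : (code (P ++ x :: S)).testBit P.length = x := by
  induction P with
  | nil => simp [code]
  | cons b u ih =>
    simp only [List.cons_append, List.length_cons, code, Nat.testBit_bit_succ, ih]

theorem dsw_bit (d s p q V c r : ℕ) (hpq : p < q) (hq : q < d) (hr : r < 16) :
    (dsw 16 d s p q V).testBit (16 * c + r) =
      ((V.testBit (16 * c + r) ^^ ((V.testBit (16 * (c + (2 ^ q - 2 ^ p)) + r) ^^ V.testBit (16 * c + r)) && (decide (c < 2 ^ d) && c.testBit p && !c.testBit q))) ^^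
      (decide (2 ^ q - 2 ^ p ≤ c) && ((V.testBit (16 * c + r) ^^ V.testBit (16 * (c - (2 ^ q - 2 ^ p)) + r)) && (decide (c - (2 ^ q - 2 ^ p) < 2 ^ d) && (c - (2 ^ q - 2 ^ p)).testBit p && !(c - (2 ^ q - 2 ^ p)).testBit q)))) := by
  show ((V ^^^ (((V >>> (16 * (2 ^ q - 2 ^ p))) ^^^ V) &&& mskM 16 d p q)) ^^^ ((((V >>> (16 * (2 ^ q - 2 ^ p))) ^^^ V) &&& mskM 16 d p q) <<< (16 * (2 ^ q - 2 ^ p)))).testBit (16 * c + r) = _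
  set H := 2 ^ q - 2 ^ p
  rw [Nat.testBit_xor, Nat.testBit_xor, Nat.testBit_shiftLeft, Nat.testBit_and, Nat.testBit_and, Nat.testBit_xor, Nat.testBit_xor,
    Nat.testBit_shiftRight, Nat.testBit_shiftRight, mskM_bit p q d c r hr (by omega) hq]
  by_cases h1 : H ≤ c
  · have e1 : 16 * c + r - 16 * H = 16 * (c - H) + r := by omega
    rw [e1, mskM_bit p q d _ r hr (by omega) hq]
    have e2 : 16 * H + (16 * (c - H) + r) = 16 * c + r := by omega
    have e3 : 16 * H + (16 * c + r) = 16 * (c + H) + r := by omega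
    have e4 : 16 * H ≤ 16 * c + r := by omega
    rw [e2, e3]
    simp only [ge_iff_le, e4, h1, decide_true, Bool.true_and]
  · have e4 : ¬ 16 * H ≤ 16 * c + r := by omega
    have e3 : 16 * H + (16 * c + r) = 16 * (c + H) + r := by omega
    rw [e3]
    simp only [ge_iff_le, e4, h1, decide_false, Bool.false_and]

theorem code_surj : ∀ (N c : ℕ), c < 2 ^ N → ∃ w : Wd, w.length = N ∧ code w = c
  | 0, c, h => ⟨[], rfl, by simp at h; simp [code, h]⟩
  | N+1, c, h => by
    obtain ⟨w, h1, h2⟩ := code_surj N (c / 2) (by rw [pow_succ] at h; omega)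
    exact ⟨c.bodd :: w, by simp [h1], by rw [code, h2, ← Nat.div2_val, Nat.bit_bodd_div2]⟩

theorem code_split {p q : ℕ} (hpq : p < q) (w : Wd) (hq : q < w.length) :
    ∃ P x M y S, w = P ++ x :: (M ++ y :: S) ∧ P.length = p ∧ M.length + p + 1 = q := by
  refine ⟨w.take p, w[p], (w.drop (p+1)).take (q - p - 1), w[q], w.drop (q + 1), ?_, ?_, ?_⟩
  · have h1 : w.drop (q+1) = (w.drop (p+1)).drop (q - p - 1 + 1) := by rw [List.drop_drop]; congr 1; omega
    have h2 : w[q] = (w.drop (p+1))[q - p - 1]'(by simp; omega) := by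
      rw [List.getElem_drop]; congr 1; omega
    rw [h1, h2, ← List.drop_eq_getElem_cons, List.take_append_drop, ← List.drop_eq_getElem_cons, List.take_append_drop]
  · simp; omega
  · simp; omega

theorem code_swap (P M S : Wd) {p q : ℕ} (hP : P.length = p) (hM : M.length + p + 1 = q) :
    code (P ++ false :: (M ++ true :: S)) = code (P ++ true :: (M ++ false :: S)) + (2 ^ q - 2 ^ p) := by
  have hpp : (2:ℕ) ^ p ≤ 2 ^ q := Nat.pow_le_pow_right (by norm_num) (by omega)
  have : (2:ℕ) ^ q = 2 * 2 ^ p * 2 ^ M.length := by rw [← hM, pow_add, pow_add]; ring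
  simp only [code_append, code, Nat.bit_val, Bool.toNat_true, Bool.toNat_false, hP]
  obtain ⟨k, hk⟩ := Nat.exists_eq_add_of_le hpp
  rw [hk, Nat.add_sub_cancel_left]
  have h2 : 2 * 2 ^ p * 2 ^ M.length = 2 ^ p + k := by rw [← this, hk]
  linear_combination h2

theorem code_bit2 (P : Wd) (x : Bool) (M : Wd) (y : Bool) (S : Wd) {q : ℕ} (hM : M.length + P.length + 1 = q) :
   (code (P ++ x :: (M ++ y :: S))).testBit q = y := by
  have := code_bit (P ++ x :: M) y S
  simp only [List.append_assoc, List.cons_append, List.length_append, List.length_cons] at this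
  have e : P.length + (M.length + 1) = q := by omega
  rw [e] at this
  exact this

theorem shift_bits (d p q c : ℕ) (hpq : p < q) (hq : q < d) (hc : c < 2 ^ d) (h1 : c.testBit p = true) (h2 : c.testBit q = false) :
    (c + (2 ^ q - 2 ^ p)).testBit p = false ∧ (c + (2 ^ q - 2 ^ p)).testBit q = true ∧ c + (2 ^ q - 2 ^ p) < 2 ^ d := by
  obtain ⟨w, h, rfl⟩ := code_surj d c hc
  obtain ⟨P, x, M, y, S, rfl, hP, hM⟩ := code_split hpq w (h ▸ hq)
  rw [code_bit2 P x M y S (by omega)] at h2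
  rw [← hP, code_bit] at h1
  subst h1 h2
  rw [← code_swap P M S hP hM]
  refine ⟨by rw [← hP, code_bit], by rw [code_bit2 _ _ _ _ _ (by omega)], ?_⟩
  rw [← h]
  have := code_lt (P ++ false :: (M ++ true :: S))
  simpa using this

theorem dsw_any (d s p q V c : ℕ) (hpq : p < q) (hq : q < d) : ∃ c', dig (dsw 16 d s p q V) c = dig V c' := by
  by_cases h1 : c < 2 ^ d ∧ c.testBit p = true ∧ c.testBit q = false
  · refine ⟨c + (2 ^ q - 2 ^ p), dig_eq fun r hr => ?_⟩
    rw [dsw_bit d s p q V c r hpq hq hr, h1.2.1, h1.2.2]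
    by_cases h2 : 2 ^ q - 2 ^ p ≤ c ∧ c - (2 ^ q - 2 ^ p) < 2 ^ d ∧ (c - (2 ^ q - 2 ^ p)).testBit p = true ∧ (c - (2 ^ q - 2 ^ p)).testBit q = false
    · have := shift_bits d p q _ hpq hq h2.2.1 h2.2.2.1 h2.2.2.2
      rw [Nat.sub_add_cancel h2.1] at this
      simp [this.1] at h1
    · have : (decide (2 ^ q - 2 ^ p ≤ c) && (decide (c - (2 ^ q - 2 ^ p) < 2 ^ d) && (c - (2 ^ q - 2 ^ p)).testBit p && !(c - (2 ^ q - 2 ^ p)).testBit q)) = false := by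
        rw [Bool.eq_false_iff]
        simpa [and_assoc] using h2
      generalize decide (2 ^ q - 2 ^ p ≤ c) = a at *
      generalize (decide (c - (2 ^ q - 2 ^ p) < 2 ^ d) && (c - (2 ^ q - 2 ^ p)).testBit p && !(c - (2 ^ q - 2 ^ p)).testBit q) = b at *
      have e : decide (c < 2 ^ d) = true := by simpa using h1.1
      rw [e]
      generalize V.testBit _ = u at *
      generalize V.testBit _ = v at *
      generalize V.testBit _ = w at *
      revert this; revert a b u v w; decide
  · by_cases h2 : 2 ^ q - 2 ^ p ≤ c ∧ c - (2 ^ q - 2 ^ p) < 2 ^ d ∧ (c - (2 ^ q - 2 ^ p)).testBit p = true ∧ (c - (2 ^ q - 2 ^ p)).testBit q = false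
    · refine ⟨c - (2 ^ q - 2 ^ p), dig_eq fun r hr => ?_⟩
      rw [dsw_bit d s p q V c r hpq hq hr, h2.2.2.1, h2.2.2.2]
      have := shift_bits d p q _ hpq hq h2.2.1 h2.2.2.1 h2.2.2.2
      rw [Nat.sub_add_cancel h2.1] at this
      simp [this.1, h2.1, h2.2.1]
    · refine ⟨c, dig_eq fun r hr => ?_⟩
      rw [dsw_bit d s p q V c r hpq hq hr]
      have e2 : (decide (2 ^ q - 2 ^ p ≤ c) && (decide (c - (2 ^ q - 2 ^ p) < 2 ^ d) && (c - (2 ^ q - 2 ^ p)).testBit p && !(c - (2 ^ q - 2 ^ p)).testBit q)) = false := by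
        rw [Bool.eq_false_iff]
        simpa [and_assoc] using h2
      have e1 : (decide (c < 2 ^ d) && c.testBit p && !c.testBit q) = false := by
        rw [Bool.eq_false_iff]
        simpa [and_assoc] using h1
      generalize decide (2 ^ q - 2 ^ p ≤ c) = a at *
      generalize (decide (c - (2 ^ q - 2 ^ p) < 2 ^ d) && (c - (2 ^ q - 2 ^ p)).testBit p && !(c - (2 ^ q - 2 ^ p)).testBit q) = b at *
      rw [e1]
      generalize V.testBit _ = u at *
      generalize V.testBit _ = v at *
      generalize V.testBit _ = w at *
      revert e2; clear e1 h1 h2; revert a b u v w; decide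

theorem dsw_code (d s p q V : ℕ) (P M S : Wd) (x y : Bool) (hP : P.length = p) (hM : M.length + p + 1 = q)
    (hd : (P ++ x :: (M ++ y :: S)).length = d) :
    dig (dsw 16 d s p q V) (code (P ++ x :: (M ++ y :: S))) = dig V (code (P ++ y :: (M ++ x :: S))) := by
  have hpq : p < q := by omega
  have hq : q < d := by simp at hd; omega
  have b1 : (code (P ++ x :: (M ++ y :: S))).testBit p = x := by rw [← hP, code_bit]
  have b2 : (code (P ++ x :: (M ++ y :: S))).testBit q = y := code_bit2 _ _ _ _ _ (by omega)
  have b3 : code (P ++ x :: (M ++ y :: S)) < 2 ^ d := hd ▸ code_lt _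
  have key : (code (P ++ x :: (M ++ y :: S))).testBit p = true ∨ (code (P ++ x :: (M ++ y :: S))).testBit q = false → 
    (decide (2 ^ q - 2 ^ p ≤ code (P ++ x :: (M ++ y :: S))) && (decide (code (P ++ x :: (M ++ y :: S)) - (2 ^ q - 2 ^ p) < 2 ^ d) && (code (P ++ x :: (M ++ y :: S)) - (2 ^ q - 2 ^ p)).testBit p && !(code (P ++ x :: (M ++ y :: S)) - (2 ^ q - 2 ^ p)).testBit q)) = false := by
    generalize code (P ++ x :: (M ++ y :: S)) = c
    intro hor
    rw [Bool.eq_false_iff]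
    intro h
    simp only [Bool.and_eq_true, decide_eq_true_eq, Bool.not_eq_true'] at h
    have := shift_bits d p q _ hpq hq h.2.1.1 h.2.1.2 h.2.2
    rw [Nat.sub_add_cancel h.1] at this
    simp [this.1, this.2.1] at hor
  apply dig_eq
  intro r hr
  rw [dsw_bit d s p q V _ r hpq hq hr, b1, b2]
  rw [b1, b2] at key
  cases x <;> cases y
  · specialize key (Or.inr rfl)
    generalize code (P ++ false :: (M ++ false :: S)) = c at *
    generalize decide (2 ^ q - 2 ^ p ≤ c) = a at *
    generalize (decide (c - (2 ^ q - 2 ^ p) < 2 ^ d) && (c - (2 ^ q - 2 ^ p)).testBit p && !(c - (2 ^ q - 2 ^ p)).testBit q) = b at *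
    cases a <;> cases b <;> simp_all
  · have e := code_swap P M S hP hM
    have c1 : (code (P ++ true :: (M ++ false :: S))).testBit p = true := by rw [← hP, code_bit]
    have c2 : (code (P ++ true :: (M ++ false :: S))).testBit q = false := code_bit2 _ _ _ _ _ (by omega)
    have c3 : code (P ++ true :: (M ++ false :: S)) < 2 ^ d := by
      have := code_lt (P ++ true :: (M ++ false :: S))
      rw [← hd]; simpa using this
    rw [e, Nat.add_sub_cancel]
    simp [c1, c2, c3]
  · specialize key (Or.inl rfl)
    rw [code_swap P M S hP hM]
    generalize code (P ++ true :: (M ++ false :: S)) = c at *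
    generalize decide (2 ^ q - 2 ^ p ≤ c) = a at *
    generalize (decide (c - (2 ^ q - 2 ^ p) < 2 ^ d) && (c - (2 ^ q - 2 ^ p)).testBit p && !(c - (2 ^ q - 2 ^ p)).testBit q) = b at *
    generalize V.testBit (16 * (c + (2 ^ q - 2 ^ p)) + r) = u
    generalize V.testBit (16 * c + r) = v
    cases a <;> cases b <;> cases u <;> cases v <;> simp_all
  · specialize key (Or.inl rfl)
    generalize code (P ++ true :: (M ++ true :: S)) = c at *
    generalize decide (2 ^ q - 2 ^ p ≤ c) = a at *
    generalize (decide (c - (2 ^ q - 2 ^ p) < 2 ^ d) && (c - (2 ^ q - 2 ^ p)).testBit p && !(c - (2 ^ q - 2 ^ p)).testBit q) = b at *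
    cases a <;> cases b <;> simp_all

end C520

namespace C520
open Equiv

theorem swT_code (d V : ℕ) : ∀ (l s o g : ℕ) (P a M b S : Wd), P.length = o → a.length = l → b.length = l → M.length + l = g →
    (P ++ (a ++ (M ++ (b ++ S)))).length = d →
    dig (swT 16 d l s o g V) (code (P ++ (a ++ (M ++ (b ++ S))))) = dig V (code (P ++ (b ++ (M ++ (a ++ S)))))
  | 0, s, o, g, P, a, M, b, S, _, ha, hb, _, _ => by
    rw [List.length_eq_zero_iff] at ha hb
    subst ha hb; rfl
  | l+1, s, o, g, P, x :: a, M, y :: b, S, hP, ha, hb, hM, hd => by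
    simp only [List.length_cons, Nat.add_right_cancel_iff] at ha hb
    show dig (dsw 16 d s o (o + g) (swT 16 d l (s+1) (o+1) g V)) _ = _
    have h1 := dsw_code d s o (o + g) (swT 16 d l (s+1) (o+1) g V) P (a ++ M) (b ++ S) x y hP (by simp; omega) (by simpa using hd)
    have h2 := swT_code d V l (s+1) (o+1) g (P ++ [y]) a (M ++ [x]) b S (by simp [hP]) ha hb (by simp; omega) (by simp at hd ⊢; omega)
    simp only [List.append_assoc, List.cons_append, List.nil_append] at h1 h2 ⊢
    rw [h1, h2]
  | l+1, s, o, g, P, x :: a, M, [], S, _, _, hb, _, _ => by simp at hb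
  | l+1, s, o, g, P, [], M, _, S, _, ha, _, _, _ => by simp at ha

theorem swT_any (d V : ℕ) : ∀ (l s o g c : ℕ), l ≤ g → o + g + l ≤ d → ∃ c', dig (swT 16 d l s o g V) c = dig V c'
  | 0, _, _, _, c, _, _ => ⟨c, rfl⟩
  | l+1, s, o, g, c, h1, h2 => by
    obtain ⟨c1, e1⟩ := dsw_any d s o (o + g) (swT 16 d l (s+1) (o+1) g V) c (by omega) (by omega)
    obtain ⟨c2, e2⟩ := swT_any d V l (s+1) (o+1) g c1 (by omega) (by omega)
    exact ⟨c2, e1.trans e2⟩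

theorem rotT_succ (d fuel s o l m V : ℕ) : rotT 16 d (fuel+1) s o l m V = if l * m = 0 then V else
    if l ≤ m then swT 16 d l s o l (rotT 16 d fuel (s*2) (o+l) l (m-l) V) else swT 16 d m s (o+l-m) m (rotT 16 d fuel (s*2) o (l-m) m V) := by
  have : rotT 16 d (fuel+1) s o l m V = bsel (Nat.beq (l * m) 0) V (bsel (Nat.ble l m)
    (swT 16 d l s o l (rotT 16 d fuel (s*2) (o+l) l (m-l) V)) (swT 16 d m s (o+l-m) m (rotT 16 d fuel (s*2) o (l-m) m V))) := rfl
  rw [this]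
  simp only [bsel_eq, Nat.beq_eq, Nat.ble_eq]

theorem rotT_code (d V : ℕ) : ∀ (fuel s o l m : ℕ) (P a b S : Wd), P.length = o → a.length = l → b.length = m → l + m ≤ fuel →
    (P ++ (a ++ (b ++ S))).length = d →
    dig (rotT 16 d fuel s o l m V) (code (P ++ (a ++ (b ++ S)))) = dig V (code (P ++ (b ++ (a ++ S))))
  | 0, s, o, l, m, P, a, b, S, _, ha, hb, h, _ => by
    have e1 : a = [] := List.length_eq_zero_iff.1 (by omega)
    have e2 : b = [] := List.length_eq_zero_iff.1 (by omega)
    subst e1 e2; rfl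
  | fuel+1, s, o, l, m, P, a, b, S, hP, ha, hb, h, hd => by
    rw [rotT_succ]
    simp only [List.length_append] at hd
    split_ifs with h1 h2
    · rcases Nat.mul_eq_zero.1 h1 with h1 | h1
      · have e1 : a = [] := List.length_eq_zero_iff.1 (by omega)
        subst e1; rfl
      · have e1 : b = [] := List.length_eq_zero_iff.1 (by omega)
        subst e1; rfl
    · rw [mul_eq_zero, not_or] at h1
      obtain ⟨b1, b2, rfl, hb1⟩ : ∃ b1 b2, b = b1 ++ b2 ∧ b1.length = l := ⟨b.take l, b.drop l, by simp, by simp; omega⟩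
      simp only [List.length_append] at hb hd
      have e1 := swT_code d (rotT 16 d fuel (s*2) (o+l) l (m-l) V) l s o l P a [] b1 (b2 ++ S) hP ha hb1 (by simp) (by simp; omega)
      have e2 := rotT_code d V fuel (s*2) (o+l) l (m-l) (P ++ b1) a b2 S (by simp; omega) ha (by omega) (by omega) (by simp; omega)
      simp only [List.append_assoc, List.nil_append] at e1 e2 ⊢
      rw [e1, e2]
    · rw [mul_eq_zero, not_or] at h1
      obtain ⟨a1, a2, rfl, hb1⟩ : ∃ b1 b2, a = b1 ++ b2 ∧ b1.length = l - m := ⟨a.take (l-m), a.drop (l-m), by simp, by simp; omega⟩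
      simp only [List.length_append] at ha hd
      have e1 := swT_code d (rotT 16 d fuel (s*2) o (l-m) m V) m s (o+l-m) m (P ++ a1) a2 [] b S (by simp; omega) (by omega) hb (by simp) (by simp; omega)
      have e2 := rotT_code d V fuel (s*2) o (l-m) m P a1 b (a2 ++ S) hP hb1 hb (by omega) (by simp; omega)
      simp only [List.append_assoc, List.nil_append] at e1 e2 ⊢
      rw [e1, e2]

theorem rotT_any (d V : ℕ) : ∀ (fuel s o l m c : ℕ), o + l + m ≤ d → ∃ c', dig (rotT 16 d fuel s o l m V) c = dig V c'
  | 0, s, o, l, m, c, _ => ⟨c, rfl⟩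
  | fuel+1, s, o, l, m, c, h => by
    rw [rotT_succ]
    split_ifs with h1 h2
    · exact ⟨c, rfl⟩
    · obtain ⟨c1, e1⟩ := swT_any d (rotT 16 d fuel (s*2) (o+l) l (m-l) V) l s o l c le_rfl (by omega)
      obtain ⟨c2, e2⟩ := rotT_any d V fuel (s*2) (o+l) l (m-l) c1 (by omega)
      exact ⟨c2, e1.trans e2⟩
    · obtain ⟨c1, e1⟩ := swT_any d (rotT 16 d fuel (s*2) o (l-m) m V) m s (o+l-m) m c le_rfl (by omega)
      obtain ⟨c2, e2⟩ := rotT_any d V fuel (s*2) o (l-m) m c1 (by omega)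
      exact ⟨c2, e1.trans e2⟩

def Bd (V m : ℕ) : Prop := ∀ c, dig V c ≤ m

theorem mod_succ_dig (x c : ℕ) : x % 2 ^ (16 * (c+1)) = x % 2 ^ (16 * c) + 2 ^ (16 * c) * dig x c := by
  rw [mul_add, mul_one, pow_add, Nat.mod_mul, dig]

theorem dig_add_aux {x y m m' : ℕ} (hx : Bd x m) (hy : Bd y m') (h : m + m' < 2 ^ 16) :
    ∀ c, x % 2 ^ (16 * c) + y % 2 ^ (16 * c) < 2 ^ (16 * c)
  | 0 => by simp [Nat.mod_one]
  | c+1 => by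
    have ih := dig_add_aux hx hy h c
    rw [mod_succ_dig, mod_succ_dig]
    have h1 := hx c
    have h2 := hy c
    have h3 : 2 ^ (16 * (c+1)) = 2 ^ (16 * c) * 2 ^ 16 := by rw [mul_add, mul_one, pow_add]
    have h4 : 2 ^ (16 * c) * (dig x c + dig y c + 1) ≤ 2 ^ (16 * c) * 2 ^ 16 := Nat.mul_le_mul_left _ (by omega)
    rw [h3]
    have h5 : 2 ^ (16 * c) * (dig x c + dig y c + 1) = 2 ^ (16 * c) * dig x c + 2 ^ (16 * c) * dig y c + 2 ^ (16 * c) := by ring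
    omega

theorem dig_add {x y m m' : ℕ} (hx : Bd x m) (hy : Bd y m') (h : m + m' < 2 ^ 16) (c : ℕ) :
    dig (x + y) c = dig x c + dig y c := by
  have h1 := dig_add_aux hx hy h c
  have h2 : (x + y) / 2 ^ (16 * c) = x / 2 ^ (16 * c) + y / 2 ^ (16 * c) := by
    rw [Nat.add_div (by positivity), if_neg (by omega)]; omega
  unfold dig
  rw [h2, Nat.add_mod, Nat.mod_eq_of_lt]
  have := hx c
  have := hy c
  unfold dig at *
  omega

theorem Bd_add {x y m m' : ℕ} (hx : Bd x m) (hy : Bd y m') (h : m + m' < 2 ^ 16) : Bd (x + y) (m + m') := by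
  intro c
  rw [dig_add hx hy h]
  exact Nat.add_le_add (hx c) (hy c)

theorem dig_zero (c : ℕ) : dig 0 c = 0 := by simp [dig]

/-- all insertions -/
def insL (w : Wd) : List Wd → List (List Wd)
  | [] => []
  | b :: bs => ((w ++ b) :: bs) :: (insL w bs).map (b :: ·)

def CyL {M : Type*} [AddCommMonoid M] (t : Wd → M) : ℕ → List Wd → M
  | 0, ws => t ws.flatten
  | _+1, [] => 0
  | n+1, a :: ws => ((insL a ws).map (CyL t n)).sum

def spl (a : ℕ) : List ℕ → List ℕ → ℕ → List (List ℕ × ℕ)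
  | [], _, _ => []
  | b :: bs, pre, o => (pre ++ (a + b) :: bs, o) :: spl a bs (pre ++ [b]) (o + b)

theorem spl_length (a : ℕ) : ∀ ls pre o, (spl a ls pre o).length = ls.length
  | [], _, _ => rfl
  | b :: bs, pre, o => by simp [spl, spl_length a bs]

theorem cyL_spec (a s m : ℕ) (f : List ℕ → ℕ → ℕ) : ∀ ls pre o, (∀ x ∈ spl a ls pre o, Bd (f x.1 x.2) m) → ls.length * m < 2 ^ 16 →
    Bd (cyL a ls pre o f (fun x y => frcS s x fun x => frcS s y fun y => addS s x y) 0) (ls.length * m) ∧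
    ∀ c, dig (cyL a ls pre o f (fun x y => frcS s x fun x => frcS s y fun y => addS s x y) 0) c =
      ((spl a ls pre o).map fun x => dig (f x.1 x.2) c).sum
  | [], pre, o, _, _ => ⟨fun c => by show dig 0 c ≤ _; simp [dig_zero], fun c => dig_zero c⟩
  | b :: bs, pre, o, hf, hm => by
    have h1 := hf (pre ++ (a + b) :: bs, o) (by simp [spl])
    simp only [List.length_cons, add_mul, one_mul] at hm ⊢
    obtain ⟨h2, h3⟩ := cyL_spec a s m f bs (pre ++ [b]) (o + b) (fun x hx => hf x (by simp [spl, hx])) (by omega)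
    have h4 : m + bs.length * m < 2 ^ 16 := by omega
    constructor
    · have := Bd_add h1 h2 h4
      rw [add_comm m] at this
      exact this
    · intro c
      rw [spl, List.map_cons, List.sum_cons, ← h3 c]
      exact dig_add h1 h2 h4 c

theorem spl_mem (a : ℕ) : ∀ ls pre o x, x ∈ spl a ls pre o → o = pre.sum → x.1.length = pre.length + ls.length ∧ x.1.sum = pre.sum + a + ls.sum ∧ a + x.2 ≤ x.1.sum
  | [], _, _, x, h, _ => by simp [spl] at h
  | b :: bs, pre, o, x, h, ho => by
    simp only [spl, List.mem_cons] at h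
    rcases h with rfl | h
    · simp [ho]; omega
    · have := spl_mem a bs (pre ++ [b]) (o + b) x h (by simp [ho])
      simp at this ⊢; omega

theorem spl_ins {M : Type*} [AddCommMonoid M] (w : Wd) (ws0 : List Wd) (F : List ℕ × ℕ → M) (G : List Wd → M)
    (h : ∀ p b bs, p ++ b :: bs = ws0 → F ((p ++ (w ++ b) :: bs).map List.length, p.flatten.length) = G (p ++ (w ++ b) :: bs)) :
    ∀ ws pws : List Wd, pws ++ ws = ws0 → ((spl w.length (ws.map List.length) (pws.map List.length) pws.flatten.length).map F).sum = ((insL w ws).map fun x => G (pws ++ x)).sum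
  | [], pws, _ => rfl
  | b :: bs, pws, hw => by
    have ih := spl_ins w ws0 F G h bs (pws ++ [b]) (by simp [hw])
    have h1 := h pws b bs hw
    simp only [List.map_cons, spl, insL, List.sum_cons, List.map_map]
    have e1 : (pws ++ [b]).map List.length = pws.map List.length ++ [b.length] := by simp
    have e2 : (pws ++ [b]).flatten.length = pws.flatten.length + b.length := by simp
    rw [e1, e2] at ih
    rw [ih, ← h1]
    congr 2
    · simp
    · simp [Function.comp_def]

theorem cyT_spec (D V B : ℕ) (hB : Bd V B) (hD : D ≤ 20) : ∀ (n s : ℕ) (ls : List ℕ), ls.length = n + 2 → ls.sum ≤ D → (n+1).factorial * B < 2 ^ 16 →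
    Bd (cyT 16 D V n s ls) ((n+1).factorial * B) ∧ ∀ (ws : List Wd) (S : Wd), ws.map List.length = ls → (ws.flatten ++ S).length = D →
      dig (cyT 16 D V n s ls) (code (ws.flatten ++ S)) = CyL (fun w => dig V (code (w ++ S))) n ws
  | 0, s, ls, hl, hs, hm => ⟨fun c => by show dig V c ≤ _; simpa using hB c, fun ws S h1 h2 => rfl⟩
  | n+1, s, [], hl, hs, hm => by simp at hl
  | n+1, s, a :: ls, hl, hs, hm => by
    simp only [List.length_cons, List.sum_cons] at hl hs
    have hl' : ls.length = n + 2 := by omega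
    have hf : (n+1+1).factorial * B = ls.length * ((n+1).factorial * B) := by rw [hl', Nat.factorial_succ]; ring
    have hm' : (n+1).factorial * B < 2 ^ 16 := lt_of_le_of_lt (Nat.mul_le_mul_right _ (Nat.factorial_le (by omega))) hm
    have ih := fun (s : ℕ) (x : List ℕ × ℕ) (hx : x ∈ spl a ls [] 0) => cyT_spec D V B hB hD n s x.1
      (by have := spl_mem a ls [] 0 x hx rfl; simp at this; omega) (by have := spl_mem a ls [] 0 x hx rfl; simp at this; omega) hm'
    have key := cyL_spec a s ((n+1).factorial * B) (fun ls' o => 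
         frcS (Nat.add s o) (cyT 16 D V n (Nat.add (Nat.mul s 20) o) ls') fun U => rotT 16 D 20 (Nat.add (Nat.mul s 20) o) 0 a o U) ls [] 0
         (fun x hx c => by
            have h2 := spl_mem a ls [] 0 x hx rfl
            obtain ⟨c', hc'⟩ := rotT_any D (cyT 16 D V n (Nat.add (Nat.mul s 20) x.2) x.1) 20 (Nat.add (Nat.mul s 20) x.2) 0 a x.2 c (by simp at h2; omega)
            rw [frcS_eq, hc']
            exact (ih _ x hx).1 c') (by rw [← hf]; exact hm)
    rw [← hf] at key
    refine ⟨key.1, ?_⟩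
    rintro (_ | ⟨w, ws⟩) S h1 h2
    · simp at h1
    · simp only [List.map_cons, List.cons.injEq] at h1
      obtain ⟨rfl, rfl⟩ := h1
      refine (key.2 _).trans ?_
      rw [CyL]
      have := spl_ins w ws (fun x => dig (frcS (Nat.add s x.2) (cyT 16 D V n (Nat.add (Nat.mul s 20) x.2) x.1) fun U => rotT 16 D 20 (Nat.add (Nat.mul s 20) x.2) 0 w.length x.2 U) (code ((w :: ws).flatten ++ S)))
        (CyL (fun w => dig V (code (w ++ S))) n) ?_ ws [] rfl
      · simpa using this
      · intro p b bs hp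
        subst hp
        rw [frcS_eq]
        have h3 := rotT_code D (cyT 16 D V n (Nat.add (Nat.mul s 20) p.flatten.length) ((p ++ (w ++ b) :: bs).map List.length)) 20 (Nat.add (Nat.mul s 20) p.flatten.length) 0 w.length p.flatten.length
          [] w p.flatten (b ++ (bs.flatten ++ S)) rfl rfl rfl (by simp at h2 ⊢; omega) (by simp at h2 ⊢; omega)
        have h4 := (cyT_spec D V B hB hD n (Nat.add (Nat.mul s 20) p.flatten.length) ((p ++ (w ++ b) :: bs).map List.length) (by simpa using hl') (by simp at hs ⊢; omega) hm').2
           (p ++ (w ++ b) :: bs) S rfl (by simp at h2 ⊢; omega)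
        simp only [List.nil_append, List.flatten_cons, List.flatten_append, List.append_assoc] at h3 h4 ⊢
        rw [h3, h4]

theorem insL_ofFn {M : Type*} [AddCommMonoid M] (w : Wd) : ∀ (n : ℕ) (b : Fin n → Wd) (f : List Wd → M),
    ∑ r, f (List.ofFn (Function.update b r (w ++ b r))) = ((insL w (List.ofFn b)).map f).sum
  | 0, b, f => by simp [insL]
  | n+1, b, f => by
    rw [Fin.sum_univ_succ, List.ofFn_succ (f := b)]
    simp only [insL, List.map_cons, List.sum_cons, List.map_map]
    congr 1
    · rw [List.ofFn_succ]; simp [Fin.succ_ne_zero]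
    · rw [← insL_ofFn w n (fun i => b i.succ) (f ∘ (b 0 :: ·))]
      refine Finset.sum_congr rfl fun r _ => ?_
      rw [List.ofFn_succ]
      simp only [Function.comp]
      rw [Function.update_of_ne (Fin.succ_ne_zero r).symm]
      congr 3
      funext i
      by_cases hi : i = r
      · subst hi; simp
      · rw [Function.update_of_ne hi, Function.update_of_ne (fun h => hi (Fin.succ_injective _ h))]

theorem Cy_eq_CyL {M : Type*} [AddCommGroup M] (t : Wd → M) : ∀ (n : ℕ) (a : Fin (n+2) → Wd), Cy t (n+1) a = CyL t n (List.ofFn a)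
  | 0, a => by simp [Cy, CyL, List.ofFn_succ]
  | n+1, a => by
    rw [Cy, List.ofFn_succ, CyL, ← insL_ofFn]
    refine Finset.sum_congr rfl fun r _ => ?_
    rw [Cy_eq_CyL t n]
    rfl

theorem insL_perm (w : Wd) : ∀ (ws x : List _), x ∈ insL w ws → x.flatten.Perm (w ++ ws.flatten)
  | [], x, h => by simp [insL] at h
  | b :: bs, x, h => by
    simp only [insL, List.mem_cons, List.mem_map] at h
    rcases h with rfl | ⟨y, hy, rfl⟩
    · simp
    · have := insL_perm w bs y hy
      simp only [List.flatten_cons]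
      refine (this.append_left b).trans ?_
      rw [← List.append_assoc, ← List.append_assoc]
      exact List.perm_append_comm.append_right _

theorem CyL_congr {M : Type*} [AddCommMonoid M] (t t' : Wd → M) : ∀ (n : ℕ) (ws : List Wd), (∀ w, w.Perm ws.flatten → t w = t' w) → CyL t n ws = CyL t' n ws
  | 0, ws, h => h _ (List.Perm.refl _)
  | n+1, [], h => rfl
  | n+1, a :: ws, h => by
    rw [CyL, CyL]
    congr 1
    apply List.map_congr_left
    intro x hx
    apply CyL_congr t t' n
    intro w hw
    exact h w (hw.trans (insL_perm a ws x hx))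

theorem CyL_map {M N : Type*} [AddCommMonoid M] [AddCommMonoid N] (f : M →+ N) (t : Wd → M) : ∀ (n : ℕ) (ws : List Wd), CyL (fun w => f (t w)) n ws = f (CyL t n ws)
  | 0, ws => rfl
  | n+1, [] => by simp [CyL]
  | n+1, a :: ws => by
    rw [CyL, CyL, map_list_sum, List.map_map]
    congr 1
    apply List.map_congr_left
    intro x _
    exact CyL_map f t n x

theorem CyL_add {M : Type*} [AddCommMonoid M] (t t' : Wd → M) : ∀ (n : ℕ) (ws : List Wd), CyL (fun w => t w + t' w) n ws = CyL t n ws + CyL t' n ws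
  | 0, ws => rfl
  | n+1, [] => by simp [CyL]
  | n+1, a :: ws => by
    rw [CyL, CyL, CyL, ← List.sum_map_add]
    congr 1
    apply List.map_congr_left
    intro x _
    exact CyL_add t t' n x

theorem insL_len (w : Wd) : ∀ ws, (insL w ws).length = ws.length
  | [] => rfl
  | b :: bs => by simp [insL, insL_len w bs]

theorem insL_len2 (w : Wd) : ∀ ws x, x ∈ insL w ws → x.length = ws.length
  | [], x, h => by simp [insL] at h
  | b :: bs, x, h => by
    simp only [insL, List.mem_cons, List.mem_map] at h
    rcases h with rfl | ⟨y, hy, rfl⟩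
    · simp
    · simp [insL_len2 w bs y hy]

theorem CyL_const {M : Type*} [AddCommMonoid M] (c : M) : ∀ (n : ℕ) (ws : List Wd), ws.length = n + 2 → CyL (fun _ => c) n ws = (n+1).factorial • c
  | 0, ws, _ => by simp [CyL]
  | n+1, [], h => by simp at h
  | n+1, a :: ws, h => by
    simp only [List.length_cons] at h
    have : (insL a ws).map (CyL (fun _ => c) n) = (insL a ws).map (fun _ => (n+1).factorial • c) := by
      apply List.map_congr_left
      intro x hx
      exact CyL_const c n x (by rw [insL_len2 a ws x hx]; omega)
    rw [CyL, this, List.map_const', List.sum_replicate, insL_len, smul_smul, Nat.factorial_succ (n+1)]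
    congr 2; omega

end C520

namespace C520
open Equiv

theorem geo (n : ℕ) : repu 16 n * (2 ^ 16 - 1) = 2 ^ (16 * n) - 1 := by
  show (2 ^ (16 * n) - 1) / (2 ^ 16 - 1) * (2 ^ 16 - 1) = _
  apply Nat.div_mul_cancel
  rw [pow_mul]
  have := Nat.sub_dvd_pow_sub_pow (2 ^ 16) 1 n
  rwa [one_pow] at this

theorem repu_add (a b : ℕ) : repu 16 (a + b) = repu 16 a + 2 ^ (16 * a) * repu 16 b := by
  have h1 := geo (a + b)
  have h2 := geo a
  have h3 := geo b
  have p1 : 1 ≤ 2 ^ (16 * a) := Nat.one_le_two_pow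
  have p2 : 1 ≤ 2 ^ (16 * b) := Nat.one_le_two_pow
  have p3 : 1 ≤ 2 ^ (16 * (a + b)) := Nat.one_le_two_pow
  apply Nat.eq_of_mul_eq_mul_right (show 0 < 2 ^ 16 - 1 by norm_num)
  rw [add_mul, mul_assoc, h1, h2, h3, mul_add, pow_add, Nat.mul_sub, mul_one]
  have : 2 ^ (16 * a) * 1 ≤ 2 ^ (16 * a) * 2 ^ (16 * b) := Nat.mul_le_mul_left _ p2
  omega

theorem repu_lt (m n : ℕ) (hm : m < 2 ^ 16) : m * repu 16 n < 2 ^ (16 * n) := by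
  have h := geo n
  have p1 : 1 ≤ 2 ^ (16 * n) := Nat.one_le_two_pow
  have : m * repu 16 n ≤ (2 ^ 16 - 1) * repu 16 n := Nat.mul_le_mul_right _ (by omega)
  rw [mul_comm (2 ^ 16 - 1), h] at this
  omega

theorem dig_repu (m n c : ℕ) (hm : m < 2 ^ 16) (hc : c < n) : dig (m * repu 16 n) c = m := by
  obtain ⟨k, rfl⟩ : ∃ k, n = c + (1 + k) := ⟨n - c - 1, by omega⟩
  have r1 : repu 16 1 = 1 := by decide
  rw [dig, repu_add, repu_add, r1]
  have h := repu_lt m c hm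
  have : m * (repu 16 c + 2 ^ (16 * c) * (1 + 2 ^ (16 * 1) * repu 16 k)) = m * repu 16 c + 2 ^ (16 * c) * (m + 2 ^ 16 * (m * repu 16 k)) := by ring
  rw [this, Nat.add_mul_div_left _ _ (by positivity), Nat.div_eq_of_lt h, zero_add, Nat.add_mul_mod_self_left, Nat.mod_eq_of_lt hm]

theorem dig_ge {V N c : ℕ} (h : V < 2 ^ (16 * N)) (hc : N ≤ c) : dig V c = 0 := by
  rw [dig, Nat.div_eq_of_lt, Nat.zero_mod]
  exact h.trans_le (Nat.pow_le_pow_right (by norm_num) (by omega))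

def chkV (D d V : ℕ) : Bool :=
  frc V fun V => (Nat.beq (Nat.land V (Nat.mul 65024 (repu 16 (Nat.pow 2 D)))) 0).and
    ((Nat.ble (Nat.succ V) (Nat.pow 2 (Nat.mul 16 (Nat.pow 2 D)))).and
     (Nat.beq (rotT 16 D 20 0 0 1 (Nat.sub d 1) V) V))

theorem chkV_spec {D d V : ℕ} (h : chkV D d V = true) : Bd V 511 ∧ rotT 16 D 20 0 0 1 (d - 1) V = V := by
  unfold chkV at h
  rw [frc_eq, Bool.and_eq_true, Bool.and_eq_true] at h
  obtain ⟨h1, h2, h3⟩ := h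
  rw [Nat.beq_eq] at h1 h3
  refine ⟨fun c => ?_, h3⟩
  have hV : V < 2 ^ (16 * 2 ^ D) := Nat.le_of_ble_eq_true h2
  by_cases hc : c < 2 ^ D
  · have e : dig V c &&& 65024 = 0 := by
      rw [← dig_repu 65024 (2 ^ D) c (by norm_num) hc]
      apply Nat.eq_of_testBit_eq
      intro i
      rw [Nat.testBit_and, dig_testBit, dig_testBit]
      have : (V &&& (65024 * repu 16 (2 ^ D))).testBit (16 * c + i) = false := by
        have h1' : V &&& (65024 * repu 16 (2 ^ D)) = 0 := h1
        rw [h1']; simp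
      rw [Nat.testBit_and] at this
      rw [Nat.zero_testBit]
      cases decide (i < 16) <;> simp_all
    have : dig V c < 2 ^ 9 := by
      apply Nat.lt_pow_two_of_testBit
      intro i hi
      by_cases h16 : i < 16
      · have h5 := congrArg (fun x => x.testBit i) e
        simp only [Nat.testBit_and, Nat.zero_testBit] at h5
        have h6 : Nat.testBit 65024 i = true := by
          interval_cases i <;> decide
        rw [h6, Bool.and_true] at h5
        exact h5
      · rw [dig_testBit]; simp [h16]
    omega
  · rw [dig_ge hV (by omega)]; omega

theorem chkC_spec (D d F V : ℕ) (L : List (List ℕ)) (h : chkC 16 D d F V L = true) :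
    ∀ l ∈ L, ∃ s, cyT 16 D V 4 s l = 3840 * d * repu 16 (F * 2 ^ d) := by
  have gen : ∀ (L : List (List ℕ)) (s : ℕ), (List.rec (motive := fun _ => Nat → Bool) (fun _ => true) (fun l _ ih s =>
    bsel (Nat.beq (cyT 16 D V 4 s l) (3840 * d * repu 16 (F * 2 ^ d))) (ih (Nat.succ s)) false) L s : Bool) = true → ∀ l ∈ L, ∃ s, cyT 16 D V 4 s l = 3840 * d * repu 16 (F * 2 ^ d) := by
    intro L
    induction L with
    | nil => intro s _ l hl; simp at hl
    | cons a L ih =>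
      intro s h l hl
      simp only at h
      rw [bsel_eq] at h
      split_ifs at h with h1
      rw [Nat.beq_eq] at h1
      rcases List.mem_cons.1 hl with rfl | hl
      · exact ⟨s, h1⟩
      · exact ih _ h l hl
  exact gen L 1 h

theorem lensL_mem : ∀ (k lo rem : ℕ) (l : List ℕ), l.length = k → l.SortedLE → (∀ x ∈ l, lo ≤ x) → l.sum = rem → l ∈ lensL k lo rem
  | 0, lo, rem, l, h, _, _, hs => by
    rw [List.length_eq_zero_iff] at h
    subst h; subst hs; exact List.mem_singleton.2 rfl
  | k+1, lo, rem, [], h, _, _, _ => by simp at h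
  | k+1, lo, rem, x :: l, h, h1, h2, h3 => by
    show _ ∈ (List.range' lo (rem+1-lo)).flatMap fun l => (lensL k l (rem-l)).map (l :: ·)
    simp only [List.sum_cons] at h3
    have h4 := h1.pairwise
    rw [List.pairwise_cons] at h4
    rw [List.mem_flatMap]
    refine ⟨x, ?_, ?_⟩
    · rw [List.mem_range'_1]
      have := h2 x (by simp)
      omega
    · exact List.mem_map.2 ⟨l, lensL_mem k x _ l (by simpa using h) h4.2.sortedLE h4.1 (by omega), rfl⟩

section
variable {K : Type*} [Field K] [CharZero K]

def phi (K : Type*) [Field K] (d V : ℕ) (S : Wd) (q : ℕ) (w : Wd) : K :=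
  if w.length = d ∧ w.count true = q then (dig V (code (w ++ S)) : K) - ((32 * d : ℕ) : K) else 0

theorem rot_cyc {D d V : ℕ} {S : Wd} (hd : d ≤ 20) (hS : S.length + d = D) (h : rotT 16 D 20 0 0 1 (d - 1) V = V) :
    ∀ (u v : Wd), u.length + v.length = d → dig V (code (u ++ (v ++ S))) = dig V (code (v ++ (u ++ S)))
  | [], v, _ => rfl
  | a :: u, v, hl => by
    simp only [List.length_cons] at hl
    have h1 := rotT_code D V 20 0 0 1 (d - 1) [] [a] (u ++ v) S rfl rfl (by simp; omega) (by omega) (by simp; omega)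
    rw [h] at h1
    have h2 := rot_cyc hd hS h u (v ++ [a]) (by simp; omega)
    simp only [List.nil_append, List.append_assoc, List.cons_append] at h1 h2 ⊢
    rw [h1, h2]

theorem phi_cyc {D d V : ℕ} {S : Wd} (hd : d ≤ 20) (hS : S.length + d = D) (h : rotT 16 D 20 0 0 1 (d - 1) V = V) (q : ℕ) (u v : Wd) :
    phi K d V S q (u ++ v) = phi K d V S q (v ++ u) := by
  unfold phi
  have e1 : (u ++ v).length = (v ++ u).length := by simp [add_comm]
  have e2 : (u ++ v).count true = (v ++ u).count true := by simp [add_comm]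
  rw [e1, e2]
  split_ifs with hc
  · have := rot_cyc hd hS h u v (by rw [List.length_append] at hc; omega)
    rw [List.append_assoc, List.append_assoc, this]
  · rfl

theorem phi_Cy {D d F V : ℕ} {S : Wd} (hd : d ≤ 16) (hS : S.length + d = D) (hD : D ≤ 20) (hF : code S < F) (hV : chkV D d V = true)
    (hC : ∀ l ∈ lensL 6 1 d, ∃ s, cyT 16 D V 4 s l = 3840 * d * repu 16 (F * 2 ^ d)) (q : ℕ) (a : Fin 6 → Wd) (h0 : ∀ i, a i ≠ []) :
    Cy (phi K d V S q) 5 a = 0 := by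
  obtain ⟨hB, hrot⟩ := chkV_spec hV
  rw [← Cy_symm (phi K d V S q) (phi_cyc (by omega) hS hrot q) 5 a (Tuple.sort fun i => (a i).length), Cy_eq_CyL]
  have hmono := Tuple.monotone_sort (fun i => (a i).length)
  set b := a ∘ Tuple.sort (fun i => (a i).length) with hb
  by_cases hc : (List.ofFn b).flatten.length = d ∧ (List.ofFn b).flatten.count true = q
  · rw [CyL_congr _ (fun w => (dig V (code (w ++ S)) : K) + (-((32 * d : ℕ) : K))) 4]
    · rw [CyL_add, CyL_const _ _ _ (by simp)]
      have e := CyL_map (Nat.castAddMonoidHom K) (fun w => dig V (code (w ++ S))) 4 (List.ofFn b)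
      simp only [Nat.coe_castAddMonoidHom] at e
      rw [e]
      have hsum : ((List.ofFn b).map List.length).sum = d := by rw [← hc.1, List.length_flatten]
      obtain ⟨s, hs⟩ := hC ((List.ofFn b).map List.length) (by
        apply lensL_mem
        · simp
        · rw [List.map_ofFn]
          exact hmono.sortedLE_ofFn
        · intro x hx
          rw [List.map_ofFn, List.mem_ofFn] at hx
          obtain ⟨i, rfl⟩ := hx
          exact List.length_pos_iff.2 (h0 _)
        · exact hsum)
      have h2 := (cyT_spec D V 511 hB (by omega) 4 s ((List.ofFn b).map List.length) (by simp) (by omega) (by decide)).2 (List.ofFn b) S rfl (by simp only [List.length_append, hc.1]; omega)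
      rw [← h2, hs, dig_repu _ _ _ (by omega)]
      · norm_num [Nat.factorial]; ring
      · rw [code_append, hc.1]
        have := code_lt (List.ofFn b).flatten
        rw [hc.1] at this
        nlinarith
    · intro w hw
      rw [phi, if_pos ⟨hw.length_eq.trans hc.1, (hw.count_eq _).trans hc.2⟩, sub_eq_add_neg]
  · rw [CyL_congr _ (fun w => (0:K)) 4, CyL_const _ _ _ (by simp), smul_zero]
    intro w hw
    rw [phi, if_neg]
    rwa [hw.length_eq, hw.count_eq]
end

/-- all generators; the flag marks `w - swp w` -/
def GLs : List (Wd × Bool) := symWords.map (fun l => (expd l, false)) ++ skewWords.map (fun l => (expd l, true)) ++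
  words81.flatMap fun l => [(expd l, false), (swp (expd l), false)]

def zr (V d f : ℕ) (g : Wd × Bool) : Bool :=
  Nat.beq (dig V (Nat.add (code g.1) (Nat.mul (Nat.pow 2 d) f)))
    (bsel g.2 (dig V (Nat.add (code (swp g.1)) (Nat.mul (Nat.pow 2 d) f))) (Nat.mul 32 d))

def slot (G : List (Wd × Bool)) (g : Wd × Bool) : ℕ := ((G.takeWhile fun g' => !(g' == g)).filter fun g' => g'.1.count true == g.1.count true).length

def prc (V d F : ℕ) : Bool := frc V fun V => (GLs.filter fun g => g.1.length == d).all fun g =>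
  frc (slot (GLs.filter fun g => g.1.length == d) g) fun f => Nat.blt f F && (!g.2 || 2 * g.1.count true == d) &&
  (GLs.filter fun g => g.1.length == d).all fun g' => !(g'.1.count true == g.1.count true) || (zr V d f g' == !(g' == g))

def gval {K : Type*} [Field K] (φ : Wd → K) (g : Wd × Bool) : K := φ g.1 - if g.2 then φ (swp g.1) else 0

theorem dual_exists {K : Type*} [Field K] [CharZero K] {D d F V : ℕ} (h2 : 2 ≤ d) (hd : d ≤ 16) (hdD : d ≤ D) (hD : D ≤ 20) (hF : F * 2 ^ d ≤ 2 ^ D) (hV : chkV D d V = true)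
    (hC : ∀ l ∈ lensL 6 1 d, ∃ s, cyT 16 D V 4 s l = 3840 * d * repu 16 (F * 2 ^ d)) (hp : prc V d F = true)
    (g : Wd × Bool) (hg : g ∈ GLs) (hgd : g.1.length = d) :
    ∃ φ : Wd → K, (∀ u v, φ (u ++ v) = φ (v ++ u)) ∧ (∀ a : Fin 6 → Wd, (∀ i, a i ≠ []) → Cy φ 5 a = 0) ∧ (∀ w, φ w ≠ 0 → w.length = d ∧ w.count true = g.1.count true) ∧
      gval φ g ≠ 0 ∧ ∀ g' ∈ GLs, g' ≠ g → gval φ g' = 0 := by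
  unfold prc at hp
  rw [frc_eq, List.all_eq_true] at hp
  have h := hp g (List.mem_filter.2 ⟨hg, by simp [hgd]⟩)
  rw [frc_eq] at h
  generalize slot (GLs.filter fun g => g.1.length == d) g = f at h
  rw [Bool.and_eq_true, Bool.and_eq_true, List.all_eq_true, Nat.blt_eq] at h
  obtain ⟨⟨hf, hsk⟩, hall⟩ := h
  obtain ⟨S, hS, hcS⟩ := code_surj (D - d) f (by
    have h3 : 2 ^ D = 2 ^ (D - d) * 2 ^ d := by rw [← pow_add]; congr 1; omega
    rw [h3] at hF
    exact lt_of_lt_of_le hf (Nat.le_of_mul_le_mul_right hF (by positivity)))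
  have hrot := (chkV_spec hV).2
  have hphi : ∀ w : Wd, w.length = d → w.count true = g.1.count true → phi K d V S (g.1.count true) w = (dig V (code w + 2 ^ d * f) : K) - ((32 * d : ℕ) : K) := by
    intro w hw hc
    rw [phi, if_pos ⟨hw, hc⟩, code_append, hw, hcS]
  have hswl : ∀ w : Wd, (swp w).length = w.length := fun w => by simp [swp]
  have hswc : ∀ w : Wd, (swp w).count true + w.count true = w.length := fun w => by
    induction w with
    | nil => rfl
    | cons b w ih =>
      have : swp (b :: w) = (!b) :: swp w := rfl
      rw [this, List.count_cons, List.count_cons, List.length_cons]; cases b <;> simp <;> omega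
  have hz : ∀ g' ∈ GLs, g'.1.length = d → g'.1.count true = g.1.count true → (gval (phi K d V S (g.1.count true)) g' = 0 ↔ zr V d f g' = true) := by
    intro g' hg' hl hc
    have hsk' : g'.2 = true → 2 * g'.1.count true = d := by
      intro hs
      have h5 := hp g' (List.mem_filter.2 ⟨hg', by simp [hl]⟩)
      rw [frc_eq, Bool.and_eq_true, Bool.and_eq_true] at h5
      have := h5.1.2
      rw [hs] at this
      simpa using this
    unfold gval zr
    rw [Nat.beq_eq, bsel_eq, hphi _ hl hc]
    by_cases hs : g'.2 = true
    · have h6 := hsk' hs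
      have h7 := hswc g'.1
      rw [if_pos hs, if_pos hs, hphi _ (by rw [hswl, hl]) (by omega)]
      rw [sub_sub_sub_cancel_right, sub_eq_zero, Nat.cast_inj]
      rfl
    · rw [if_neg hs, if_neg hs, sub_zero, sub_eq_zero, Nat.cast_inj]
      rfl
  have hall' : ∀ g' ∈ GLs, g'.1.length = d → g'.1.count true = g.1.count true → zr V d f g' = !(g' == g) := by
    intro g' hg' hl hc
    have := hall g' (List.mem_filter.2 ⟨hg', by simp [hl]⟩)
    simpa [hc] using this
  refine ⟨phi K d V S (g.1.count true), phi_cyc (by omega) (by omega) hrot _, phi_Cy hd (by omega) hD (hcS ▸ hf) hV hC _, ?_, ?_, ?_⟩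
  · intro w hw
    unfold phi at hw
    by_contra hcon
    exact hw (if_neg hcon)
  · rw [Ne, hz g hg hgd rfl, hall' g hg hgd rfl]
    simp
  · intro g' hg' hne
    by_cases hc : g'.1.length = d ∧ g'.1.count true = g.1.count true
    · rw [hz g' hg' hc.1 hc.2, hall' g' hg' hc.1 hc.2]
      simpa using hne
    · have h0 : phi K d V S (g.1.count true) g'.1 = 0 := if_neg hc
      unfold gval
      rw [h0]
      by_cases hs : g'.2 = true
      · rw [if_pos hs, zero_sub, neg_eq_zero]
        apply if_neg
        rw [hswl]
        rintro ⟨h8, h9⟩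
        have h5 := hp g' (List.mem_filter.2 ⟨hg', by simp [h8]⟩)
        rw [frc_eq, Bool.and_eq_true, Bool.and_eq_true] at h5
        have := h5.1.2
        rw [hs] at this
        have h10 := hswc g'.1
        simp at this
        exact hc ⟨h8, by omega⟩
      · rw [if_neg hs, sub_zero]

end C520

namespace C520

def DualP (d : ℕ) : Prop := ∃ D F V, 2 ≤ d ∧ d ≤ 16 ∧ d ≤ D ∧ D ≤ 20 ∧ F * 2 ^ d ≤ 2 ^ D ∧ chkV D d V = true ∧ prc V d F = true ∧
  ∀ l ∈ lensL 6 1 d, ∃ s, cyT 16 D V 4 s l = 3840 * d * repu 16 (F * 2 ^ d)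

theorem chunk {D d F V k n : ℕ} {L : List (List ℕ)} (h : chkC 16 D d F V ((L.drop k).take n) = true)
    (h2 : ∀ l ∈ L.drop (k + n), ∃ s, cyT 16 D V 4 s l = 3840 * d * repu 16 (F * 2 ^ d)) :
    ∀ l ∈ L.drop k, ∃ s, cyT 16 D V 4 s l = 3840 * d * repu 16 (F * 2 ^ d) := by
  intro l hl
  rw [← List.take_append_drop n (L.drop k), List.mem_append] at hl
  rcases hl with hl | hl
  · exact chkC_spec _ _ _ _ _ h l hl
  · rw [List.drop_drop] at hl
    exact h2 l hl

theorem mkD {D d F V : ℕ} (h : 2 ≤ d ∧ d ≤ 16 ∧ d ≤ D ∧ D ≤ 20 ∧ F * 2 ^ d ≤ 2 ^ D) (h1 : chkV D d V = true) (h2 : prc V d F = true)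
    (h3 : ∀ l ∈ (lensL 6 1 d).drop 0, ∃ s, cyT 16 D V 4 s l = 3840 * d * repu 16 (F * 2 ^ d)) : DualP d :=
  ⟨D, F, V, h.1, h.2.1, h.2.2.1, h.2.2.2.1, h.2.2.2.2, h1, h2, h3⟩

theorem chunkE {D d F V k : ℕ} {L : List (List ℕ)} (h : L.drop k = []) :
    ∀ l ∈ L.drop k, ∃ s, cyT 16 D V 4 s l = 3840 * d * repu 16 (F * 2 ^ d) := by
  rw [h]; simp

set_option maxHeartbeats 40000000 in
/-- all heavy computations, in one theorem so that they run one after the other -/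
theorem heavy : runN (allData.take 14) st1 = true ∧ ∀ d, 2 ≤ d → d ≤ 15 → DualP d := by
  refine ⟨by decide +kernel, fun d h2 h15 => ?_⟩
  interval_cases d
  · refine mkD (D := 2) (F := 1) (V := tabV 16 2 2 1 dat2) (by norm_num) (by decide +kernel) (by decide +kernel) ?_
    exact chunkE (by decide +kernel)
  · refine mkD (D := 3) (F := 1) (V := tabV 16 3 3 1 dat3) (by norm_num) (by decide +kernel) (by decide +kernel) ?_
    exact chunkE (by decide +kernel)
  · refine mkD (D := 5) (F := 2) (V := tabV 16 5 4 2 dat4) (by norm_num) (by decide +kernel) (by decide +kernel) ?_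
    exact chunkE (by decide +kernel)
  · refine mkD (D := 6) (F := 2) (V := tabV 16 6 5 2 dat5) (by norm_num) (by decide +kernel) (by decide +kernel) ?_
    exact chunkE (by decide +kernel)
  · refine mkD (D := 8) (F := 3) (V := tabV 16 8 6 3 dat6) (by norm_num) (by decide +kernel) (by decide +kernel) ?_
    iterate 1 refine chunk (n := 100) (by decide +kernel) ?_
    exact chunkE (by decide +kernel)
  · refine mkD (D := 9) (F := 3) (V := tabV 16 9 7 3 dat7) (by norm_num) (by decide +kernel) (by decide +kernel) ?_
    iterate 1 refine chunk (n := 100) (by decide +kernel) ?_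
    exact chunkE (by decide +kernel)
  · refine mkD (D := 11) (F := 5) (V := tabV 16 11 8 5 dat8) (by norm_num) (by decide +kernel) (by decide +kernel) ?_
    iterate 1 refine chunk (n := 100) (by decide +kernel) ?_
    exact chunkE (by decide +kernel)
  · refine mkD (D := 12) (F := 5) (V := tabV 16 12 9 5 dat9) (by norm_num) (by decide +kernel) (by decide +kernel) ?_
    iterate 1 refine chunk (n := 100) (by decide +kernel) ?_
    exact chunkE (by decide +kernel)
  · refine mkD (D := 13) (F := 8) (V := tabV 16 13 10 8 dat10) (by norm_num) (by decide +kernel) (by decide +kernel) ?_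
    iterate 1 refine chunk (n := 100) (by decide +kernel) ?_
    exact chunkE (by decide +kernel)
  · refine mkD (D := 14) (F := 7) (V := tabV 16 14 11 7 dat11) (by norm_num) (by decide +kernel) (by decide +kernel) ?_
    iterate 1 refine chunk (n := 100) (by decide +kernel) ?_
    exact chunkE (by decide +kernel)
  · refine mkD (D := 15) (F := 7) (V := tabV 16 15 12 7 dat12) (by norm_num) (by decide +kernel) (by decide +kernel) ?_
    iterate 2 refine chunk (n := 10) (by decide +kernel) ?_
    exact chunkE (by decide +kernel)
  · refine mkD (D := 16) (F := 5) (V := tabV 16 16 13 5 dat13) (by norm_num) (by decide +kernel) (by decide +kernel) ?_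
    iterate 3 refine chunk (n := 5) (by decide +kernel) ?_
    exact chunkE (by decide +kernel)
  · refine mkD (D := 16) (F := 3) (V := tabV 16 16 14 3 dat14) (by norm_num) (by decide +kernel) (by decide +kernel) ?_
    iterate 7 refine chunk (n := 3) (by decide +kernel) ?_
    exact chunkE (by decide +kernel)
  · refine mkD (D := 15) (F := 1) (V := tabV 16 15 15 1 dat15) (by norm_num) (by decide +kernel) (by decide +kernel) ?_
    iterate 6 refine chunk (n := 5) (by decide +kernel) ?_
    exact chunkE (by decide +kernel)

end C520

namespace C520

theorem cy20 {M : Type*} [AddCommGroup M] (t : Wd → M) (a b c v : Wd) (h : Cy t 5 ![a,a,a,b,c,v] = 0) : 6 • ((arr20 a b c).map fun w => t (w ++ v)).sum = 0 := by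
  rw [Cy_eq_CyL, show List.ofFn ![a,a,a,b,c,v] = [a,a,a,b,c,v] from rfl] at h
  rw [← h]
  simp only [CyL, insL, arr20, List.map_cons, List.map_nil, List.sum_cons, List.sum_nil, List.flatten_cons, List.flatten_nil, List.append_assoc, List.append_nil]
  abel

theorem cy5 {M : Type*} [AddCommGroup M] (t : Wd → M) (a b v : Wd) (h : Cy t 5 ![a,a,a,a,b,v] = 0) : 24 • ((arr5 a b).map fun w => t (w ++ v)).sum = 0 := by
  rw [Cy_eq_CyL, show List.ofFn ![a,a,a,a,b,v] = [a,a,a,a,b,v] from rfl] at h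
  rw [← h]
  simp only [CyL, insL, arr5, List.map_cons, List.map_nil, List.sum_cons, List.sum_nil, List.flatten_cons, List.flatten_nil, List.append_assoc, List.append_nil]
  abel

/-- shape -/
def Sh : ℕ → Tr → Prop
  | 0, .leaf _ => True
  | 0, .node _ _ => False
  | _+1, .leaf _ => False
  | k+1, .node l r => Sh k l ∧ Sh k r

theorem get_node (l r : Tr) (k i : ℕ) : (Tr.node l r).get (k + 1) i = if 2 ^ k ≤ i then r.get k (i - 2 ^ k) else l.get k i := by
  show bsel (Nat.ble (2 ^ k) i) (r.get k (i - 2 ^ k)) (l.get k i) = _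
  rw [bsel_eq]; simp only [Nat.ble_eq]

theorem set_node {α : Type} (l r : Tr) (k i v : ℕ) (c : Tr → α) : (Tr.node l r).set (k + 1) i v c = if 2 ^ k ≤ i then r.set k (i - 2 ^ k) v (fun r' => c (.node l r')) else l.set k i v (fun l' => c (.node l' r)) := by
  show bsel (Nat.ble (2 ^ k) i) _ _ = _
  rw [bsel_eq]; simp only [Nat.ble_eq]; rfl

theorem set_spec : ∀ (k : ℕ) (T : Tr) (i v : ℕ), Sh k T → i < 2 ^ k → ∃ T', Sh k T' ∧ (∀ j < 2 ^ k, T'.get k j = if j = i then v else T.get k j) ∧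
    ∀ {α : Type} (c : Tr → α), T.set k i v c = c T'
  | 0, .leaf w, i, v, _, hi => ⟨.leaf v, trivial, fun j hj => by rw [if_pos (by simp at hi hj; omega)]; rfl, fun c => rfl⟩
  | 0, .node _ _, _, _, h, _ => h.elim
  | _+1, .leaf _, _, _, h, _ => h.elim
  | k+1, .node l r, i, v, h, hi => by
    rw [pow_succ] at hi
    by_cases hk : 2 ^ k ≤ i
    · obtain ⟨r', h1, h2, h3⟩ := set_spec k r (i - 2 ^ k) v h.2 (by omega)
      refine ⟨.node l r', ⟨h.1, h1⟩, fun j hj => ?_, fun c => ?_⟩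
      · rw [pow_succ] at hj
        rw [get_node, get_node]
        by_cases hj' : 2 ^ k ≤ j
        · rw [if_pos hj', if_pos hj', h2 _ (by omega)]
          congr 1
          apply propext; omega
        · rw [if_neg hj', if_neg hj', if_neg (by omega)]
      · rw [set_node, if_pos hk, h3]
    · obtain ⟨l', h1, h2, h3⟩ := set_spec k l i v h.1 (by omega)
      refine ⟨.node l' r, ⟨h1, h.2⟩, fun j hj => ?_, fun c => ?_⟩
      · rw [get_node, get_node]
        by_cases hj' : 2 ^ k ≤ j
        · rw [if_pos hj', if_pos hj', if_neg (by omega)]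
        · rw [if_neg hj', if_neg hj', h2 _ (by omega)]
      · rw [set_node, if_neg hk, h3]

theorem full_sh : ∀ k, Sh k (Tr.full k)
  | 0 => trivial
  | k+1 => ⟨full_sh k, full_sh k⟩

theorem full_get : ∀ k i, (Tr.full k).get k i = 0
  | 0, _ => rfl
  | k+1, i => by
    show (Tr.node (Tr.full k) (Tr.full k)).get (k+1) i = 0
    rw [get_node, full_get, full_get, ite_self]

/-- numeric value of a digit function -/
def nv (n : ℕ) (f : ℕ → ℕ) : ℕ := ∑ i ∈ Finset.range n, f i * XX ^ i

theorem XX_pos : 0 < XX := by decide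

theorem nv_add (a b : ℕ) (f : ℕ → ℕ) : nv (a + b) f = nv a f + XX ^ a * nv b (fun i => f (a + i)) := by
  rw [nv, Finset.sum_range_add, nv, nv, Finset.mul_sum]
  congr 1
  refine Finset.sum_congr rfl fun i _ => ?_
  rw [pow_add]; ring

theorem nv_lt (n : ℕ) (f : ℕ → ℕ) (h : ∀ i, f i < XX) : nv n f < XX ^ n := by
  induction n with
  | zero => simp [nv]
  | succ n ih =>
    rw [nv, Finset.sum_range_succ, pow_succ]
    have := Nat.mul_le_mul_right (XX ^ n) (Nat.succ_le_of_lt (h n))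
    rw [nv] at ih
    rw [Nat.succ_mul] at this
    linarith

theorem nv_zero {n : ℕ} {f : ℕ → ℕ} (h : nv n f = 0) : ∀ i < n, f i = 0 := by
  intro i hi
  rw [nv, Finset.sum_eq_zero_iff] at h
  have := h i (Finset.mem_range.2 hi)
  rcases Nat.mul_eq_zero.1 this with h | h
  · exact h
  · exact absurd h (pow_pos XX_pos i).ne'

theorem nv_div (a b : ℕ) (f : ℕ → ℕ) (h : ∀ i, f i < XX) : nv (a + b) f / XX ^ a = nv b (fun i => f (a + i)) := by
  rw [nv_add, Nat.add_mul_div_left _ _ (pow_pos XX_pos a), Nat.div_eq_of_lt (nv_lt a f h), zero_add]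

theorem nv_mod (a b : ℕ) (f : ℕ → ℕ) (h : ∀ i, f i < XX) : nv (a + b) f % XX ^ a = nv a f := by
  rw [nv_add, Nat.add_mul_mod_self_left, Nat.mod_eq_of_lt (nv_lt a f h)]

theorem ap_node (l r : Tr) (k V acc : ℕ) : ap (.node l r) (k + 1) V acc = if V = 0 then acc else ap r k (V / XX ^ 2 ^ k) (ap l k (V % XX ^ 2 ^ k) acc) := by
  show bsel (Nat.beq V 0) acc (ap r k (V / XX ^ 2 ^ k) (ap l k (V % XX ^ 2 ^ k) acc)) = _
  rw [bsel_eq]; simp only [Nat.beq_eq]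

theorem ap_spec : ∀ (k : ℕ) (T : Tr) (f : ℕ → ℕ) (acc : ℕ), Sh k T → (∀ i, f i < XX) →
    ap T k (nv (2 ^ k) f) acc = acc + ∑ i ∈ Finset.range (2 ^ k), (f i % 7) * T.get k i
  | 0, .leaf w, f, acc, _, hf => by
    show acc + nv 1 f % 7 * w = _
    simp only [nv, pow_zero, Finset.sum_range_one, mul_one]; rfl
  | 0, .node _ _, _, _, h, _ => h.elim
  | _+1, .leaf _, _, _, h, _ => h.elim
  | k+1, .node l r, f, acc, h, hf => by
    rw [ap_node]
    split_ifs with hV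
    · have := nv_zero hV
      rw [Finset.sum_eq_zero, add_zero]
      intro i hi
      rw [this i (Finset.mem_range.1 hi), Nat.zero_mod, zero_mul]
    · rw [pow_succ, mul_two, nv_div _ _ _ hf, nv_mod _ _ _ hf, ap_spec k l f acc h.1 hf, ap_spec k r _ _ h.2 (fun i => hf _), Finset.sum_range_add, add_assoc]
      congr 2
      · refine Finset.sum_congr rfl fun i hi => ?_
        rw [get_node, if_neg (by simpa using hi)]
      · refine Finset.sum_congr rfl fun i hi => ?_
        rw [get_node, if_pos (by omega), Nat.add_sub_cancel_left]

theorem nrm_succ (k V : ℕ) : nrm (k + 1) V = if V = 0 then 0 else nrm k (V % XX ^ 2 ^ k) + nrm k (V / XX ^ 2 ^ k) * XX ^ 2 ^ k := by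
  show bsel (Nat.beq V 0) 0 (nrm k (V % XX ^ 2 ^ k) + nrm k (V / XX ^ 2 ^ k) * XX ^ 2 ^ k) = _
  rw [bsel_eq]; simp only [Nat.beq_eq]

theorem nrm_spec : ∀ (k : ℕ) (f : ℕ → ℕ), (∀ i, f i < XX) → nrm k (nv (2 ^ k) f) = nv (2 ^ k) (fun i => f i % 7)
  | 0, f, _ => by
    show nv 1 f % 7 = _
    simp [nv]
  | k+1, f, hf => by
    rw [nrm_succ]
    split_ifs with hV
    · have := nv_zero hV
      symm
      rw [nv, Finset.sum_eq_zero]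
      intro i hi
      rw [this i (Finset.mem_range.1 hi), Nat.zero_mod, zero_mul]
    · rw [pow_succ, mul_two, nv_div _ _ _ hf, nv_mod _ _ _ hf, nrm_spec k f hf, nrm_spec k _ (fun i => hf _), nv_add]
      ring

section
variable {E E' : Type*} [AddCommGroup E] [AddCommGroup E']

def Rp (n : ℕ) (c : ℕ → E) (V : ℕ) (e : E) (m : ℕ) : Prop :=
  ∃ f : ℕ → ℕ, (∀ i, n ≤ i → f i = 0) ∧ (∀ i, f i ≤ m) ∧ V = nv n f ∧ e = ∑ i ∈ Finset.range n, f i • c i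

theorem nv_ext {n n' : ℕ} (h : n ≤ n') {f : ℕ → ℕ} (hf : ∀ i, n ≤ i → f i = 0) : nv n f = nv n' f := by
  apply Finset.sum_subset (Finset.range_mono h)
  intro i _ hi
  rw [hf i (by simpa using hi), zero_mul]

theorem Rp.mono {n n' : ℕ} {c c' : ℕ → E} {V : ℕ} {e : E} {m m' : ℕ} (h : Rp n c V e m) (hn : n ≤ n') (hm : m ≤ m') (hc : ∀ i < n, c i = c' i) : Rp n' c' V e m' := by
  obtain ⟨f, h1, h2, h3, h4⟩ := h
  refine ⟨f, fun i hi => h1 i (hn.trans hi), fun i => (h2 i).trans hm, h3.trans (nv_ext hn h1), h4.trans ?_⟩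
  rw [← Finset.sum_subset (Finset.range_mono hn) (f := fun i => f i • c' i)]
  · exact Finset.sum_congr rfl fun i hi => by rw [hc i (Finset.mem_range.1 hi)]
  · intro i _ hi
    rw [h1 i (by simpa using hi), zero_smul]

theorem Rp.add {n : ℕ} {c : ℕ → E} {V V' : ℕ} {e e' : E} {m m' : ℕ} (h : Rp n c V e m) (h' : Rp n c V' e' m') : Rp n c (V + V') (e + e') (m + m') := by
  obtain ⟨f, h1, h2, h3, h4⟩ := h
  obtain ⟨g, g1, g2, g3, g4⟩ := h'
  refine ⟨fun i => f i + g i, fun i hi => by simp [h1 i hi, g1 i hi], fun i => add_le_add (h2 i) (g2 i), ?_, ?_⟩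
  · rw [h3, g3, nv, nv, nv, ← Finset.sum_add_distrib]
    exact Finset.sum_congr rfl fun i _ => by ring
  · rw [h4, g4, ← Finset.sum_add_distrib]
    exact Finset.sum_congr rfl fun i _ => by rw [add_smul]

theorem Rp.mul {n : ℕ} {c : ℕ → E} {V : ℕ} {e : E} {m : ℕ} (h : Rp n c V e m) (k : ℕ) : Rp n c (k * V) (k • e) (k * m) := by
  obtain ⟨f, h1, h2, h3, h4⟩ := h
  refine ⟨fun i => k * f i, fun i hi => by simp [h1 i hi], fun i => Nat.mul_le_mul_left _ (h2 i), ?_, ?_⟩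
  · rw [h3, nv, nv, Finset.mul_sum]
    exact Finset.sum_congr rfl fun i _ => by ring
  · rw [h4, Finset.smul_sum]
    exact Finset.sum_congr rfl fun i _ => by rw [mul_smul]

theorem Rp.zero (n : ℕ) (c : ℕ → E) (m : ℕ) : Rp n c 0 0 m :=
  ⟨fun _ => 0, fun _ _ => rfl, fun _ => Nat.zero_le _, by simp [nv], by simp⟩

theorem Rp.sum {n : ℕ} {c : ℕ → E} {m : ℕ} {V : ℕ → ℕ} {e : ℕ → E} : ∀ (k : ℕ), (∀ i < k, Rp n c (V i) (e i) m) → Rp n c (∑ i ∈ Finset.range k, V i) (∑ i ∈ Finset.range k, e i) (k * m)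
  | 0, _ => by simpa using Rp.zero n c _
  | k+1, h => by
    rw [Finset.sum_range_succ, Finset.sum_range_succ, Nat.succ_mul]
    exact (Rp.sum k fun i hi => h i (by omega)).add (h k (by omega))

theorem Rp.single {n : ℕ} (c : ℕ → E) {i : ℕ} (hi : i < n) : Rp n c (XX ^ i) (c i) 1 := by
  refine ⟨fun j => if j = i then 1 else 0, fun j hj => if_neg (by omega), fun j => by dsimp only; split_ifs <;> omega, ?_, ?_⟩
  · simp [nv, hi]
  · simp [hi]

theorem Rp.shift {n N o : ℕ} {c c' : ℕ → E} {V : ℕ} {e : E} {m : ℕ} (h : Rp n c V e m) (hc : ∀ i < n, c i = c' (o + i)) (hN : o + n ≤ N) : Rp N c' (V * XX ^ o) e m := by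
  refine Rp.mono (n := o + n) ?_ hN le_rfl (fun _ _ => rfl)
  obtain ⟨f, h1, h2, h3, h4⟩ := h
  refine ⟨fun i => if i < o then 0 else f (i - o), fun i hi => ?_, fun i => ?_, ?_, ?_⟩
  · dsimp only; rw [if_neg (by omega)]; exact h1 _ (by omega)
  · dsimp only; split_ifs
    · omega
    · exact h2 _
  · rw [h3, nv_add, nv.eq_def o, Finset.sum_eq_zero (s := Finset.range o), zero_add, mul_comm]
    · congr 1
      exact Finset.sum_congr rfl fun i _ => by dsimp only; rw [if_neg (by omega), Nat.add_sub_cancel_left]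
    · intro i hi
      rw [if_pos (by simpa using hi), zero_mul]
  · rw [h4, Finset.sum_range_add, Finset.sum_eq_zero (s := Finset.range o), zero_add]
    · refine Finset.sum_congr rfl fun i hi => ?_
      dsimp only
      rw [if_neg (by omega), Nat.add_sub_cancel_left, hc i (by simpa using hi)]
    · intro i hi
      dsimp only; rw [if_pos (by simpa using hi), zero_smul]

theorem Rp.map {n : ℕ} {c : ℕ → E} {V : ℕ} {e : E} {m : ℕ} (h : Rp n c V e m) (φ : E →+ E') : Rp n (fun i => φ (c i)) V (φ e) m := by
  obtain ⟨f, h1, h2, h3, h4⟩ := h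
  refine ⟨f, h1, h2, h3, ?_⟩
  rw [h4, map_sum]
  exact Finset.sum_congr rfl fun i _ => by rw [map_nsmul]

theorem mod7 (h7 : ∀ e : E, 7 • e = 0) (a : ℕ) (e : E) : (a % 7) • e = a • e := by
  conv_rhs => rw [← Nat.div_add_mod a 7, add_smul, mul_comm, mul_smul, h7, smul_zero, zero_add]

theorem Rp.nrm (h7 : ∀ e : E, 7 • e = 0) {n : ℕ} {c : ℕ → E} {V : ℕ} {e : E} {m : ℕ} (h : Rp n c V e m) (hm : m < XX) (hn : n ≤ 512) : Rp n c (nrm 9 V) e 6 := by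
  obtain ⟨f, h1, h2, h3, h4⟩ := h
  refine ⟨fun i => f i % 7, fun i hi => by simp [h1 i hi], fun i => by dsimp only; omega, ?_, ?_⟩
  · rw [h3, nv_ext hn h1, show (512:ℕ) = 2 ^ 9 by norm_num, nrm_spec 9 f (fun i => (h2 i).trans_lt hm)]
    exact (nv_ext (f := fun i => f i % 7) hn fun i hi => by simp [h1 i hi]).symm
  · rw [h4]
    exact Finset.sum_congr rfl fun i _ => by rw [mod7 h7]

theorem Rp.ap (h7 : ∀ e : E, 7 • e = 0) {n n' : ℕ} {c c' : ℕ → E} {V : ℕ} {e : E} {m : ℕ} (h : Rp n c V e m) (hm : m < XX) (hn : n ≤ 512) {T : Tr} (hT : Sh 9 T)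
    (hr : ∀ i < n, Rp n' c' (T.get 9 i) (c i) 6) : Rp n' c' (ap T 9 V 0) e 18432 := by
  obtain ⟨f, h1, h2, h3, h4⟩ := h
  rw [h3, nv_ext hn h1]
  have := ap_spec 9 T f 0 hT (fun i => (h2 i).trans_lt hm)
  rw [show (512:ℕ) = 2 ^ 9 by norm_num, this, zero_add, show (2:ℕ) ^ 9 = 512 by norm_num, ← Finset.sum_subset (Finset.range_mono hn) (f := fun i => f i % 7 * T.get 9 i)
    (by intro i _ hi; rw [h1 i (by simpa using hi), Nat.zero_mod, zero_mul])]
  have key := Rp.sum (n := n') (c := c') (m := 36) (V := fun i => f i % 7 * T.get 9 i) (e := fun i => f i • c i) n (fun i hi => by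
    have := (hr i hi).mul (f i % 7)
    rw [mod7 h7] at this
    exact this.mono le_rfl (by have := Nat.mod_lt (f i) (show 7 > 0 by norm_num); omega) (fun _ _ => rfl))
  rw [h4]
  exact key.mono le_rfl (by omega) (fun _ _ => rfl)

theorem Rp.apN (h7 : ∀ e : E, 7 • e = 0) {n n' : ℕ} {c c' : ℕ → E} {V : ℕ} {e : E} {m : ℕ} (h : Rp n c V e m) (hm : m < XX) (hn : n ≤ 512) (hn' : n' ≤ 512) {T : Tr} (hT : Sh 9 T)
    (hr : ∀ i < n, Rp n' c' (T.get 9 i) (c i) 6) : Rp n' c' (apN T V) e 6 :=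
  Rp.nrm h7 (Rp.ap h7 h hm hn hT hr) (by decide) hn'

/-- valid pivots -/
def Vd (c : ℕ → E) (k o : ℕ) (T : Tr) : Prop := Sh k T ∧ ∀ j < 2 ^ k, T.get k j ≠ 0 → Rp (o + j) c (T.get k j - 1) (c (o + j)) 6

theorem Vd.map {c : ℕ → E} {k o : ℕ} {T : Tr} (h : Vd c k o T) (φ : E →+ E') : Vd (fun i => φ (c i)) k o T :=
  ⟨h.1, fun j hj h0 => (h.2 j hj h0).map φ⟩

theorem Vd_node {c : ℕ → E} {k o : ℕ} {l r : Tr} : Vd c (k + 1) o (.node l r) ↔ Vd c k o l ∧ Vd c k (o + 2 ^ k) r := by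
  constructor
  · rintro ⟨⟨h1, h2⟩, h3⟩
    refine ⟨⟨h1, fun j hj h0 => ?_⟩, ⟨h2, fun j hj h0 => ?_⟩⟩
    · have := h3 j (by rw [pow_succ]; omega)
      rw [get_node, if_neg (by omega)] at this
      exact this h0
    · have := h3 (2 ^ k + j) (by rw [pow_succ]; omega)
      rw [get_node, if_pos (by omega), Nat.add_sub_cancel_left, ← add_assoc] at this
      exact this h0
  · rintro ⟨⟨h1, h2⟩, ⟨h3, h4⟩⟩
    refine ⟨⟨h1, h3⟩, fun j hj h0 => ?_⟩
    rw [pow_succ] at hj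
    rw [get_node] at h0 ⊢
    split_ifs at h0 ⊢ with hk
    · have := h4 (j - 2 ^ k) (by omega) h0
      rwa [show o + 2 ^ k + (j - 2 ^ k) = o + j by omega] at this
    · exact h2 j (by omega) h0

theorem elim_node {α : Type} (l r : Tr) (k o V : ℕ) (kc : ℕ → α) (ks : Tr → α) : elim (.node l r) (k + 1) o V kc ks =
    if XX ^ o ≤ V then elim r k (o + 2 ^ k) V (fun V' => elim l k o V' kc (fun l' => ks (.node l' r))) (fun r' => ks (.node l r')) else kc V := by
  show bsel (Nat.ble (XX ^ o) V) _ _ = _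
  rw [bsel_eq]; simp only [Nat.ble_eq]; rfl

theorem elim_leaf {α : Type} (r k o V : ℕ) (kc : ℕ → α) (ks : Tr → α) : elim (.leaf r) k o V kc ks =
    if V / XX ^ o % 7 = 0 then kc (V % XX ^ o) else if r = 0 then ks (.leaf (nrm 9 (ninv (V / XX ^ o % 7) * (V % XX ^ o)) + 1)) else kc (V % XX ^ o + V / XX ^ o % 7 * (r - 1)) := by
  show bsel (Nat.beq (V / XX ^ o % 7) 0) (kc (V % XX ^ o)) (bsel (Nat.beq r 0) (ks (.leaf (nrm 9 (ninv (V / XX ^ o % 7) * (V % XX ^ o)) + 1))) (kc (V % XX ^ o + V / XX ^ o % 7 * (r - 1)))) = _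
  rw [bsel_eq, bsel_eq]; simp only [Nat.beq_eq]

theorem Rp.split {o : ℕ} {c : ℕ → E} {V : ℕ} {e : E} {m : ℕ} (h : Rp (o + 1) c V e m) (hm : m < XX) :
    ∃ e', Rp o c (V % XX ^ o) e' m ∧ e = e' + (V / XX ^ o) • c o := by
  obtain ⟨f, h1, h2, h3, h4⟩ := h
  have hf : ∀ i, f i < XX := fun i => (h2 i).trans_lt hm
  refine ⟨∑ i ∈ Finset.range o, f i • c i, ⟨fun i => if i < o then f i else 0, fun i hi => if_neg (by omega), fun i => ?_, ?_, ?_⟩, ?_⟩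
  · dsimp only; split_ifs
    · exact h2 i
    · omega
  · rw [h3, nv_mod _ _ _ hf]
    exact Finset.sum_congr rfl fun i hi => by dsimp only; rw [if_pos (by simpa using hi)]
  · exact Finset.sum_congr rfl fun i hi => by dsimp only; rw [if_pos (by simpa using hi)]
  · rw [h3, nv_div _ _ _ hf, h4, Finset.sum_range_succ]
    simp [nv]

theorem Rp.drop {o n : ℕ} {c : ℕ → E} {V : ℕ} {e : E} {m : ℕ} (h : Rp n c V e m) (hV : V < XX ^ o) : Rp o c V e m := by
  obtain ⟨f, h1, h2, h3, h4⟩ := h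
  have hz : ∀ i, o ≤ i → f i = 0 := by
    intro i hi
    by_cases hin : n ≤ i
    · exact h1 i hin
    by_contra h0
    have : f i * XX ^ i ≤ nv n f := Finset.single_le_sum (f := fun i => f i * XX ^ i) (fun _ _ => Nat.zero_le _) (Finset.mem_range.2 (by omega))
    have h5 : XX ^ o ≤ XX ^ i := Nat.pow_le_pow_right XX_pos hi
    have h6 : 1 * XX ^ i ≤ f i * XX ^ i := Nat.mul_le_mul_right _ (by omega)
    omega
  have key : Rp (max o n) c V e m := Rp.mono ⟨f, h1, h2, h3, h4⟩ (le_max_right _ _) le_rfl (fun _ _ => rfl)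
  refine ⟨f, hz, h2, ?_, ?_⟩
  · rw [h3, nv_ext (le_max_right o n) h1, nv_ext (le_max_left o n) hz]
  · rw [h4, Finset.sum_subset (Finset.range_mono (le_max_right o n)), ← Finset.sum_subset (Finset.range_mono (le_max_left o n))]
    · intro i _ hi
      rw [hz i (by simpa using hi), zero_smul]
    · intro i _ hi
      rw [h1 i (by simpa using hi), zero_smul]

theorem elim_spec (h7 : ∀ e : E, 7 • e = 0) (c : ℕ → E) : ∀ (k : ℕ) (T : Tr) (o V m : ℕ), Vd c k o T → Rp (o + 2 ^ k) c V 0 m → m + 36 * 2 ^ k < 500000 → o + 2 ^ k ≤ 512 →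
    (∃ V', Rp o c V' 0 (m + 36 * 2 ^ k) ∧ ∀ {α : Type} (kc : ℕ → α) (ks : Tr → α), elim T k o V kc ks = kc V') ∨
    (∃ T', Vd c k o T' ∧ ∀ {α : Type} (kc : ℕ → α) (ks : Tr → α), elim T k o V kc ks = ks T')
  | 0, .leaf r, o, V, m, hT, hV, hm, ho => by
    have hX : (500000 : ℕ) * 7 < XX := by decide
    obtain ⟨e', h1, h2⟩ := Rp.split hV (by omega)
    rw [← mod7 h7] at h2
    have hlt : V / XX ^ o % 7 < 7 := Nat.mod_lt _ (by norm_num)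
    by_cases hc : V / XX ^ o % 7 = 0
    · left
      refine ⟨V % XX ^ o, ?_, fun kc ks => by rw [elim_leaf, if_pos hc]⟩
      rw [hc, zero_smul, add_zero] at h2
      rw [h2]
      exact h1.mono le_rfl (by omega) (fun _ _ => rfl)
    · by_cases hr : r = 0
      · right
        refine ⟨_, ?_, fun kc ks => by rw [elim_leaf, if_neg hc, if_pos hr]⟩
        refine ⟨trivial, fun j hj _ => ?_⟩
        have hj0 : j = 0 := by simpa using hj
        subst hj0
        show Rp (o + 0) c (nrm 9 (ninv (V / XX ^ o % 7) * (V % XX ^ o))) (c (o + 0)) 6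
        rw [add_zero]
        have h8 : ninv (V / XX ^ o % 7) < 7 := Nat.mod_lt _ (by norm_num)
        have h3 := h1.mul (ninv (V / XX ^ o % 7))
        have h4 := Rp.nrm h7 h3 (by nlinarith) (by omega)
        have h5 : e' = - ((V / XX ^ o % 7) • c o) := eq_neg_of_add_eq_zero_left h2.symm
        rw [h5] at h4
        convert h4 using 1
        generalize V / XX ^ o % 7 = a at hlt hc
        have h9 : (ninv a * a) % 7 = 6 := by
          interval_cases a
          · exact absurd rfl hc
          all_goals rfl
        rw [smul_neg, ← mul_smul, ← mod7 h7, h9, eq_neg_iff_add_eq_zero, ← succ_nsmul', h7]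
      · left
        refine ⟨_, ?_, fun kc ks => by rw [elim_leaf, if_neg hc, if_neg hr]⟩
        have h3 := hT.2 0 (by norm_num) hr
        have h4 := h1.add (h3.mul (V / XX ^ o % 7))
        rw [add_zero] at h4
        rw [h2]
        exact h4.mono le_rfl (by omega) (fun _ _ => rfl)
  | 0, .node _ _, _, _, _, h, _, _, _ => h.1.elim
  | _+1, .leaf _, _, _, _, h, _, _, _ => h.1.elim
  | k+1, .node l r, o, V, m, hT, hV, hm, ho => by
    rw [pow_succ] at hm ho hV ⊢
    by_cases hX : XX ^ o ≤ V
    · obtain ⟨hl, hr⟩ := Vd_node.1 hT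
      rcases elim_spec h7 c k r (o + 2 ^ k) V m hr (by rwa [add_assoc, ← mul_two]) (by omega) (by omega) with ⟨V', h1, h2⟩ | ⟨r', h1, h2⟩
      · rcases elim_spec h7 c k l o V' _ hl h1 (by omega) (by omega) with ⟨V'', h3, h4⟩ | ⟨l', h3, h4⟩
        · left
          refine ⟨V'', h3.mono le_rfl (by omega) (fun _ _ => rfl), fun kc ks => ?_⟩
          rw [elim_node, if_pos hX, h2, h4]
        · right
          refine ⟨.node l' r, Vd_node.2 ⟨h3, hr⟩, fun kc ks => ?_⟩
          rw [elim_node, if_pos hX, h2, h4]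
      · right
        refine ⟨.node l r', Vd_node.2 ⟨hl, h1⟩, fun kc ks => ?_⟩
        rw [elim_node, if_pos hX, h2]
    · left
      refine ⟨V, ?_, fun kc ks => by rw [elim_node, if_neg hX]⟩
      exact (hV.drop (by omega)).mono le_rfl (by omega) (fun _ _ => rfl)

theorem ins_spec (h7 : ∀ e : E, 7 • e = 0) (c : ℕ → E) {T : Tr} {V n : ℕ} (hT : Vd c 9 0 T) (hV : Rp n c V 0 400000) (hn : n ≤ 512) :
    ∃ T', Vd c 9 0 T' ∧ ∀ {α : Type} (k : Tr → α), ins V T k = k T' := by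
  rcases elim_spec h7 c 9 T 0 V 400000 hT (hV.mono (by omega) le_rfl (fun _ _ => rfl)) (by norm_num) (by norm_num) with ⟨V', _, h⟩ | ⟨T', h1, h⟩
  · exact ⟨T, hT, fun k => h _ _⟩
  · exact ⟨T', h1, fun k => h _ _⟩
end
end C520

namespace C520

section
variable {M : Type*} [AddCommGroup M] (t : Wd → M)

def et (w : Wd) : Wd → M := fun v => t (w ++ v)
def es (w : Wd) : {v : Wd // v ≠ []} → M := fun v => t (w ++ v.1)

def rho (M : Type*) [AddCommGroup M] (z : Bool) : ({v : Wd // v ≠ []} → M) →+ (Wd → M) where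
  toFun F v := F ⟨z :: v, by simp⟩
  map_zero' := rfl
  map_add' _ _ := rfl

def lam (M : Type*) [AddCommGroup M] (z : Bool) : ({v : Wd // v ≠ []} → M) →+ (Wd → M) where
  toFun F v := F ⟨v ++ [z], by simp⟩
  map_zero' := rfl
  map_add' _ _ := rfl

def res (M : Type*) [AddCommGroup M] : (Wd → M) →+ ({v : Wd // v ≠ []} → M) where
  toFun F v := F v.1
  map_zero' := rfl
  map_add' _ _ := rfl

def ev0 (M : Type*) [AddCommGroup M] : (Wd → M) →+ M where
  toFun F := F []
  map_zero' := rfl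
  map_add' _ _ := rfl

theorem rho_es (z : Bool) (w : Wd) : rho M z (es t w) = et t (w ++ [z]) := by
  funext v
  show t (w ++ z :: v) = t (w ++ [z] ++ v)
  simp

theorem lam_es (hc : ∀ u v, t (u ++ v) = t (v ++ u)) (z : Bool) (w : Wd) : lam M z (es t w) = et t (z :: w) := by
  funext v
  show t (w ++ (v ++ [z])) = t (z :: w ++ v)
  rw [← List.append_assoc, hc]; rfl

theorem res_et (w : Wd) : res M (et t w) = es t w := rfl
theorem ev0_et (w : Wd) : ev0 M (et t w) = t w := by
  show t (w ++ []) = _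
  rw [List.append_nil]

def bz (z : ℕ) : Bool := Nat.beq z 1

def col (n : ℕ) (B : ℕ → Wd) (j : ℕ) : Wd := B (j % n) ++ [bz (j / n)]

theorem col_eq (n : ℕ) (B : ℕ → Wd) (z i : ℕ) (hi : i < n) : col n B (z * n + i) = B i ++ [bz z] := by
  unfold col
  rw [Nat.mul_comm, Nat.mul_add_mod, Nat.mod_eq_of_lt hi, Nat.mul_add_div (by omega), Nat.div_eq_of_lt hi, add_zero]

variable {t}

theorem colR {n : ℕ} {B : ℕ → Wd} {V : ℕ} {w : Wd} {m : ℕ} (h : Rp n (fun i => es t (B i)) V (es t w) m) (z : ℕ) (hz : z < 2) :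
    Rp (2 * n) (fun j => et t (col n B j)) (V * XX ^ (z * n)) (et t (w ++ [bz z])) m := by
  have h1 := h.map (rho M (bz z))
  rw [rho_es] at h1
  refine h1.shift (fun i hi => ?_) (by nlinarith)
  rw [rho_es, col_eq _ _ _ _ hi]

variable (t)

structure Inv (m : ℕ) (s : St) (B : ℕ → Wd) (n' : ℕ) (B' : ℕ → Wd) : Prop where
  tl : s.tabs.length = m
  nf : ∀ w : Wd, w.length = m → Rp s.n (fun i => es t (B i)) (nfw w s.tabs 1) (es t w) 18432
  l0 : ∀ i < n', Rp s.n (fun i => es t (B i)) (s.l0.get 9 i) (es t (false :: B' i)) 6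
  l1 : ∀ i < n', Rp s.n (fun i => es t (B i)) (s.l1.get 9 i) (es t (true :: B' i)) 6
  len : s.npl.length = s.n
  npl : ∀ i p, s.npl[i]? = some p → p.1 < 2 ∧ p.2 < n' ∧ B i = B' p.2 ++ [bz p.1]
  pvl : ∀ p ∈ s.pvl, p.1 < 2 ∧ p.2.1 < n' ∧ Rp s.n (fun i => es t (B i)) p.2.2 (es t (B' p.2.1 ++ [bz p.1])) 6

variable {t}

theorem mkplt_spec (n : ℕ) (lt : Tr) : ∀ (npl : List (ℕ × ℕ)) (i : ℕ) (T : Tr), Sh 9 T → i + npl.length ≤ 512 →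
    ∃ T', Sh 9 T' ∧ (∀ j p, npl[j]? = some p → T'.get 9 (i + j) = lt.get 9 p.2 * XX ^ (p.1 * n)) ∧ (∀ j < i, T'.get 9 j = T.get 9 j) ∧
      ∀ {α : Type} (k : Tr → α), mkplt n lt npl i T k = k T'
  | [], i, T, hT, _ => ⟨T, hT, by simp, fun _ _ => rfl, fun _ => rfl⟩
  | p :: npl, i, T, hT, hl => by
    rw [List.length_cons] at hl
    obtain ⟨T1, h1, h2, h3⟩ := set_spec 9 T i (lt.get 9 p.2 * XX ^ (p.1 * n)) hT (by norm_num; omega)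
    obtain ⟨T2, g1, g2, g4, g3⟩ := mkplt_spec n lt npl (i + 1) T1 h1 (by omega)
    refine ⟨T2, g1, ?_, ?_, ?_⟩
    · intro j q hj
      rcases j with _ | j
      · simp only [List.getElem?_cons_zero, Option.some.injEq] at hj
        subst hj
        rw [g4 _ (by omega), h2 _ (by norm_num; omega), if_pos (by omega)]
      · rw [List.getElem?_cons_succ] at hj
        rw [← g2 j q hj]; congr 1; omega
    · intro j hj
      rw [g4 _ (by omega), h2 _ (by norm_num; omega), if_neg (by omega)]
    · intro α k
      rw [← g3 k, ← h3 (fun T' => mkplt n lt npl (i + 1) T' k)]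
      rfl

theorem lrows_spec (hc : ∀ u v, t (u ++ v) = t (v ++ u)) (h7 : ∀ m : M, 7 • m = 0) {n n' : ℕ} {B B' : ℕ → Wd} {lt plt : Tr} {z0 : Bool} (hn : n ≤ 250) (hP : Sh 9 plt)
    (hl : ∀ i < n', Rp n (fun i => es t (B i)) (lt.get 9 i) (es t (z0 :: B' i)) 6)
    (hp : ∀ i < n, Rp (2 * n) (fun j => et t (col n B j)) (plt.get 9 i) (et t (z0 :: B i)) 6) :
    ∀ (pvl : List (ℕ × ℕ × ℕ)), (∀ p ∈ pvl, p.1 < 2 ∧ p.2.1 < n' ∧ Rp n (fun i => es t (B i)) p.2.2 (es t (B' p.2.1 ++ [bz p.1])) 6) → ∀ T, Vd (fun j => et t (col n B j)) 9 0 T →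
    ∃ T', Vd (fun j => et t (col n B j)) 9 0 T' ∧ ∀ {α : Type} (k : Tr → α), lrows n lt plt pvl T k = k T'
  | [], _, T, hT => ⟨T, hT, fun _ => rfl⟩
  | p :: pvl, hpv, T, hT => by
    have h7' : ∀ F : Wd → M, 7 • F = 0 := fun F => funext fun v => h7 (F v)
    obtain ⟨h1, h2, h3⟩ := hpv p (by simp)
    have a1 := colR (hl _ h2) p.1 h1
    have a2 := h3.map (lam M z0)
    simp only [lam_es t hc] at a2
    have a3 := (Rp.ap h7' a2 (by decide) (by omega) hP hp).mul 6
    have a4 := a1.add a3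
    have e : et t (z0 :: B' p.2.1 ++ [bz p.1]) + 6 • et t (z0 :: (B' p.2.1 ++ [bz p.1])) = 0 := by
      rw [List.cons_append, ← succ_nsmul', h7']
    rw [e] at a4
    obtain ⟨T1, b1, b2⟩ := ins_spec h7' _ hT (a4.mono le_rfl (by norm_num) (fun _ _ => rfl)) (by omega)
    obtain ⟨T2, c1, c2⟩ := lrows_spec hc h7 hn hP hl hp pvl (fun q hq => hpv q (by simp [hq])) T1 b1
    refine ⟨T2, c1, fun k => ?_⟩
    rw [← c2 k, ← b2 (fun T' => lrows n lt plt pvl T' k)]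
    rfl

theorem crows_spec (hc : ∀ u v, t (u ++ v) = t (v ++ u)) (h7 : ∀ m : M, 7 • m = 0) {n : ℕ} {B : ℕ → Wd} {plt : Tr} {z : ℕ} (hz : z < 2) (hn : n ≤ 250)
    (hp : ∀ i < n, Rp (2 * n) (fun j => t (col n B j)) (plt.get 9 i) (t (bz z :: B i)) 6) :
    ∀ (m i : ℕ), i + m ≤ n → ∀ T, Vd (fun j => t (col n B j)) 9 0 T →
    ∃ T', Vd (fun j => t (col n B j)) 9 0 T' ∧ ∀ {α : Type} (k : Tr → α), crows (z * n) plt m i T k = k T'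
  | 0, _, _, T, hT => ⟨T, hT, fun _ => rfl⟩
  | m+1, i, hi, T, hT => by
    have a1 := (hp i (by omega)).add ((Rp.single (n := 2 * n) (fun j => t (col n B j)) (i := z * n + i) (by nlinarith)).mul 6)
    have e : t (bz z :: B i) + 6 • t (col n B (z * n + i)) = 0 := by
      rw [col_eq _ _ _ _ (by omega), hc]
      exact (succ_nsmul' _ _).symm.trans (h7 _)
    rw [e] at a1
    obtain ⟨T1, b1, b2⟩ := ins_spec h7 _ hT (a1.mono le_rfl (by norm_num) (fun _ _ => rfl)) (by omega)
    obtain ⟨T2, c1, c2⟩ := crows_spec hc h7 hz hn hp m (i + 1) (by omega) T1 b1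
    refine ⟨T2, c1, fun k => ?_⟩
    rw [← c2 k, ← b2 (fun T' => crows (z * n) plt m (i + 1) T' k)]
    rfl

theorem wrow_spec {m : ℕ} {s : St} {B B' : ℕ → Wd} {n' : ℕ} (hI : Inv t m s B n' B') (w : Wd) (hw : w.length = m + 1) :
    Rp (2 * s.n) (fun j => et t (col s.n B j)) (wrow s w) (et t w) 18432 := by
  have hne : w ≠ [] := by rintro rfl; simp at hw
  have h1 := hI.nf w.dropLast (by simp [hw])
  have h2 : w.dropLast ++ [w.getLastD false] = w := by
    rw [List.getLastD_eq_getLast?, List.getLast?_eq_getLast_of_ne_nil hne]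
    exact List.dropLast_append_getLast hne
  show Rp _ _ (bsel (w.getLastD false) (nfw w.dropLast s.tabs 1 * XX ^ s.n) (nfw w.dropLast s.tabs 1)) _ _
  rw [bsel_eq]
  generalize w.getLastD false = z at h2
  cases z
  · have := colR h1 0 (by norm_num)
    rw [zero_mul, pow_zero, mul_one, show w.dropLast ++ [bz 0] = w from h2] at this
    exact this
  · have := colR h1 1 (by norm_num)
    rw [one_mul, show w.dropLast ++ [bz 1] = w from h2] at this
    exact this

theorem sumRows_spec {m : ℕ} {s : St} {B B' : ℕ → Wd} {n' : ℕ} (hI : Inv t m s B n' B') (ws : List Wd) (hw : ∀ w ∈ ws, w.length = m + 1) :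
    Rp (2 * s.n) (fun j => et t (col s.n B j)) (sumRows s ws) (ws.map (et t)).sum (ws.length * 18432) := by
  have gen : ∀ (ws : List Wd), (∀ w ∈ ws, w.length = m + 1) → ∀ a e b, Rp (2 * s.n) (fun j => et t (col s.n B j)) a e b →
      Rp (2 * s.n) (fun j => et t (col s.n B j)) (List.rec (motive := fun _ => Nat → Nat) (fun a => a) (fun w _ ih a => frc (Nat.add a (wrow s w)) ih) ws a) (e + (ws.map (et t)).sum) (b + ws.length * 18432) := by
    intro ws
    induction ws with
    | nil => intro _ a e b h; simpa using h
    | cons w ws ih =>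
      intro hw a e b h
      have h1 := ih (fun v hv => hw v (by simp [hv])) _ _ _ (h.add (wrow_spec hI w (hw w (by simp))))
      rw [List.map_cons, List.sum_cons, ← add_assoc, List.length_cons, show b + (ws.length + 1) * 18432 = b + 18432 + ws.length * 18432 by ring]
      exact h1
  have := gen ws hw 0 0 0 (Rp.zero _ _ _)
  rwa [zero_add, zero_add] at this

theorem map_sum_list {E E' : Type*} [AddCommGroup E] [AddCommGroup E'] (φ : E →+ E') (f : Wd → E) (ws : List Wd) : φ (ws.map f).sum = (ws.map fun w => φ (f w)).sum := by
  rw [map_list_sum, List.map_map]; rfl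

theorem grows_spec (h7 : ∀ m : M, 7 • m = 0) {m : ℕ} {s : St} {B B' : ℕ → Wd} {n' : ℕ} (hI : Inv t m s B n' B') (hn : s.n ≤ 250) :
    ∀ (rs : List (Wd × List Wd)), (∀ r ∈ rs, r.1.length = m + 1 ∧ (∀ w ∈ r.2, w.length = m + 1) ∧ r.2.length ≤ 1 ∧ t r.1 = (r.2.map t).sum) → ∀ T, Vd (fun j => t (col s.n B j)) 9 0 T →
    ∃ T', Vd (fun j => t (col s.n B j)) 9 0 T' ∧ ∀ {α : Type} (k : Tr → α), grows s rs T k = k T'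
  | [], _, T, hT => ⟨T, hT, fun _ => rfl⟩
  | r :: rs, hr, T, hT => by
    obtain ⟨h1, h2, h3, h4⟩ := hr r (by simp)
    have a1 := ((wrow_spec hI r.1 h1).map (ev0 M)).add (((sumRows_spec hI r.2 h2).map (ev0 M)).mul 6)
    rw [map_sum_list] at a1
    simp only [ev0_et] at a1
    have e : t r.1 + 6 • (r.2.map t).sum = 0 := by
      rw [h4, ← succ_nsmul', h7]
    rw [show (r.2.map fun w => t w) = r.2.map t from rfl, e] at a1
    obtain ⟨T1, b1, b2⟩ := ins_spec h7 _ hT (a1.mono le_rfl (by omega) (fun _ _ => rfl)) (by omega)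
    obtain ⟨T2, c1, c2⟩ := grows_spec h7 hI hn rs (fun q hq => hr q (by simp [hq])) T1 b1
    refine ⟨T2, c1, fun k => ?_⟩
    rw [← c2 k, ← b2 (fun T' => grows s rs T' k)]
    rfl

theorem allp_spec (T : Tr) : ∀ (m i : ℕ), allp T m i = true → ∀ j, i ≤ j → j < i + m → T.get 9 j ≠ 0
  | 0, i, _, j, h1, h2 => by omega
  | m+1, i, h, j, h1, h2 => by
    have h' : bsel (Nat.beq (T.get 9 i) 0) false (allp T m (i + 1)) = true := h
    rw [bsel_eq] at h'
    split_ifs at h' with h0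
    rw [Nat.beq_eq] at h0
    rcases Nat.eq_or_lt_of_le h1 with rfl | h3
    · exact h0
    · exact allp_spec T m (i + 1) h' j h3 (by omega)

theorem all_zero {E : Type*} [AddCommGroup E] {c : ℕ → E} {T : Tr} {n : ℕ} (hT : Vd c 9 0 T) (hn : n ≤ 512) (h : ∀ j < n, T.get 9 j ≠ 0) : ∀ j < n, c j = 0 := by
  intro j
  induction j using Nat.strong_induction_on with
  | _ j ih =>
    intro hj
    obtain ⟨f, _, _, _, h4⟩ := hT.2 j (by norm_num; omega) (h j hj)
    rw [zero_add] at h4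
    rw [h4]
    refine Finset.sum_eq_zero fun i hi => ?_
    rw [Finset.mem_range] at hi
    rw [ih i hi (by omega), smul_zero]

theorem Rp.eq_zero {E : Type*} [AddCommGroup E] {n : ℕ} {c : ℕ → E} {V m : ℕ} {e : E} (h : Rp n c V e m) (hc : ∀ j < n, c j = 0) : e = 0 := by
  obtain ⟨f, _, _, _, h4⟩ := h
  rw [h4]
  exact Finset.sum_eq_zero fun i hi => by rw [hc i (by simpa using hi), smul_zero]

theorem rel_zero (h7 : ∀ m : M, 7 • m = 0) (hC : ∀ a : Fin 6 → Wd, (∀ i, a i ≠ []) → Cy t 5 a = 0) (r : ℕ × ℕ × ℕ) (h1 : dec r.1 ≠ []) (h2 : dec r.2.1 ≠ []) (h3 : r.2.2 ≠ 0 → dec r.2.2 ≠ []) :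
    ((relWs r).map (es t)).sum = 0 := by
  funext v
  have e : ∀ ws : List Wd, ((ws.map (es t)).sum) v = (ws.map fun w => t (w ++ v.1)).sum := by
    intro ws
    induction ws with
    | nil => rfl
    | cons w ws ih => rw [List.map_cons, List.sum_cons, Pi.add_apply, ih, List.map_cons, List.sum_cons]; rfl
  rw [e]
  show _ = (0 : M)
  unfold relWs
  rw [bsel_eq]
  split_ifs with h0
  · have k := cy5 t (dec r.1) (dec r.2.1) v.1 (hC _ (by intro i; fin_cases i <;> first | exact h1 | exact h2 | exact v.2))
    generalize ((arr5 (dec r.1) (dec r.2.1)).map fun w => t (w ++ v.1)).sum = x at k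
    have : x = 5 • (24 • x) - 17 • (7 • x) := by abel
    rw [this, k, h7, smul_zero, smul_zero, sub_zero]
  · have h3' := h3 (by rwa [Nat.beq_eq] at h0)
    have k := cy20 t (dec r.1) (dec r.2.1) (dec r.2.2) v.1 (hC _ (by intro i; fin_cases i <;> first | exact h1 | exact h2 | exact h3' | exact v.2))
    generalize ((arr20 (dec r.1) (dec r.2.1) (dec r.2.2)).map fun w => t (w ++ v.1)).sum = x at k
    have : x = 7 • x - 6 • x := by abel
    rw [this, k, h7, sub_zero]

def relOK (d : ℕ) (r : ℕ × ℕ × ℕ) : Prop := dec r.1 ≠ [] ∧ dec r.2.1 ≠ [] ∧ (r.2.2 ≠ 0 → dec r.2.2 ≠ []) ∧ ∀ w ∈ relWs r, w.length = d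

theorem relWs_len (r : ℕ × ℕ × ℕ) : (relWs r).length ≤ 20 := by
  unfold relWs
  rw [bsel_eq]
  split_ifs <;> simp [arr5, arr20]

theorem srows_spec (h7 : ∀ m : M, 7 • m = 0) (hC : ∀ a : Fin 6 → Wd, (∀ i, a i ≠ []) → Cy t 5 a = 0) {m : ℕ} {s : St} {B B' : ℕ → Wd} {n' : ℕ} (hI : Inv t m s B n' B') (hn : s.n ≤ 250) :
    ∀ (rs : List (ℕ × ℕ × ℕ)), (∀ r ∈ rs, relOK (m + 1) r) → ∀ T, Vd (fun j => es t (col s.n B j)) 9 0 T →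
    ∃ T', Vd (fun j => es t (col s.n B j)) 9 0 T' ∧ ∀ {α : Type} (k : Tr → α), srows s rs T k = k T'
  | [], _, T, hT => ⟨T, hT, fun _ => rfl⟩
  | r :: rs, hr, T, hT => by
    have h7' : ∀ F : {v : Wd // v ≠ []} → M, 7 • F = 0 := fun F => funext fun v => h7 (F v)
    obtain ⟨h1, h2, h3, h4⟩ := hr r (by simp)
    have a1 := (sumRows_spec hI (relWs r) h4).map (res M)
    rw [map_sum_list] at a1
    simp only [res_et] at a1
    rw [show ((relWs r).map fun w => es t w) = (relWs r).map (es t) from rfl, rel_zero h7 hC r h1 h2 h3] at a1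
    obtain ⟨T1, b1, b2⟩ := ins_spec h7' _ hT (a1.mono le_rfl (by have := relWs_len r; omega) (fun _ _ => rfl)) (by omega)
    obtain ⟨T2, c1, c2⟩ := srows_spec h7 hC hI hn rs (fun q hq => hr q (by simp [hq])) T1 b1
    refine ⟨T2, c1, fun k => ?_⟩
    rw [← c2 k, ← b2 (fun T' => srows s rs T' k)]
    rfl

/-- words of the new basis -/
def Bn (B : ℕ → Wd) (a : List (ℕ × ℕ)) (i : ℕ) : Wd := B (a.getD i (0, 0)).2 ++ [bz (a.getD i (0, 0)).1]

variable (t) in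
structure FI (n : ℕ) (B : ℕ → Wd) (j n' : ℕ) (U : Tr) (a : List (ℕ × ℕ)) (b : List (ℕ × ℕ × ℕ)) : Prop where
  sh : Sh 9 U
  len : a.length = n'
  le : n' ≤ j
  ha : ∀ p ∈ a, p.1 < 2 ∧ p.2 < n
  hU : ∀ i < j, Rp n' (fun i => es t (Bn B a.reverse i)) (U.get 9 i) (es t (col n B i)) 6
  hb : ∀ p ∈ b, p.1 < 2 ∧ p.2.1 < n ∧ Rp n' (fun i => es t (Bn B a.reverse i)) p.2.2 (es t (B p.2.1 ++ [bz p.1])) 6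

theorem fin_spec (h7 : ∀ m : M, 7 • m = 0) {n : ℕ} (hn : n ≤ 250) {B : ℕ → Wd} {T : Tr} (hT : Vd (fun j => es t (col n B j)) 9 0 T) :
    ∀ (m j n' : ℕ) (U : Tr) (a : List (ℕ × ℕ)) (b : List (ℕ × ℕ × ℕ)), j + m = 2 * n → FI t n B j n' U a b →
    ∃ n'' U' a' b', FI t n B (2 * n) n'' U' a' b' ∧ ∀ {α : Type} (k : Nat → Tr → List (Nat × Nat) → List (Nat × Nat × Nat) → α), fin n T m j n' U a b k = k n'' U' a' b'
  | 0, j, n', U, a, b, hj, h => ⟨n', U, a, b, by rwa [← hj], fun _ => rfl⟩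
  | m+1, j, n', U, a, b, hj, h => by
    have h7' : ∀ F : {v : Wd // v ≠ []} → M, 7 • F = 0 := fun F => funext fun v => h7 (F v)
    have hz : j / n < 2 := by rw [Nat.div_lt_iff_lt_mul (by omega)]; omega
    have hi : j % n < n := Nat.mod_lt _ (by omega)
    have heq : ∀ {α : Type} (k : Nat → Tr → List (Nat × Nat) → List (Nat × Nat × Nat) → α), fin n T (m + 1) j n' U a b k =
        if T.get 9 j = 0 then U.set 9 j (XX ^ n') (fun U' => fin n T m (j + 1) (n' + 1) U' ((j / n, j % n) :: a) b k)
        else U.set 9 j (apN U (T.get 9 j - 1)) (fun U' => fin n T m (j + 1) n' U' a ((j / n, j % n, apN U (T.get 9 j - 1)) :: b) k) := by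
      intro α k
      show bsel (Nat.beq (T.get 9 j) 0) _ _ = _
      rw [bsel_eq]; simp only [Nat.beq_eq]; rfl
    by_cases h0 : T.get 9 j = 0
    · obtain ⟨U1, u1, u2, u3⟩ := set_spec 9 U j (XX ^ n') h.sh (by norm_num; omega)
      have hB : ∀ i < n', es t (Bn B a.reverse i) = es t (Bn B ((j / n, j % n) :: a).reverse i) := by
        intro i hi
        unfold Bn
        rw [List.reverse_cons, List.getD_append _ _ _ _ (by rw [List.length_reverse, h.len]; exact hi)]
      have hB' : Bn B ((j / n, j % n) :: a).reverse n' = col n B j := by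
        unfold Bn
        rw [List.reverse_cons, List.getD_append_right _ _ _ _ (by rw [List.length_reverse, h.len]), List.length_reverse, h.len, Nat.sub_self]
        rfl
      have hFI : FI t n B (j + 1) (n' + 1) U1 ((j / n, j % n) :: a) b := by
        refine ⟨u1, by simp [h.len], by have := h.le; omega, ?_, ?_, ?_⟩
        · intro p hp
          rcases List.mem_cons.1 hp with rfl | hp
          · exact ⟨hz, hi⟩
          · exact h.ha p hp
        · intro i hi
          rw [u2 i (by norm_num; omega)]
          split_ifs with hij
          · subst hij
            have := Rp.single (n := n' + 1) (fun i' => es t (Bn B ((i / n, i % n) :: a).reverse i')) (i := n') (by omega)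
            rw [hB'] at this
            exact this.mono le_rfl (by norm_num) (fun _ _ => rfl)
          · exact (h.hU i (by omega)).mono (by omega) le_rfl hB
        · intro p hp
          obtain ⟨p1, p2, p3⟩ := h.hb p hp
          exact ⟨p1, p2, p3.mono (by omega) le_rfl hB⟩
      obtain ⟨n'', U', a', b', f1, f2⟩ := fin_spec h7 hn hT m (j + 1) _ _ _ _ (by omega) hFI
      refine ⟨n'', U', a', b', f1, fun k => ?_⟩
      rw [heq, if_pos h0, u3, f2]
    · have hv := hT.2 j (by norm_num; omega) h0
      rw [zero_add] at hv
      have hv' := Rp.apN h7' hv (by decide) (by omega) (by have := h.le; omega) h.sh h.hU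
      obtain ⟨U1, u1, u2, u3⟩ := set_spec 9 U j (apN U (T.get 9 j - 1)) h.sh (by norm_num; omega)
      have hFI : FI t n B (j + 1) n' U1 a ((j / n, j % n, apN U (T.get 9 j - 1)) :: b) := by
        refine ⟨u1, h.len, by have := h.le; omega, h.ha, ?_, ?_⟩
        · intro i hi
          rw [u2 i (by norm_num; omega)]
          split_ifs with hij
          · subst hij
            exact hv'
          · exact h.hU i (by omega)
        · intro p hp
          rcases List.mem_cons.1 hp with rfl | hp
          · exact ⟨hz, hi, hv'⟩
          · exact h.hb p hp
      obtain ⟨n'', U', a', b', f1, f2⟩ := fin_spec h7 hn hT m (j + 1) _ _ _ _ (by omega) hFI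
      refine ⟨n'', U', a', b', f1, fun k => ?_⟩
      rw [heq, if_neg h0, u3, f2]

theorem newl_spec (h7 : ∀ m : M, 7 • m = 0) {n n' : ℕ} (hn : n ≤ 250) (hn' : n' ≤ 512) {B : ℕ → Wd} {c : ℕ → {v : Wd // v ≠ []} → M} {tab plt : Tr} {z0 : Bool} (hs : Sh 9 tab)
    (hU : ∀ i < 2 * n, Rp n' c (tab.get 9 i) (es t (col n B i)) 6)
    (hp : ∀ i < n, Rp (2 * n) (fun j => et t (col n B j)) (plt.get 9 i) (et t (z0 :: B i)) 6) :
    ∀ (m i : ℕ) (T : Tr), i + m = n → Sh 9 T → (∀ j < i, Rp n' c (T.get 9 j) (es t (z0 :: B j)) 6) →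
    ∃ T', (∀ j < n, Rp n' c (T'.get 9 j) (es t (z0 :: B j)) 6) ∧ ∀ {α : Type} (k : Tr → α), newl tab plt m i T k = k T'
  | 0, i, T, hi, _, h => ⟨T, by rwa [← hi, add_zero], fun _ => rfl⟩
  | m+1, i, T, hi, hT, h => by
    have h7' : ∀ F : {v : Wd // v ≠ []} → M, 7 • F = 0 := fun F => funext fun v => h7 (F v)
    have a1 := (hp i (by omega)).map (res M)
    simp only [res_et] at a1
    have a2 := Rp.apN h7' a1 (by decide) (by omega) hn' hs hU
    obtain ⟨T1, u1, u2, u3⟩ := set_spec 9 T i (apN tab (plt.get 9 i)) hT (by norm_num; omega)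
    obtain ⟨T2, c1, c2⟩ := newl_spec h7 hn hn' hs hU hp m (i + 1) T1 (by omega) u1 (by
      intro j hj
      rw [u2 j (by norm_num; omega)]
      split_ifs with hij
      · subst hij; exact a2
      · exact h j (by omega))
    refine ⟨T2, c1, fun k => ?_⟩
    rw [← c2 k, ← u3 (fun T' => newl tab plt m (i + 1) T' k)]
    rfl

theorem nfw_append (w : Wd) (z : Bool) (x : ℕ × Tr) : ∀ (tabs : List (ℕ × Tr)) (V : ℕ), tabs.length = w.length →
    nfw (w ++ [z]) (tabs ++ [x]) V = ap x.2 9 (if z then nfw w tabs V * XX ^ x.1 else nfw w tabs V) 0 := by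
  induction w with
  | nil =>
    intro tabs V h
    obtain rfl : tabs = [] := List.length_eq_zero_iff.1 h
    show ap x.2 9 (bsel z (V * XX ^ x.1) V) 0 = _
    rw [bsel_eq]; rfl
  | cons y w ih =>
    intro tabs V h
    rcases tabs with _ | ⟨u, tabs⟩
    · simp at h
    · exact ih tabs _ (by simpa using h)

theorem step_spec (hc : ∀ u v, t (u ++ v) = t (v ++ u)) (h7 : ∀ m : M, 7 • m = 0) (hC : ∀ a : Fin 6 → Wd, (∀ i, a i ≠ []) → Cy t 5 a = 0) {m : ℕ} {s : St} {B B' : ℕ → Wd} {n' : ℕ} (hI : Inv t m s B n' B')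
    (rs : List (ℕ × ℕ × ℕ)) (gs : List (Wd × List Wd)) (hrs : ∀ r ∈ rs, relOK (m + 1) r) (hgs : ∀ r ∈ gs, r.1.length = m + 1 ∧ (∀ w ∈ r.2, w.length = m + 1) ∧ r.2.length ≤ 1)
    (k : St → Bool) (h : step s rs gs k = true) :
    ((∀ r ∈ gs, t r.1 = (r.2.map t).sum) → ∀ w : Wd, w.length = m + 1 → t w = 0) ∧ ∃ s' B₁ B₂ n₂, Inv t (m + 1) s' B₁ n₂ B₂ ∧ k s' = true := by
  have h7' : ∀ F : {v : Wd // v ≠ []} → M, 7 • F = 0 := fun F => funext fun v => h7 (F v)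
  unfold step at h
  rw [bsel_eq] at h
  split_ifs at h with hn
  rw [Nat.ble_eq] at hn
  obtain ⟨p0, s0, g0, -, e0⟩ := mkplt_spec s.n s.l0 s.npl 0 (Tr.full 9) (full_sh 9) (by rw [hI.len]; omega)
  obtain ⟨p1, s1, g1, -, e1⟩ := mkplt_spec s.n s.l1 s.npl 0 (Tr.full 9) (full_sh 9) (by rw [hI.len]; omega)
  rw [e0, e1] at h
  have hpp : ∀ (z0 : Bool) (lt p : Tr), (∀ i < n', Rp s.n (fun i => es t (B i)) (lt.get 9 i) (es t (z0 :: B' i)) 6) → (∀ j q, s.npl[j]? = some q → p.get 9 (0 + j) = lt.get 9 q.2 * XX ^ (q.1 * s.n)) →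
      ∀ i < s.n, Rp (2 * s.n) (fun j => et t (col s.n B j)) (p.get 9 i) (et t (z0 :: B i)) 6 := by
    intro z0 lt p hl hg i hi
    have hq : s.npl[i]? = some (s.npl[i]'(by rw [hI.len]; exact hi)) := List.getElem?_eq_getElem _
    obtain ⟨q1, q2, q3⟩ := hI.npl i _ hq
    have := hg i _ hq
    rw [zero_add] at this
    rw [this, q3]
    exact colR (hl _ q2) _ q1
  have hp0 := hpp false _ _ hI.l0 g0
  have hp1 := hpp true _ _ hI.l1 g1
  have hfull : Vd (fun j => et t (col s.n B j)) 9 0 (Tr.full 9) := ⟨full_sh 9, fun j _ h => absurd (full_get 9 j) h⟩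
  obtain ⟨T1, v1, e2⟩ := lrows_spec hc h7 hn s0 hI.l0 hp0 s.pvl hI.pvl _ hfull
  obtain ⟨T2, v2, e3⟩ := lrows_spec hc h7 hn s1 hI.l1 hp1 s.pvl hI.pvl _ v1
  rw [e2, e3, bsel_eq] at h
  split_ifs at h with hT
  constructor
  · intro hg
    have w1 := v2.map (ev0 M)
    simp only [ev0_et] at w1
    obtain ⟨T3, w3, e4⟩ := crows_spec (z := 0) hc h7 (by norm_num) hn (fun i hi => by have := (hp0 i hi).map (ev0 M); simp only [ev0_et] at this; exact this) s.n 0 (by omega) _ w1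
    obtain ⟨T4, w4, e5⟩ := crows_spec (z := 1) hc h7 (by norm_num) hn (fun i hi => by have := (hp1 i hi).map (ev0 M); simp only [ev0_et] at this; exact this) s.n 0 (by omega) _ w3
    obtain ⟨T5, w5, e6⟩ := grows_spec h7 hI hn gs (fun r hr => ⟨(hgs r hr).1, (hgs r hr).2.1, (hgs r hr).2.2, hg r hr⟩) _ w4
    rw [zero_mul] at e4
    rw [one_mul] at e5
    rw [e4, e5, e6] at hT
    have h5 := allp_spec T5 _ _ hT
    have h6 := all_zero w5 (n := 2 * s.n) (by omega) (fun j hj => h5 j (by omega) (by simpa using hj))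
    intro w hw
    have h8 := (wrow_spec hI w hw).map (ev0 M)
    simp only [ev0_et] at h8
    exact h8.eq_zero h6
  · have w1 := v2.map (res M)
    simp only [res_et] at w1
    obtain ⟨T3, w3, e4⟩ := srows_spec h7 hC hI hn rs hrs _ w1
    rw [e4] at h
    obtain ⟨n₁, U, a, b, hF, e5⟩ := fin_spec h7 hn w3 (2 * s.n) 0 0 (Tr.full 9) [] [] (by omega)
      ⟨full_sh 9, rfl, le_rfl, by simp, by simp, by simp⟩
    have e5' := e5 fun n' tab a b =>
      newl tab p0 s.n 0 (Tr.full 9) fun l0 => newl tab p1 s.n 0 (Tr.full 9) fun l1 =>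
      k ⟨n', s.tabs ++ [(s.n, tab)], l0, l1, a.reverse, b.reverse⟩
    have hle := hF.le
    obtain ⟨L0, x0, e6⟩ := newl_spec h7 hn (by omega) hF.sh hF.hU hp0 s.n 0 (Tr.full 9) (by omega) (full_sh 9) (by simp)
    obtain ⟨L1, x1, e7⟩ := newl_spec h7 hn (by omega) hF.sh hF.hU hp1 s.n 0 (Tr.full 9) (by omega) (full_sh 9) (by simp)
    rw [e6, e7] at e5'
    refine ⟨_, Bn B a.reverse, B, s.n, ?_, e5'.symm.trans h⟩
    refine ⟨by simp [hI.tl], ?_, x0, x1, by simp [hF.len], ?_, ?_⟩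
    · intro w hw
      have hne : w ≠ [] := by rintro rfl; simp at hw
      obtain ⟨w', z, rfl⟩ : ∃ w' z, w = w' ++ [z] := ⟨_, _, (List.dropLast_append_getLast hne).symm⟩
      have hw' : w'.length = m := by simpa using hw
      rw [nfw_append _ _ _ _ _ (by rw [hI.tl, hw'])]
      have h1 := hI.nf w' hw'
      have key : Rp (2 * s.n) (fun j => es t (col s.n B j)) (if z = true then nfw w' s.tabs 1 * XX ^ s.n else nfw w' s.tabs 1) (es t (w' ++ [z])) 18432 := by
        cases z
        · have := (colR h1 0 (by norm_num)).map (res M)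
          rw [zero_mul, pow_zero, mul_one] at this
          exact this
        · have := (colR h1 1 (by norm_num)).map (res M)
          rw [one_mul] at this
          exact this
      exact Rp.ap h7' key (by decide) (by omega) hF.sh hF.hU
    · intro i p hp
      have hm : p ∈ a := List.mem_reverse.1 (List.mem_of_getElem? hp)
      refine ⟨(hF.ha p hm).1, (hF.ha p hm).2, ?_⟩
      unfold Bn
      have : a.reverse.getD i (0, 0) = p := by rw [List.getD_eq_getElem?_getD]; simp only at hp; rw [hp]; rfl
      rw [this]
    · intro p hp
      exact hF.hb p (by simpa using hp)

theorem runN_spec (hc : ∀ u v, t (u ++ v) = t (v ++ u)) (h7 : ∀ m : M, 7 • m = 0) (hC : ∀ a : Fin 6 → Wd, (∀ i, a i ≠ []) → Cy t 5 a = 0) :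
    ∀ (L : List (List (ℕ × ℕ × ℕ) × List (Wd × List Wd))) (m : ℕ) (s : St) (B B' : ℕ → Wd) (n' : ℕ), Inv t m s B n' B' → runN L s = true →
    (∀ i p, L[i]? = some p → (∀ r ∈ p.1, relOK (m + 1 + i) r) ∧ ∀ r ∈ p.2, r.1.length = m + 1 + i ∧ (∀ w ∈ r.2, w.length = m + 1 + i) ∧ r.2.length ≤ 1) →
    (∀ i p, L[i]? = some p → (∀ r ∈ p.2, t r.1 = (r.2.map t).sum) → ∀ w : Wd, w.length = m + 1 + i → t w = 0) ∧ ∀ w : Wd, m + L.length < w.length → t w = 0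
  | [], m, s, B, B', n', hI, h, _ => by
    refine ⟨by simp, fun w hw => ?_⟩
    have h0 : s.n = 0 := Nat.eq_of_beq_eq_true h
    have h1 := (hI.nf (w.take m) (by simp at hw ⊢; omega)).eq_zero (by rw [h0]; intro j hj; omega)
    have h2 := congrFun h1 ⟨w.drop m, by simp at hw ⊢; omega⟩
    have h3 : t (w.take m ++ w.drop m) = 0 := h2
    rwa [List.take_append_drop] at h3
  | p :: L, m, s, B, B', n', hI, h, hok => by
    have hp := hok 0 p rfl
    obtain ⟨h1, s', B₁, B₂, n₂, h2, h3⟩ := step_spec hc h7 hC hI p.1 p.2 hp.1 hp.2 (runN L) h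
    obtain ⟨h4, h5⟩ := runN_spec hc h7 hC L (m + 1) s' B₁ B₂ n₂ h2 h3 (by
      intro i q hq
      have := hok (i + 1) q (by simpa using hq)
      rwa [show m + 1 + (i + 1) = m + 1 + 1 + i by omega] at this)
    refine ⟨?_, fun w hw => h5 w (by rw [List.length_cons] at hw; omega)⟩
    intro i q hq hg w hw
    rcases i with _ | i
    · simp only [List.getElem?_cons_zero, Option.some.injEq] at hq
      subst hq
      exact h1 hg w hw
    · exact h4 i q (by simpa using hq) hg w (by omega)

theorem st1_Inv : Inv t 1 st1 (fun i => [bz i]) 1 (fun _ => []) := by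
  have hX : ∀ w : Wd, w.length = 1 → w = [false] ∨ w = [true] := by
    intro w hw
    obtain ⟨b, rfl⟩ := List.length_eq_one_iff.1 hw
    cases b <;> simp
  have a0 : Rp 2 (fun i => es t [bz i]) 1 (es t [false]) 6 := by
    have := Rp.single (n := 2) (fun i => es t [bz i]) (i := 0) (by norm_num)
    exact this.mono le_rfl (by norm_num) (fun _ _ => rfl)
  have a1 : Rp 2 (fun i => es t [bz i]) XX (es t [true]) 6 := by
    have := Rp.single (n := 2) (fun i => es t [bz i]) (i := 1) (by norm_num)
    rw [pow_one] at this
    exact this.mono le_rfl (by norm_num) (fun _ _ => rfl)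
  refine ⟨rfl, ?_, ?_, ?_, rfl, ?_, by intro p hp; exact absurd hp List.not_mem_nil⟩
  · intro w hw
    rcases hX w hw with rfl | rfl
    · have : nfw [false] st1.tabs 1 = 1 := by decide +kernel
      rw [this]; exact a0.mono le_rfl (by norm_num) (fun _ _ => rfl)
    · have : nfw [true] st1.tabs 1 = XX := by decide +kernel
      rw [this]; exact a1.mono le_rfl (by norm_num) (fun _ _ => rfl)
  · intro i hi
    obtain rfl : i = 0 := by omega
    have : st1.l0.get 9 0 = 1 := by decide +kernel
    rw [this]; exact a0
  · intro i hi
    obtain rfl : i = 0 := by omega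
    have : st1.l1.get 9 0 = XX := by decide +kernel
    rw [this]; exact a1
  · intro i p hp
    have : st1.npl = [(0,0),(1,0)] := rfl
    rw [this] at hp
    rcases i with _ | _ | i
    · simp at hp; subst hp; exact ⟨by norm_num, by norm_num, rfl⟩
    · simp at hp; subst hp; exact ⟨by norm_num, by norm_num, rfl⟩
    · simp at hp
end
end C520

namespace C520

instance (d : ℕ) (r : ℕ × ℕ × ℕ) : Decidable (relOK d r) := by unfold relOK; infer_instance

theorem data_ok : ∀ i ∈ List.range 14, ∀ p ∈ (allData.take 14)[i]?, (∀ r ∈ p.1, relOK (2 + i) r) ∧ ∀ r ∈ p.2, r.1.length = 2 + i ∧ (∀ w ∈ r.2, w.length = 2 + i) ∧ r.2.length ≤ 1 := by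
  decide +kernel

theorem data_len : (allData.take 14).length = 14 := by decide +kernel

theorem data_gens : ∀ i ∈ List.range 14, ∃ p ∈ (allData.take 14)[i]?, p.2 = gensAt (2 + i) := by
  have h : ∀ i ∈ List.range 14, (((allData.take 14)[i]?).map fun p => p.2) = some (gensAt (2 + i)) := by
    decide +kernel
  intro i hi
  have := h i hi
  rw [Option.map_eq_some_iff] at this
  exact this

theorem gen7 {M : Type*} [AddCommGroup M] (t : Wd → M) (hc : ∀ u v, t (u ++ v) = t (v ++ u)) (h7 : ∀ m : M, 7 • m = 0) (hC : ∀ a : Fin 6 → Wd, (∀ i, a i ≠ []) → Cy t 5 a = 0)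
    (d : ℕ) (hd : 2 ≤ d) (hg : ∀ r ∈ gensAt d, t r.1 = (r.2.map t).sum) (w : Wd) (hw : w.length = d) : t w = 0 := by
  obtain ⟨h1, h2⟩ := runN_spec hc h7 hC (allData.take 14) 1 st1 _ _ _ st1_Inv heavy.1 (by
    intro i p hp
    have hi : i < 14 := by
      have := (List.getElem?_eq_some_iff.1 hp).1
      rwa [data_len] at this
    exact data_ok i (List.mem_range.2 hi) p hp)
  rw [data_len] at h2
  by_cases h : d < 16
  · obtain ⟨p, hp, e⟩ := data_gens (d - 2) (List.mem_range.2 (by omega))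
    refine h1 (d - 2) p hp ?_ w (by omega)
    rw [e, show 2 + (d - 2) = d by omega]
    exact hg
  · exact h2 w (by omega)

end C520

namespace C520

theorem Cy_map {M M' : Type*} [AddCommGroup M] [AddCommGroup M'] (f : M →+ M') (t : Wd → M) : ∀ (n : ℕ) (a : Fin (n+1) → Wd), f (Cy t n a) = Cy (fun w => f (t w)) n a
  | 0, a => rfl
  | n+1, a => by
    unfold Cy
    rw [map_sum]
    exact Finset.sum_congr rfl fun r _ => Cy_map f t n _

theorem Cy_congr {M : Type*} [AddCommGroup M] (t t' : Wd → M) (L : ℕ) (h : ∀ w : Wd, w.length = L → t w = t' w) : ∀ (n : ℕ) (a : Fin (n+1) → Wd), ∑ i, (a i).length = L → Cy t n a = Cy t' n a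
  | 0, a, ha => h _ (by simpa using ha)
  | n+1, a, ha => by
    unfold Cy
    exact Finset.sum_congr rfl fun r _ => Cy_congr t t' L h n _ ((glue_sum a r).trans ha)

theorem Cy_zero {M : Type*} [AddCommGroup M] : ∀ (n : ℕ) (a : Fin (n+1) → Wd), Cy (fun _ => (0 : M)) n a = 0
  | 0, _ => rfl
  | n+1, a => by
    unfold Cy
    exact Finset.sum_eq_zero fun r _ => Cy_zero n _

theorem lift0 {V : Type*} [AddCommGroup V] (htf : ∀ (n : ℤ) (v : V), n ≠ 0 → n • v = 0 → v = 0) (t : Wd → V) (hc : ∀ u v, t (u ++ v) = t (v ++ u))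
    (hC : ∀ a : Fin 6 → Wd, (∀ i, a i ≠ []) → Cy t 5 a = 0) (d : ℕ) (hd : 2 ≤ d) (hs : ∀ w, w.length ≠ d → t w = 0)
    (hg : ∀ r ∈ gensAt d, t r.1 = (r.2.map t).sum) (w : Wd) : t w = 0 := by
  have hfin : (t '' {w | w.length = d}).Finite := (List.finite_length_eq Bool d).image t
  let N : Submodule ℤ V := Submodule.span ℤ (t '' {w | w.length = d})
  have hN : ∀ w, t w ∈ N := fun w => by
    by_cases h : w.length = d
    · exact Submodule.subset_span ⟨w, h, rfl⟩
    · rw [hs w h]; exact N.zero_mem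
  have hfg : (⊤ : Submodule ℤ N).FG := by
    have : N.FG := Submodule.fg_span hfin
    exact Module.finite_def.1 (Module.Finite.iff_fg.2 this)
  let t' : Wd → N := fun w => ⟨t w, hN w⟩
  let P : Submodule ℤ N := (Ideal.span {(7:ℤ)}) • ⊤
  let f : N →+ (N ⧸ P) := P.mkQ.toAddMonoidHom
  have hC' : ∀ a : Fin 6 → Wd, (∀ i, a i ≠ []) → Cy t' 5 a = 0 := by
    intro a ha
    apply Subtype.coe_injective
    have := Cy_map N.subtype.toAddMonoidHom t' 5 a
    exact this.trans (hC a ha)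
  have key := gen7 (fun w => f (t' w)) (fun u v => by
      show f (t' _) = f (t' _)
      congr 1; exact Subtype.ext (hc u v))
    (fun m => by
      obtain ⟨x, rfl⟩ := P.mkQ_surjective m
      rw [← map_nsmul]
      apply (Submodule.Quotient.mk_eq_zero P).2
      have := Submodule.smul_mem_smul (Ideal.mem_span_singleton_self (7:ℤ)) (Submodule.mem_top (R := ℤ) (x := x))
      have e : (7:ℕ) • x = (7:ℤ) • x := by norm_cast
      rw [e]; exact this)
    (fun a ha => by
      have := Cy_map f t' 5 a
      rw [← this, hC' a ha, map_zero]) d hd (fun r hr => by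
      have h1 : t' r.1 = (r.2.map t').sum := by
        apply Subtype.coe_injective
        have := map_sum_list N.subtype.toAddMonoidHom t' r.2
        exact (hg r hr).trans this.symm
      rw [h1, map_sum_list])
  have hle : (⊤ : Submodule ℤ N) ≤ Ideal.span {(7:ℤ)} • ⊤ := by
    have h0 : ∀ w : Wd, w.length = d → t' w ∈ P := fun w hw => (Submodule.Quotient.mk_eq_zero P).1 (key w hw)
    have h1 : N ≤ P.map N.subtype := by
      apply Submodule.span_le.2
      rintro _ ⟨w, hw, rfl⟩
      exact ⟨t' w, h0 w hw, rfl⟩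
    intro x _
    obtain ⟨y, hy, e⟩ := h1 x.2
    rwa [← Subtype.coe_injective e]
  obtain ⟨r, hr, h⟩ := Submodule.exists_sub_one_mem_and_smul_eq_zero_of_fg_of_le_smul _ _ hfg hle
  have hr0 : r ≠ 0 := by
    rintro rfl
    rw [Ideal.mem_span_singleton] at hr
    omega
  exact htf r (t w) hr0 (congrArg Subtype.val (h (t' w) trivial))

section
variable {K : Type*} [Field K]

theorem fw_cyc (u v : Wd) : fw (K := K) (u ++ v) = fw (v ++ u) := by
  funext x
  unfold fw
  rw [ev_append, ev_append, trace_mul_comm]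

theorem fw_ev (w : Wd) : (ev (R := sl K 5 × sl K 5 → K) (fun i j v => v.1.1 i j) (fun i j v => v.2.1 i j) w).trace = fw (K := K) w := by
  funext v
  have h := tr_map (Pi.evalRingHom (fun _ : sl K 5 × sl K 5 => K) v) (ev (R := sl K 5 × sl K 5 → K) (fun i j v => v.1.1 i j) (fun i j v => v.2.1 i j) w)
  have h2 := ev_map (Pi.evalRingHom (fun _ : sl K 5 × sl K 5 => K) v) (fun i j v => v.1.1 i j) (fun i j v => v.2.1 i j) w
  unfold fw
  rw [h2] at h
  exact h.symm

theorem fw_one (b : Bool) : fw (K := K) [b] = 0 := by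
  funext v
  have h1 : (v.1 : Matrix (Fin 5) (Fin 5) K).trace = 0 := v.1.2
  have h2 : (v.2 : Matrix (Fin 5) (Fin 5) K).trace = 0 := v.2.2
  cases b <;> simp [fw, ev, h1, h2]

theorem fw_mem [CharZero K] (A : Subalgebra K (sl K 5 × sl K 5 → K)) (hA : ∀ d, ∀ r ∈ gensAt d, fw (K := K) r.1 - (r.2.map fw).sum ∈ A) :
    ∀ (d : ℕ) (w : Wd), w.length = d → fw (K := K) w ∈ A := by
  intro d
  induction d using Nat.strong_induction_on with
  | _ d ih =>
  by_cases h0 : d < 2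
  · intro w hw
    match w with
    | [] =>
      have : fw (K := K) [] = algebraMap K _ 5 := by
        funext v
        simp [fw, ev]
      rw [this]; exact A.algebraMap_mem _
    | [b] => rw [fw_one]; exact A.zero_mem
    | _ :: _ :: _ => simp at hw; omega
  let N : AddSubgroup (sl K 5 × sl K 5 → K) := A.toSubmodule.toAddSubgroup
  let t0 : Wd → (sl K 5 × sl K 5 → K) ⧸ N := fun w => QuotientAddGroup.mk (fw w)
  let t : Wd → (sl K 5 × sl K 5 → K) ⧸ N := fun w => if w.length = d then t0 w else 0
  have key := lift0 (t := t) (by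
      intro n v hn hv
      induction v using QuotientAddGroup.induction_on with
      | H x =>
      rw [← QuotientAddGroup.mk_zsmul, QuotientAddGroup.eq_zero_iff] at hv
      rw [QuotientAddGroup.eq_zero_iff]
      have h1 : ((n:K)⁻¹) • (n • x) ∈ A := A.smul_mem hv _
      have h2 : ((n:K)⁻¹) • (n • x) = x := by
        rw [← Int.cast_smul_eq_zsmul K, smul_smul, inv_mul_cancel₀ (by exact_mod_cast hn), one_smul]
      rw [h2] at h1
      exact h1)
    (by
      intro u v
      simp only [t, t0, fw_cyc u v, List.length_append, add_comm])
    (by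
      intro a ha
      by_cases hL : ∑ i, (a i).length = d
      · rw [Cy_congr t t0 d (fun w hw => if_pos hw) 5 a hL]
        have := Cy_tr (R := sl K 5 × sl K 5 → K) (fun i j v => v.1.1 i j) (fun i j v => v.2.1 i j) A.toSubring N (fun x hx => hx) d
          (fun w hw hl => by rw [fw_ev]; exact ih _ hl w rfl) le_rfl a ha hL
        simp only [fw_ev] at this
        exact this
      · rw [Cy_congr t (fun _ => 0) _ (fun w hw => if_neg fun h => hL (hw.symm.trans h)) 5 a rfl, Cy_zero])
    d (by omega) (fun w hw => if_neg hw)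
    (by
      intro r hr
      have hl : r.1.length = d ∧ ∀ w ∈ r.2, w.length = d := by
        unfold gensAt at hr
        simp only [List.mem_append, List.mem_map, List.mem_filter, List.mem_flatMap, beq_iff_eq] at hr
        rcases hr with (⟨w, ⟨_, h⟩, rfl⟩ | ⟨w, ⟨_, h⟩, rfl⟩) | ⟨w, ⟨_, h⟩, hw⟩
        · simp [h]
        · simp [h, swp]
        · simp only [List.mem_cons, List.not_mem_nil, or_false] at hw
          rcases hw with rfl | rfl <;> simp [h, swp]
      have e1 : t r.1 = t0 r.1 := if_pos hl.1
      have e2 : r.2.map t = r.2.map t0 := List.map_congr_left fun w hw => if_pos (hl.2 w hw)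
      rw [e1, e2]
      have e3 := map_sum_list (QuotientAddGroup.mk' N) fw r.2
      have e4 : (QuotientAddGroup.mk' N) (fw r.1) = (QuotientAddGroup.mk' N) (r.2.map fw).sum := by
        rw [← sub_eq_zero, ← map_sub]
        exact (QuotientAddGroup.eq_zero_iff _).2 (hA d r hr)
      exact e4.trans e3)
  intro w hw
  have h1 := key w
  have e1 : t w = t0 w := if_pos hw
  rw [e1] at h1
  exact (QuotientAddGroup.eq_zero_iff _).1 h1
end
end C520

namespace C520

section
variable {K : Type*} [Field K]

def fg (g : Wd × Bool) : sl K 5 × sl K 5 → K := fw g.1 - if g.2 then fw (swp g.1) else 0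

theorem ev_rep {n : ℕ} {R : Type*} [CommRing R] (X Y : Matrix (Fin n) (Fin n) R) (b : Bool) (k : ℕ) : ev X Y (List.replicate k b) = (bif b then Y else X) ^ k := by
  simp [ev]

theorem wordEval_eq {n : ℕ} (l : List (ℕ × ℕ)) (A B : Matrix (Fin n) (Fin n) K) : wordEval l A B = ev A B (expd l) := by
  induction l with
  | nil => rfl
  | cons p l ih =>
    have e : expd (p :: l) = List.replicate p.1 false ++ List.replicate p.2 true ++ expd l := rfl
    rw [e, ev_append, ev_append, ev_rep, ev_rep, ← ih]
    simp [wordEval]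

theorem ev_swp {n : ℕ} {R : Type*} [CommRing R] (X Y : Matrix (Fin n) (Fin n) R) (w : Wd) : ev X Y (swp w) = ev Y X w := by
  unfold ev swp
  rw [List.map_map]
  congr 1
  apply List.map_congr_left
  intro b _
  cases b <;> rfl

theorem wordTr_eq (l : List (ℕ × ℕ)) : (wordTr l : sl K 5 × sl K 5 → K) = fw (expd l) := by
  funext v; unfold wordTr fw; rw [wordEval_eq]

theorem wordTrSwap_eq (l : List (ℕ × ℕ)) : (wordTrSwap l : sl K 5 × sl K 5 → K) = fw (swp (expd l)) := by
  funext v; unfold wordTrSwap fw; rw [wordEval_eq, ev_swp]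

theorem fw_swap (w : Wd) (v : sl K 5 × sl K 5) : fw w (v.2, v.1) = fw (swp w) v := by
  unfold fw; rw [ev_swp]

theorem swp_swp (w : Wd) : swp (swp w) = w := by
  unfold swp; rw [List.map_map, show (not ∘ not) = id from funext Bool.not_not, List.map_id]

def LS : List (Wd × Bool) := symWords.map fun l => (expd l, false)
def LK : List (Wd × Bool) := skewWords.map fun l => (expd l, true)
def LD : List (Wd × Bool) := words81.map fun l => (expd l, false)
def LE : List (Wd × Bool) := words81.map fun l => (swp (expd l), false)

theorem mem_GLs (g : Wd × Bool) : g ∈ GLs ↔ g ∈ LS ∨ g ∈ LK ∨ g ∈ LD ∨ g ∈ LE := by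
  simp only [GLs, LS, LK, LD, LE, List.mem_append, List.mem_flatMap, List.mem_map, List.mem_cons, List.not_mem_nil, or_false]
  constructor
  · rintro ((h | h) | ⟨l, h, h1 | h1⟩)
    · exact Or.inl h
    · exact Or.inr (Or.inl h)
    · exact Or.inr (Or.inr (Or.inl ⟨l, h, h1.symm⟩))
    · exact Or.inr (Or.inr (Or.inr ⟨l, h, h1.symm⟩))
  · rintro (h | h | ⟨l, h, h1⟩ | ⟨l, h, h1⟩)
    · exact Or.inl (Or.inl h)
    · exact Or.inl (Or.inr h)
    · exact Or.inr ⟨l, h, Or.inl h1.symm⟩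
    · exact Or.inr ⟨l, h, Or.inr h1.symm⟩

theorem img_eq (f : List (ℕ × ℕ) → sl K 5 × sl K 5 → K) (W : List (List (ℕ × ℕ))) (g : List (ℕ × ℕ) → Wd × Bool) (h : ∀ l, f l = fg (g l)) :
    f '' {l | l ∈ W} = fg '' {x | x ∈ W.map g} := by
  ext y
  simp only [Set.mem_image, Set.mem_ofPred_eq, List.mem_map]
  constructor
  · rintro ⟨l, hl, rfl⟩; exact ⟨g l, ⟨l, hl, rfl⟩, (h l).symm⟩
  · rintro ⟨_, ⟨l, hl, rfl⟩, rfl⟩; exact ⟨l, hl, h l⟩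

theorem gensS_eq : gensS K = fg '' {x | x ∈ LS} := img_eq _ _ _ fun l => by simp [fg, wordTr_eq]
theorem gensK_eq : gensK K = fg '' {x | x ∈ LK} := img_eq _ _ _ fun l => by simp [fg, wordTr_eq, wordTrSwap_eq]
theorem gensD_eq : gensD K = fg '' {x | x ∈ LD} := img_eq _ _ _ fun l => by simp [fg, wordTr_eq]
theorem gensE_eq : gensD' K = fg '' {x | x ∈ LE} := img_eq _ _ _ fun l => by simp [fg, wordTrSwap_eq]
theorem gensP_eq : gensP K = fg '' {x | x ∈ GLs} := by
  unfold gensP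
  rw [gensS_eq, gensK_eq, gensD_eq, gensE_eq, ← Set.image_union, ← Set.image_union, ← Set.image_union]
  congr 1
  ext g
  simp [mem_GLs, or_assoc]

theorem GLs_len : ∀ g ∈ GLs, 2 ≤ g.1.length ∧ g.1.length ≤ 15 := by decide +kernel

theorem fg_dual [CharZero K] (g : Wd × Bool) (hg : g ∈ GLs) :
    ∃ Z : Subalgebra K (sl K 5 × sl K 5 → K), fg g ∉ Z ∧ ∀ g' ∈ GLs, g' ≠ g → fg g' ∈ Z := by
  obtain ⟨l2, l15⟩ := GLs_len g hg
  obtain ⟨D, F, V, h2, h16, hdD, hD, hF, hV, hp, hC⟩ := heavy.2 g.1.length l2 l15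
  obtain ⟨φ, hc, hCy, hs, h1, h0⟩ := dual_exists (K := K) h2 h16 hdD hD hF hV hC hp g hg rfl
  obtain ⟨Z, hZ⟩ := exists_Z φ hc hCy _ (fun w hw => (hs w hw).1) h2
  have key : ∀ g' ∈ GLs, (fg g' ∈ Z ↔ gval φ g' = 0) := by
    intro g' hg'
    have hne : g'.1 ≠ [] := by
      intro h
      have := (GLs_len g' hg').1
      rw [h] at this; simp at this
    have hne2 : swp g'.1 ≠ [] := by simpa [swp] using hne
    have := hZ g'.1 (swp g'.1) 1 (if g'.2 then -1 else 0) hne hne2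
    have e1 : (1:K) • fw (K := K) g'.1 + (if g'.2 then (-1:K) else 0) • fw (swp g'.1) = fg (K := K) g' := by
      unfold fg; cases g'.2 <;> simp [sub_eq_add_neg]
    have e2 : (1:K) * φ g'.1 + (if g'.2 then (-1:K) else 0) * φ (swp g'.1) = gval φ g' := by
      unfold gval; cases g'.2 <;> simp [sub_eq_add_neg]
    rw [e1, e2] at this
    exact this
  exact ⟨Z, fun h => h1 ((key g hg).1 h), fun g' hg' hn => (key g' hg').2 (h0 g' hg' hn)⟩

theorem fg_inj [CharZero K] : Set.InjOn (fg (K := K)) {x | x ∈ GLs} := by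
  intro g hg g' hg' h
  by_contra hn
  obtain ⟨Z, h1, h2⟩ := fg_dual (K := K) g hg
  exact h1 (h ▸ h2 g' hg' (Ne.symm hn))

theorem fg_card [CharZero K] (L : List (Wd × Bool)) (hL : ∀ x ∈ L, x ∈ GLs) (hN : L.Nodup) : (fg (K := K) '' {x | x ∈ L}).ncard = L.length := by
  have hi : Set.InjOn (fg (K := K)) {x | x ∈ L} := fun x hx y hy h => fg_inj (hL x hx) (hL y hy) h
  rw [hi.ncard_image]
  have : {x | x ∈ L} = (L.toFinset : Set (Wd × Bool)) := by ext; simp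
  rw [this, Set.ncard_coe_finset, List.toFinset_card_of_nodup hN]

theorem fw_bih (w : Wd) : BiHomogFun0 (fw (K := K) w) (w.count false) (w.count true) := by
  intro c d v
  have h : ev (c • (v.1 : Matrix (Fin 5) (Fin 5) K)) (d • (v.2 : Matrix (Fin 5) (Fin 5) K)) w = (c ^ w.count false * d ^ w.count true) • ev (v.1 : Matrix (Fin 5) (Fin 5) K) v.2 w := by
    induction w with
    | nil => simp [ev]
    | cons b w ih =>
      rw [ev_cons, ev_cons, ih]
      cases b
      · simp [smul_smul, pow_succ]; congr 1; ring
      · simp [smul_smul, pow_succ]; congr 1; ring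
  show (ev (c • (v.1 : Matrix (Fin 5) (Fin 5) K)) (d • (v.2 : Matrix (Fin 5) (Fin 5) K)) w).trace = _
  rw [h, trace_smul]; rfl

theorem skew_cnt : ∀ g ∈ GLs, g.2 = true → (swp g.1).count false = g.1.count false ∧ (swp g.1).count true = g.1.count true := by decide +kernel

theorem sym_rot : ∀ g ∈ LS, ∃ k ∈ List.range 5, swp g.1 = g.1.drop k ++ g.1.take k := by decide +kernel

theorem fg_bih (g : Wd × Bool) (hg : g ∈ GLs) : BiHomogFun0 (fg (K := K) g) (g.1.count false) (g.1.count true) := by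
  intro c d v
  have h1 := fw_bih (K := K) g.1 c d v
  unfold fg
  by_cases h : g.2 = true
  · have h2 := fw_bih (K := K) (swp g.1) c d v
    rw [(skew_cnt g hg h).1, (skew_cnt g hg h).2] at h2
    simp only [h, if_true, Pi.sub_apply, h1, h2, mul_sub]
  · simp [h, h1]

theorem fw_pure (w : Wd) : fw (K := K) w ∈ pureAlg0 K 5 := by
  refine ⟨⟨(ev (Matrix.of fun i j => (MvPolynomial.X (Sum.inl (i, j)) : MvPolynomial (MatVar 5) K)) (Matrix.of fun i j => MvPolynomial.X (Sum.inr (i, j))) w).trace, fun v => ?_⟩, fun a v => ?_⟩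
  · rw [← tr_map, ev_map]
    unfold fw
    congr 2
    · ext i j; simp [pairSub]
    · ext i j; simp [pairSub]
  · have h1 : ((a⁻¹ : GL (Fin 5) K) : Matrix (Fin 5) (Fin 5) K) * (a : Matrix (Fin 5) (Fin 5) K) = 1 := a.inv_mul
    have h2 : (a : Matrix (Fin 5) (Fin 5) K) * ((a⁻¹ : GL (Fin 5) K) : Matrix (Fin 5) (Fin 5) K) = 1 := a.mul_inv
    have h : ev (glConj a v.1 : Matrix (Fin 5) (Fin 5) K) (glConj a v.2) w = (a : Matrix (Fin 5) (Fin 5) K) * ev (v.1 : Matrix (Fin 5) (Fin 5) K) v.2 w * ((a⁻¹ : GL (Fin 5) K) : Matrix (Fin 5) (Fin 5) K) := by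
      induction w with
      | nil => rw [ev_nil, ev_nil, mul_one, h2]
      | cons b w ih =>
        have e : ∀ P Q : Matrix (Fin 5) (Fin 5) K, (a : Matrix (Fin 5) (Fin 5) K) * P * ((a⁻¹ : GL (Fin 5) K) : Matrix (Fin 5) (Fin 5) K) * ((a : Matrix (Fin 5) (Fin 5) K) * Q * ((a⁻¹ : GL (Fin 5) K) : Matrix (Fin 5) (Fin 5) K)) = (a : Matrix (Fin 5) (Fin 5) K) * (P * Q) * ((a⁻¹ : GL (Fin 5) K) : Matrix (Fin 5) (Fin 5) K) := by
          intro P Q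
          calc _ = (a : Matrix (Fin 5) (Fin 5) K) * P * (((a⁻¹ : GL (Fin 5) K) : Matrix (Fin 5) (Fin 5) K) * (a : Matrix (Fin 5) (Fin 5) K)) * Q * ((a⁻¹ : GL (Fin 5) K) : Matrix (Fin 5) (Fin 5) K) := by simp only [mul_assoc]
            _ = _ := by rw [h1]; simp only [mul_assoc, one_mul]
        rw [ev_cons, ev_cons, ih]
        cases b
        · exact e _ _
        · exact e _ _
    unfold fw
    rw [h, trace_mul_cycle, h1, one_mul]

theorem fg_pure (g : Wd × Bool) : fg (K := K) g ∈ pureAlg0 K 5 := by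
  unfold fg
  refine sub_mem (fw_pure _) ?_
  split_ifs
  · exact fw_pure _
  · exact zero_mem _

theorem LD_swp (g : Wd × Bool) (h : g ∈ LD ∨ g ∈ LE) : g.2 = false ∧ g ∈ GLs ∧ (swp g.1, false) ∈ GLs := by
  simp only [mem_GLs]
  rcases h with h | h
  · obtain ⟨l, hl, rfl⟩ := List.mem_map.1 h
    exact ⟨rfl, Or.inr (Or.inr (Or.inl h)), Or.inr (Or.inr (Or.inr (List.mem_map.2 ⟨l, hl, rfl⟩)))⟩
  · obtain ⟨l, hl, rfl⟩ := List.mem_map.1 h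
    exact ⟨rfl, Or.inr (Or.inr (Or.inr h)), Or.inr (Or.inr (Or.inl (List.mem_map.2 ⟨l, hl, by rw [swp_swp]⟩)))⟩

theorem swp_ne : ∀ w : Wd, w ≠ [] → swp w ≠ w
  | [], h => absurd rfl h
  | b :: w, _ => by simp [swp]

theorem fg_nonsym [CharZero K] (g : Wd × Bool) (h : g ∈ LD ∨ g ∈ LE) : ¬ IsSymmFun0 (fg (K := K) g) ∧ ¬ IsSkewFun0 (fg (K := K) g) := by
  obtain ⟨h1, h2, h3⟩ := LD_swp g h
  have hne : g.1 ≠ [] := by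
    intro h
    have := (GLs_len g h2).1
    rw [h] at this; simp at this
  have hn : (swp g.1, false) ≠ g := fun e => swp_ne _ hne (congrArg Prod.fst e)
  obtain ⟨Z, z1, z2⟩ := fg_dual (K := K) g h2
  have z3 := z2 _ h3 hn
  have e1 : fg (K := K) g = fw g.1 := by simp [fg, h1]
  have e2 : fg (K := K) (swp g.1, false) = fw (swp g.1) := by simp [fg]
  rw [e1] at z1 ⊢
  rw [e2] at z3
  constructor
  · intro hs
    apply z1
    have : fw (K := K) g.1 = fw (swp g.1) := by
      funext v; rw [← fw_swap]; exact (hs v).symm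
    rw [this]; exact z3
  · intro hs
    apply z1
    have : fw (K := K) g.1 = - fw (swp g.1) := by
      funext v
      have := hs v
      rw [fw_swap] at this
      simp [this]
    rw [this]; exact neg_mem z3

theorem adj_eq [CharZero K] : Algebra.adjoin K (gensP K) = pureAlg0 K 5 := by
  apply le_antisymm
  · apply Algebra.adjoin_le
    rw [gensP_eq]
    rintro _ ⟨g, _, rfl⟩
    exact fg_pure g
  · intro f hf
    have h1 := FFT f hf
    refine Algebra.adjoin_le ?_ h1
    rintro _ ⟨w, _, rfl⟩
    refine fw_mem _ ?_ _ w rfl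
    intro d r hr
    have key : ∀ g ∈ GLs, fg (K := K) g ∈ Algebra.adjoin K (gensP K) := fun g hg => Algebra.subset_adjoin (by rw [gensP_eq]; exact ⟨g, hg, rfl⟩)
    unfold gensAt at hr
    simp only [List.mem_append, List.mem_map, List.mem_filter, List.mem_flatMap, beq_iff_eq] at hr
    rcases hr with (⟨_, ⟨⟨l, hl, rfl⟩, _⟩, rfl⟩ | ⟨_, ⟨⟨l, hl, rfl⟩, _⟩, rfl⟩) | ⟨_, ⟨⟨l, hl, rfl⟩, _⟩, hw⟩
    · have := key (expd l, false) ((mem_GLs _).2 (Or.inl (List.mem_map.2 ⟨l, hl, rfl⟩)))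
      simpa [fg] using this
    · have := key (expd l, true) ((mem_GLs _).2 (Or.inr (Or.inl (List.mem_map.2 ⟨l, hl, rfl⟩))))
      simpa [fg] using this
    · simp only [List.mem_cons, List.not_mem_nil, or_false] at hw
      rcases hw with rfl | rfl
      · have := key (expd l, false) ((mem_GLs _).2 (Or.inr (Or.inr (Or.inl (List.mem_map.2 ⟨l, hl, rfl⟩)))))
        simpa [fg] using this
      · have := key (swp (expd l), false) ((mem_GLs _).2 (Or.inr (Or.inr (Or.inr (List.mem_map.2 ⟨l, hl, rfl⟩)))))
        simpa [fg] using this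

theorem nodups : GLs.Nodup ∧ LS.Nodup ∧ LK.Nodup ∧ LD.Nodup ∧ LE.Nodup ∧ GLs.length = 171 ∧ LS.length = 5 ∧ LK.length = 4 ∧ LD.length = 81 ∧ LE.length = 81 := by
  decide +kernel
end

theorem main (K : Type*) [Field K] [CharZero K] :
    (gensP K).ncard = 171 ∧
    (gensS K).ncard = 5 ∧ (gensK K).ncard = 4 ∧
    (gensD K).ncard = 81 ∧ (gensD' K).ncard = 81 ∧
    (∀ f ∈ gensP K, ∃ p q : ℕ, BiHomogFun0 f p q) ∧
    (∀ f ∈ gensS K, IsSymmFun0 f) ∧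
    (∀ f ∈ gensK K, IsSkewFun0 f) ∧
    (∀ f ∈ gensD K ∪ gensD' K, ¬ IsSymmFun0 f ∧ ¬ IsSkewFun0 f) ∧
    Set.BijOn (fun f : sl K 5 × sl K 5 → K => fun v : sl K 5 × sl K 5 => f (v.2, v.1))
      (gensD K) (gensD' K) ∧
    Algebra.adjoin K (gensP K) = pureAlg0 K 5 ∧
    (∀ T : Set (sl K 5 × sl K 5 → K), T ⊂ gensP K →
      Algebra.adjoin K T ≠ pureAlg0 K 5) := by
  obtain ⟨n1, n2, n3, n4, n5, l1, l2, l3, l4, l5⟩ := nodups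
  refine ⟨?_, ?_, ?_, ?_, ?_, ?_, ?_, ?_, ?_, ?_, adj_eq, ?_⟩
  · rw [gensP_eq, fg_card _ (fun x h => h) n1, l1]
  · rw [gensS_eq, fg_card _ (fun x h => (mem_GLs x).2 (by simp [h])) n2, l2]
  · rw [gensK_eq, fg_card _ (fun x h => (mem_GLs x).2 (by simp [h])) n3, l3]
  · rw [gensD_eq, fg_card _ (fun x h => (mem_GLs x).2 (by simp [h])) n4, l4]
  · rw [gensE_eq, fg_card _ (fun x h => (mem_GLs x).2 (by simp [h])) n5, l5]
  · rw [gensP_eq]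
    rintro _ ⟨g, hg, rfl⟩
    exact ⟨_, _, fg_bih g hg⟩
  · rw [gensS_eq]
    rintro _ ⟨g, hg, rfl⟩ v
    obtain ⟨k, _, hk⟩ := sym_rot g hg
    have e1 : fg (K := K) g = fw g.1 := by
      obtain ⟨l, _, rfl⟩ := List.mem_map.1 hg
      simp [fg]
    rw [e1, fw_swap, hk, fw_cyc, List.take_append_drop]
  · rw [gensK_eq]
    rintro _ ⟨g, hg, rfl⟩ v
    have e1 : fg (K := K) g = fw g.1 - fw (swp g.1) := by
      obtain ⟨l, _, rfl⟩ := List.mem_map.1 hg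
      simp [fg]
    rw [e1, Pi.sub_apply, Pi.sub_apply, fw_swap, fw_swap, swp_swp, neg_sub]
  · rw [gensD_eq, gensE_eq]
    rintro _ (⟨g, hg, rfl⟩ | ⟨g, hg, rfl⟩)
    · exact fg_nonsym g (Or.inl hg)
    · exact fg_nonsym g (Or.inr hg)
  · refine ⟨?_, ?_, ?_⟩
    · rintro _ ⟨l, hl, rfl⟩
      exact ⟨l, hl, rfl⟩
    · intro f _ f' _ h
      funext v
      exact congrFun h (v.2, v.1)
    · rintro _ ⟨l, hl, rfl⟩
      exact ⟨_, ⟨l, hl, rfl⟩, rfl⟩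
  · intro T hT h
    obtain ⟨f, hf, hfT⟩ := Set.exists_of_ssubset hT
    rw [gensP_eq] at hf
    obtain ⟨g, hg, rfl⟩ := hf
    obtain ⟨Z, z1, z2⟩ := fg_dual (K := K) g hg
    have hp := fg_pure (K := K) g
    rw [← h] at hp
    refine z1 (Algebra.adjoin_le ?_ hp)
    intro f hf
    have := hT.1 hf
    rw [gensP_eq] at this
    obtain ⟨g', hg', rfl⟩ := this
    exact z2 g' hg' (by rintro rfl; exact hfT hf)
end C520

/-- The algebra `C_{5,2}(0)` has the minimal generating set
`𝒫 = 𝒫_s ⊔ 𝒫_k ⊔ 𝒫_d ⊔ 𝒫'_d` of 171 bihomogeneous polynomials: `𝒫_s` consists of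
5 symmetric polynomials, `𝒫_k` of 4 skew-symmetric ones, the 81 + 81 polynomials of
`𝒫_d` and `𝒫'_d` are neither symmetric nor skew-symmetric, `f(x,y) ↦ f(y,x)` is a
bijection from `𝒫_d` onto `𝒫'_d`, `𝒫` generates `C_{5,2}(0)` as a unital `K`-algebra,
and no proper subset of `𝒫` generates it. -/
theorem minimal_generators_C520 (K : Type*) [Field K] [CharZero K] :
    (gensP K).ncard = 171 ∧
    (gensS K).ncard = 5 ∧ (gensK K).ncard = 4 ∧
    (gensD K).ncard = 81 ∧ (gensD' K).ncard = 81 ∧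
    (∀ f ∈ gensP K, ∃ p q : ℕ, BiHomogFun0 f p q) ∧
    (∀ f ∈ gensS K, IsSymmFun0 f) ∧
    (∀ f ∈ gensK K, IsSkewFun0 f) ∧
    (∀ f ∈ gensD K ∪ gensD' K, ¬ IsSymmFun0 f ∧ ¬ IsSkewFun0 f) ∧
    Set.BijOn (fun f : sl K 5 × sl K 5 → K => fun v : sl K 5 × sl K 5 => f (v.2, v.1))
      (gensD K) (gensD' K) ∧
    Algebra.adjoin K (gensP K) = pureAlg0 K 5 ∧
    (∀ T : Set (sl K 5 × sl K 5 → K), T ⊂ gensP K →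
      Algebra.adjoin K T ≠ pureAlg0 K 5) := C520.main K
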